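/- arXiv:math/0011027 — 11 statements merged into one kernel-verified Lean document; each statement's English description precedes it below -/
import Mathlib

section
/- Assume p_1(t) ≥ p_2(t) > 0, q_1(t) ≥ q_2(t) ≥ 0 and m_1(t) ≤ m_2(t) for all t ∈ [T_1, t_0], and assume v_1(t_0) = 0. Then v_2 has at least one zero in the half-open interval (T_1, t_0]. -/
/-- Sturm-type comparison lemma (Lemma 2.4, non-strict version).
Two equations -(pᵢ vᵢ')' + qᵢ vᵢ = mᵢ vᵢ on [T₁, t₀] with Neumann-type initial
conditions vᵢ(T₁) = 1, vᵢ'(T₁) = 0.  If p₁ ≥ p₂ > 0, q₁ ≥ q₂ ≥ 0 and m₁ ≤ m₂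
on [T₁, t₀] and v₁(t₀) = 0, then v₂ vanishes somewhere in (T₁, t₀]. -/
theorem sturm_comparison_neumann
    (T₁ t₀ : ℝ) (hT : T₁ < t₀)
    (p₁ p₂ q₁ q₂ m₁ m₂ : ℝ → ℝ)
    (hp₁c : ContinuousOn p₁ (Set.Icc T₁ t₀)) (hp₂c : ContinuousOn p₂ (Set.Icc T₁ t₀))
    (hq₁c : ContinuousOn q₁ (Set.Icc T₁ t₀)) (hq₂c : ContinuousOn q₂ (Set.Icc T₁ t₀))
    (hm₁c : ContinuousOn m₁ (Set.Icc T₁ t₀)) (hm₂c : ContinuousOn m₂ (Set.Icc T₁ t₀))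
    (v₁ v₂ v₁' v₂' pv₁' pv₂' : ℝ → ℝ)
    (hv₁ : ∀ t ∈ Set.Icc T₁ t₀, HasDerivAt v₁ (v₁' t) t)
    (hv₂ : ∀ t ∈ Set.Icc T₁ t₀, HasDerivAt v₂ (v₂' t) t)
    (hpv₁ : ∀ t ∈ Set.Icc T₁ t₀, HasDerivAt (fun s => p₁ s * v₁' s) (pv₁' t) t)
    (hpv₂ : ∀ t ∈ Set.Icc T₁ t₀, HasDerivAt (fun s => p₂ s * v₂' s) (pv₂' t) t)
    (heq₁ : ∀ t ∈ Set.Icc T₁ t₀, -pv₁' t + q₁ t * v₁ t = m₁ t * v₁ t)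
    (heq₂ : ∀ t ∈ Set.Icc T₁ t₀, -pv₂' t + q₂ t * v₂ t = m₂ t * v₂ t)
    (hv₁T : v₁ T₁ = 1) (hv₁'T : v₁' T₁ = 0)
    (hv₂T : v₂ T₁ = 1) (hv₂'T : v₂' T₁ = 0)
    (hpp : ∀ t ∈ Set.Icc T₁ t₀, p₂ t ≤ p₁ t)
    (hp₂pos : ∀ t ∈ Set.Icc T₁ t₀, 0 < p₂ t)
    (hqq : ∀ t ∈ Set.Icc T₁ t₀, q₂ t ≤ q₁ t)
    (hq₂pos : ∀ t ∈ Set.Icc T₁ t₀, 0 ≤ q₂ t)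
    (hmm : ∀ t ∈ Set.Icc T₁ t₀, m₁ t ≤ m₂ t)
    (hzero : v₁ t₀ = 0) :
    ∃ t ∈ Set.Ioc T₁ t₀, v₂ t = 0 := by
  by_contra! hne
  have hpos : ∀ t ∈ Set.Icc T₁ t₀, 0 < v₂ t := by
    intro t ht
    by_contra! hle
    have hcont : ContinuousOn v₂ (Set.Icc T₁ t) := fun s hs =>
      (hv₂ s ⟨hs.1, hs.2.trans ht.2⟩).continuousAt.continuousWithinAt
    obtain ⟨s, hs, hs0⟩ := intermediate_value_Icc' ht.1 hcont
      (show (0 : ℝ) ∈ Set.Icc (v₂ t) (v₂ T₁) from ⟨hle, by rw [hv₂T]; norm_num⟩)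
    refine hne s ⟨lt_of_le_of_ne hs.1 ?_, hs.2.trans ht.2⟩ hs0
    rintro rfl
    rw [hv₂T] at hs0
    norm_num at hs0
  -- Picone identity
  have hderiv : ∀ t ∈ Set.Icc T₁ t₀,
      HasDerivAt (fun s => p₁ s * v₁' s * v₁ s - p₂ s * v₂' s * (v₁ s ^ 2 / v₂ s))
        ((q₁ t - q₂ t + (m₂ t - m₁ t)) * v₁ t ^ 2 + (p₁ t - p₂ t) * v₁' t ^ 2
          + p₂ t * (v₁' t - v₁ t * v₂' t / v₂ t) ^ 2) t := by
    intro t ht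
    have hv : v₂ t ≠ 0 := (hpos t ht).ne'
    have h₁ : pv₁' t = (q₁ t - m₁ t) * v₁ t := by linarith [heq₁ t ht]
    have h₂ : pv₂' t = (q₂ t - m₂ t) * v₂ t := by linarith [heq₂ t ht]
    refine (((hpv₁ t ht).fun_mul (hv₁ t ht)).fun_sub
      ((hpv₂ t ht).fun_mul (((hv₁ t ht).fun_pow 2).fun_div (hv₂ t ht) hv))).congr_deriv ?_
    rw [h₁, h₂]
    field_simp
    ring
  set Φ : ℝ → ℝ := fun s => p₁ s * v₁' s * v₁ s - p₂ s * v₂' s * (v₁ s ^ 2 / v₂ s) with hΦ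
  have hmono : MonotoneOn Φ (Set.Icc T₁ t₀) := by
    refine monotoneOn_of_hasDerivWithinAt_nonneg (convex_Icc _ _)
      (fun t ht => (hderiv t ht).continuousAt.continuousWithinAt)
      (fun t ht => (hderiv t (interior_subset ht)).hasDerivWithinAt) fun t ht => ?_
    have ht' := interior_subset ht
    have hq := sub_nonneg.2 (hqq t ht')
    have hm := sub_nonneg.2 (hmm t ht')
    have hp := sub_nonneg.2 (hpp t ht')
    have hp₂ := hp₂pos t ht'
    positivity
  have hΦ₁ : Φ T₁ = 0 := by simp [hΦ, hv₁'T, hv₂'T]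
  have hΦ₀ : Φ t₀ = 0 := by simp [hΦ, hzero]
  have hΦzero : ∀ t ∈ Set.Icc T₁ t₀, Φ t = 0 := fun t ht =>
    le_antisymm (hΦ₀ ▸ hmono ht (Set.right_mem_Icc.2 hT.le) ht.2)
      (hΦ₁ ▸ hmono (Set.left_mem_Icc.2 hT.le) ht ht.1)
  have hquot : ∀ t ∈ Set.Icc T₁ t₀, HasDerivAt (fun s => v₁ s / v₂ s)
      ((v₁' t * v₂ t - v₁ t * v₂' t) / v₂ t ^ 2) t := fun t ht =>
    (hv₁ t ht).fun_div (hv₂ t ht) (hpos t ht).ne'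
  obtain ⟨c, hc, hslope⟩ := exists_hasDerivAt_eq_slope (fun s => v₁ s / v₂ s)
    (fun t => (v₁' t * v₂ t - v₁ t * v₂' t) / v₂ t ^ 2) hT
    (fun t ht => (hquot t ht).continuousAt.continuousWithinAt)
    (fun t ht => hquot t (Set.Ioo_subset_Icc_self ht))
  have hc' := Set.Ioo_subset_Icc_self hc
  have hzero' := (hderiv c hc').unique <| (hasDerivAt_const c (0 : ℝ)).congr_of_eventuallyEq <|
    Filter.eventually_of_mem (Icc_mem_nhds hc.1 hc.2) hΦzero
  have hq := mul_nonneg (add_nonneg (sub_nonneg.2 (hqq c hc')) (sub_nonneg.2 (hmm c hc')))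
    (sq_nonneg (v₁ c))
  have hp := mul_nonneg (sub_nonneg.2 (hpp c hc')) (sq_nonneg (v₁' c))
  have hv : v₂ c ≠ 0 := (hpos c hc').ne'
  have hwronskian : v₁' c * v₂ c - v₁ c * v₂' c = 0 := by
    have hsq := mul_nonneg (hp₂pos c hc').le (sq_nonneg (v₁' c - v₁ c * v₂' c / v₂ c))
    have h : p₂ c * (v₁' c - v₁ c * v₂' c / v₂ c) ^ 2 = 0 := by linarith
    have h' := pow_eq_zero_iff two_ne_zero |>.1
      ((mul_eq_zero.1 h).resolve_left (hp₂pos c hc').ne')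
    field_simp at h'
    linarith
  simp only [hwronskian, hzero, hv₁T, hv₂T, zero_div, div_one, zero_sub] at hslope
  exact div_ne_zero (by norm_num) (sub_pos.2 hT).ne' hslope.symm
end

section
/- The set B_1 is an open subset of ℝ, and ψ_1 is real-valued and continuously differentiable on B_1. -/
open Set in
/-- A solution of the planar linear system `f' = b g`, `g' = c f` that vanishes at one point
vanishes identically. -/
lemma eq_zero_of_linear_system {b c f g : ℝ → ℝ} (hb : Continuous b) (hc : Continuous c)
    (hf : ∀ t, HasDerivAt f (b t * g t) t) (hg : ∀ t, HasDerivAt g (c t * f t) t)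
    {t₀ : ℝ} (hf₀ : f t₀ = 0) (hg₀ : g t₀ = 0) (s : ℝ) : f s = 0 := by
  set l := min s t₀ - 1
  set r := max s t₀ + 1
  obtain ⟨B, hB⟩ := (isCompact_Icc (a := l) (b := r)).exists_bound_of_continuousOn hb.continuousOn
  obtain ⟨C, hC⟩ := (isCompact_Icc (a := l) (b := r)).exists_bound_of_continuousOn hc.continuousOn
  have hlip : ∀ t ∈ Ioo l r, LipschitzOnWith (max B C).toNNReal
      (fun x : ℝ × ℝ => (b t * x.2, c t * x.1)) univ := by
    intro t ht
    have hbt := hB t (Ioo_subset_Icc_self ht)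
    have hct := hC t (Ioo_subset_Icc_self ht)
    refine LipschitzOnWith.of_dist_le' fun x _ y _ => ?_
    rw [Prod.dist_eq, Real.dist_eq, Real.dist_eq, ← mul_sub, ← mul_sub, abs_mul, abs_mul]
    refine max_le ?_ ?_
    · exact mul_le_mul (hbt.trans (le_max_left _ _)) (le_max_right _ _) (abs_nonneg _)
        ((norm_nonneg _).trans (hbt.trans (le_max_left _ _)))
    · exact mul_le_mul (hct.trans (le_max_right _ _)) (le_max_left _ _) (abs_nonneg _)
        ((norm_nonneg _).trans (hct.trans (le_max_right _ _)))
  have mem : ∀ x, min s t₀ ≤ x → x ≤ max s t₀ → x ∈ Ioo l r := fun x h₁ h₂ =>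
    ⟨by linarith, by linarith⟩
  have key := ODE_solution_unique_of_mem_Ioo hlip
    (mem t₀ (min_le_right _ _) (le_max_right _ _))
    (f := fun t => (f t, g t)) (g := fun _ => (0, 0))
    (fun t _ => ⟨(hf t).prodMk (hg t), mem_univ _⟩)
    (fun t _ => ⟨by simpa using! hasDerivAt_const t ((0 : ℝ), (0 : ℝ)), mem_univ _⟩)
    (by simp [hf₀, hg₀]) (mem s (min_le_left _ _) (le_max_left _ _))
  exact congrArg Prod.fst key

open Set Filter Topology in
/-- The first zero after `T₁` of a `C¹` function depends locally as a `C¹` function on a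
parameter, as long as that zero is simple. -/
lemma exists_first_zero_contDiffAt {T₁ a₀ t₀ : ℝ} {v : ℝ → ℝ → ℝ}
    (hC1 : ContDiff ℝ 1 (fun x : ℝ × ℝ => v x.1 x.2))
    (hT : T₁ < t₀) (h₀ : v a₀ t₀ = 0) (hne : ∀ t ∈ Ico T₁ t₀, v a₀ t ≠ 0)
    (hd : deriv (v a₀) t₀ ≠ 0) :
    ∃ φ : ℝ → ℝ, ContDiffAt ℝ 1 φ a₀ ∧
      ∀ᶠ a in 𝓝 a₀, IsLeast {t : ℝ | T₁ < t ∧ v a t = 0} (φ a) := by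
  set F := fun x : ℝ × ℝ => v x.1 x.2
  have hF : ContDiffAt ℝ 1 F (a₀, t₀) := hC1.contDiffAt
  have hpartial : deriv (v a₀) t₀ = fderiv ℝ F (a₀, t₀) (0, 1) := by
    have h := (hF.differentiableAt one_ne_zero).hasFDerivAt.comp_hasDerivAt t₀
      ((hasDerivAt_const t₀ a₀).prodMk (hasDerivAt_id t₀))
    exact h.deriv
  have hinv : (fderiv ℝ F (a₀, t₀) ∘L .inr ℝ ℝ ℝ).IsInvertible := by
    refine ⟨ContinuousLinearEquiv.unitsEquivAut ℝ (Units.mk0 _ (hpartial ▸ hd)), ?_⟩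
    ext
    simp
  set φ := hF.implicitFunction one_ne_zero hinv
  have hφ : ContDiffAt ℝ 1 φ a₀ := hF.contDiffAt_implicitFunction one_ne_zero hinv
  have hφ₀ : φ a₀ = t₀ := hF.implicitFunction_apply_self one_ne_zero hinv
  have hzero := hF.eventually_apply_implicitFunction one_ne_zero hinv
  have hiff := hF.eventually_apply_eq_iff_implicitFunction one_ne_zero hinv
  have htend : Tendsto φ (𝓝 a₀) (𝓝 t₀) := hφ₀ ▸ hφ.continuousAt.tendsto
  rw [nhds_prod_eq] at hiff
  obtain ⟨P, hP, Q, hQ, hPQ⟩ := eventually_prod_iff.mp hiff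
  obtain ⟨ε, hε, hQε⟩ := Metric.eventually_nhds_iff.mp hQ
  have hcompact : ∀ᶠ a in 𝓝 a₀, ∀ t ∈ Icc T₁ (t₀ - ε), v a t ≠ 0 :=
    isCompact_Icc.eventually_forall_of_forall_eventually fun t ht =>
      hC1.continuous.continuousAt.eventually_ne (hne t ⟨ht.1, by linarith [ht.2]⟩)
  refine ⟨φ, hφ, ?_⟩
  filter_upwards [hP, hzero, hcompact, htend.eventually (lt_mem_nhds hT),
    htend.eventually (gt_mem_nhds (lt_add_of_pos_right t₀ hε))] with a haP ha0 hac haT haε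
  refine ⟨⟨haT, ha0.trans h₀⟩, fun t ht => ?_⟩
  by_contra! hlt
  have hlow : t₀ - ε < t := by
    by_contra! h
    exact hac t ⟨ht.1.le, h⟩ ht.2
  have hQt : Q t := hQε (by rw [Real.dist_eq, abs_lt]; constructor <;> linarith)
  exact hlt.ne' ((hPQ haP hQt).1 (ht.2.trans h₀.symm))


/-- Property 1: `B₁` is open and the zero-function `ψ₁` is `C¹` (and real-valued) on `B₁`.
Here `v a` is the solution of `-(p v')' + q v = a m v` with `v(T₁) = 1`, `v'(T₁) = 0`,
the family being `C¹` in `(a, t)`;  `ψ₁ a = inf {t > T₁ : v a t = 0}` and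
`B₁ = {a : v a has a zero > T₁}`. -/
theorem B1_open_psi1_C1
    (T₁ p₁ : ℝ) (hp₁ : 0 < p₁)
    (p q m : ℝ → ℝ)
    (hpc : Continuous p) (hqc : Continuous q) (hmc : Continuous m)
    (hpb : ∀ t, p₁ ≤ p t) (hqb : ∀ t, 0 ≤ q t)
    (v : ℝ → ℝ → ℝ)
    (hvdiff : ∀ a, Differentiable ℝ (v a))
    (hpvdiff : ∀ a, Differentiable ℝ (fun t => p t * deriv (v a) t))
    (heq : ∀ a t, -(deriv (fun s => p s * deriv (v a) s) t) + q t * v a t = a * m t * v a t)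
    (hvT : ∀ a, v a T₁ = 1) (hv'T : ∀ a, deriv (v a) T₁ = 0)
    (hC1 : ContDiff ℝ 1 (fun x : ℝ × ℝ => v x.1 x.2)) :
    IsOpen {a : ℝ | {t : ℝ | T₁ < t ∧ v a t = 0}.Nonempty} ∧
    ContDiffOn ℝ 1 (fun a => sInf {t : ℝ | T₁ < t ∧ v a t = 0})
      {a : ℝ | {t : ℝ | T₁ < t ∧ v a t = 0}.Nonempty} := by
  have hp : ∀ t, p t ≠ 0 := fun t => (hp₁.trans_le (hpb t)).ne'
  have simple : ∀ a t, v a t = 0 → deriv (v a) t ≠ 0 := by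
    intro a t h0 hd
    have h := eq_zero_of_linear_system (b := fun s => (p s)⁻¹) (c := fun s => q s - a * m s)
      (f := v a) (g := fun s => p s * deriv (v a) s) (hpc.inv₀ hp) (by fun_prop)
      (fun s => by
        simpa only [inv_mul_cancel_left₀ (hp s)] using (hvdiff a s).hasDerivAt)
      (fun s => by
        have hs := (hpvdiff a s).hasDerivAt
        rwa [show deriv (fun s => p s * deriv (v a) s) s = (q s - a * m s) * v a s by
          linarith [heq a s]] at hs)
      h0 (by simp [hd]) T₁
    exact one_ne_zero ((hvT a).symm.trans h)
  have key : ∀ a, {t : ℝ | T₁ < t ∧ v a t = 0}.Nonempty → ∃ φ : ℝ → ℝ,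
      ContDiffAt ℝ 1 φ a ∧ ∀ᶠ b in nhds a, IsLeast {t : ℝ | T₁ < t ∧ v b t = 0} (φ b) := by
    intro a ha
    have hset : {t : ℝ | T₁ < t ∧ v a t = 0} = Set.Ici T₁ ∩ v a ⁻¹' {0} := by
      ext t
      refine ⟨fun h => ⟨h.1.le, h.2⟩, fun h => ⟨lt_of_le_of_ne h.1 ?_, h.2⟩⟩
      rintro rfl
      exact one_ne_zero ((hvT a).symm.trans h.2)
    have hclosed : IsClosed {t : ℝ | T₁ < t ∧ v a t = 0} :=
      hset ▸ isClosed_Ici.inter (isClosed_singleton.preimage (hvdiff a).continuous)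
    have hbdd : BddBelow {t : ℝ | T₁ < t ∧ v a t = 0} := ⟨T₁, fun t ht => ht.1.le⟩
    have hmem := hclosed.csInf_mem ha hbdd
    refine exists_first_zero_contDiffAt hC1 hmem.1 hmem.2 (fun t ht h0 => ?_)
      (simple a _ hmem.2)
    rw [hset] at ht hbdd
    exact ht.2.not_ge (csInf_le hbdd ⟨ht.1, h0⟩)
  refine ⟨isOpen_iff_mem_nhds.mpr fun a ha => ?_, fun a ha => ?_⟩
  · obtain ⟨φ, -, hφ⟩ := key a ha
    exact hφ.mono fun b hb => hb.nonempty
  · obtain ⟨φ, hC, hφ⟩ := key a ha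
    exact (hC.congr_of_eventuallyEq (hφ.mono fun b hb => hb.csInf_eq)).contDiffWithinAt
end

section
/- (i) If 0 ≤ a ≤ ã then ψ_1(ã) ≤ ψ_1(a); if moreover 0 ≤ a < ã and a ∈ B_1, then ã ∈ B_1 and ψ_1(ã) < ψ_1(a). (ii) If a ≤ ã ≤ 0 then ψ_1(a) ≤ ψ_1(ã); if moreover a < ã ≤ 0 and ã ∈ B_1, then a ∈ B_1 and ψ_1(a) < ψ_1(ã). That is, ψ_1 is decreasing on [0, +∞), strictly so on B_1 ∩ [0, +∞), and increasing on (−∞, 0], strictly so on B_1 ∩ (−∞, 0]. -/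
open Set Filter Topology

/-- A solution of the first-order system `u' = y / p`, `y' = c u` which vanishes at `b`
together with its flux `y` vanishes at every earlier time. -/
lemma eq_zero_of_solution_of_flux_eq_zero {p₁ T b : ℝ} (hp₁ : 0 < p₁) {p c u y : ℝ → ℝ}
    (hpb : ∀ t, p₁ ≤ p t) (hc : Continuous c)
    (hu : ∀ t, HasDerivAt u (y t / p t) t) (hy : ∀ t, HasDerivAt y (c t * u t) t)
    (hTb : T ≤ b) (hub : u b = 0) (hyb : y b = 0) : u T = 0 := by
  obtain ⟨C, hC⟩ := (isCompact_Icc (a := T) (b := b)).exists_bound_of_continuousOn hc.continuousOn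
  set K := 1 / p₁ + C with hK
  have hder (t : ℝ) : HasDerivAt (fun t => (u t ^ 2 + y t ^ 2) * Real.exp (K * t))
      ((2 * (u t * y t) * (1 / p t + c t) + K * (u t ^ 2 + y t ^ 2)) * Real.exp (K * t)) t := by
    have hexp : HasDerivAt (fun t => Real.exp (K * t)) (Real.exp (K * t) * K) t := by
      simpa using ((hasDerivAt_id t).const_mul K).exp
    refine ((((hu t).pow 2).add ((hy t).pow 2)).mul hexp).congr_deriv ?_
    simp only [Pi.add_apply, Pi.pow_apply]
    push_cast
    ring
  have hmono : MonotoneOn (fun t => (u t ^ 2 + y t ^ 2) * Real.exp (K * t)) (Icc T b) := by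
    refine monotoneOn_of_hasDerivWithinAt_nonneg (convex_Icc T b)
      (fun t _ => (hder t).continuousAt.continuousWithinAt)
      (fun t _ => (hder t).hasDerivWithinAt) (fun t ht => ?_)
    rw [interior_Icc] at ht
    have hp : 0 < p t := hp₁.trans_le (hpb t)
    have hCt : |c t| ≤ C := hC t ⟨ht.1.le, ht.2.le⟩
    have hinv : 1 / p t ≤ 1 / p₁ := one_div_le_one_div_of_le hp₁ (hpb t)
    have hcoef : |1 / p t + c t| ≤ K := by
      refine (abs_add_le _ _).trans ?_
      rw [abs_of_pos (by positivity : 0 < 1 / p t)]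
      exact add_le_add hinv hCt
    have huy : |2 * (u t * y t)| ≤ u t ^ 2 + y t ^ 2 := by
      rw [abs_le]
      constructor <;> nlinarith [sq_nonneg (u t - y t), sq_nonneg (u t + y t)]
    have hprod := mul_le_mul huy hcoef (abs_nonneg _) (by positivity)
    rw [← abs_mul] at hprod
    have := (abs_le.1 hprod).1
    exact mul_nonneg (by linarith) (Real.exp_pos _).le
  have hle := hmono ⟨le_rfl, hTb⟩ ⟨hTb, le_rfl⟩ hTb
  simp only [hub, hyb] at hle
  have hE : u T ^ 2 + y T ^ 2 ≤ 0 := by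
    by_contra! h
    have := mul_pos h (Real.exp_pos (K * T))
    norm_num at hle
    linarith
  nlinarith [sq_nonneg (u T), sq_nonneg (y T)]

/-- Picone-type comparison: strictly before any zero of the solution with parameter `a ≥ 0`,
the solution with a larger parameter has a zero. The weight `m` may change sign. -/
lemma exists_zero_of_lt_parameter {p₁ T b a a' : ℝ} (hp₁ : 0 < p₁) {p q m u y w z : ℝ → ℝ}
    (hpb : ∀ t, p₁ ≤ p t) (hq : Continuous q) (hm : Continuous m) (hqb : ∀ t, 0 ≤ q t)
    (hu : ∀ t, HasDerivAt u (y t / p t) t) (hy : ∀ t, HasDerivAt y ((q t - a * m t) * u t) t)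
    (hw : ∀ t, HasDerivAt w (z t / p t) t) (hz : ∀ t, HasDerivAt z ((q t - a' * m t) * w t) t)
    (huT : u T = 1) (hyT : y T = 0) (hwT : w T = 1) (hzT : z T = 0)
    (ha : 0 ≤ a) (haa' : a < a') (hTb : T < b) (hub : u b = 0) :
    ∃ t, (T < t ∧ w t = 0) ∧ t < b := by
  by_contra! hno
  have hp (t : ℝ) : 0 < p t := hp₁.trans_le (hpb t)
  have hwc : Continuous w := continuous_iff_continuousAt.2 fun t => (hw t).continuousAt
  have huc : Continuous u := continuous_iff_continuousAt.2 fun t => (hu t).continuousAt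
  have hyc : Continuous y := continuous_iff_continuousAt.2 fun t => (hy t).continuousAt
  have hzc : Continuous z := continuous_iff_continuousAt.2 fun t => (hz t).continuousAt
  have hw0 : ∀ t ∈ Ico T b, w t ≠ 0 := by
    intro t ht h0
    rcases ht.1.eq_or_lt with rfl | hTt
    · simp [hwT] at h0
    · exact (hno t ⟨hTt, h0⟩).not_gt ht.2
  set H : ℝ → ℝ := fun t => a' * (u t * y t) - a * (u t * (u t / w t) * z t) with hH
  set H' : ℝ → ℝ := fun t => (a' - a) * (y t ^ 2 / p t + q t * u t ^ 2)
    + a * p t * (y t / p t - u t * z t / (p t * w t)) ^ 2 with hH'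
  have hder : ∀ t ∈ Ico T b, HasDerivAt H (H' t) t := by
    intro t ht
    have hwt := hw0 t ht
    have hpt := (hp t).ne'
    refine ((((hu t).mul (hy t)).const_mul a').sub
      ((((hu t).mul ((hu t).div (hw t) hwt)).mul (hz t)).const_mul a)).congr_deriv ?_
    simp only [hH', Pi.mul_apply, Pi.div_apply]
    field_simp
    ring
  have hH'nonneg : ∀ t, (a' - a) * (y t ^ 2 / p t) ≤ H' t := by
    intro t
    have h1 : 0 ≤ (a' - a) * (q t * u t ^ 2) :=
      mul_nonneg (sub_nonneg.2 haa'.le) (mul_nonneg (hqb t) (sq_nonneg _))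
    have h2 : 0 ≤ a * p t * (y t / p t - u t * z t / (p t * w t)) ^ 2 :=
      mul_nonneg (mul_nonneg ha (hp t).le) (sq_nonneg _)
    simp only [hH']
    linarith
  have hsq (t : ℝ) : 0 ≤ (a' - a) * (y t ^ 2 / p t) :=
    mul_nonneg (sub_nonneg.2 haa'.le) (div_nonneg (sq_nonneg _) (hp t).le)
  have hmono : MonotoneOn H (Ico T b) :=
    monotoneOn_of_hasDerivWithinAt_nonneg (convex_Ico T b)
      (fun t ht => (hder t ht).continuousAt.continuousWithinAt)
      (fun t ht => (hder t (interior_subset ht)).hasDerivWithinAt)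
      (fun t _ => (hsq t).trans (hH'nonneg t))
  have hratio : ∃ l, Tendsto (fun t => u t / w t) (𝓝[<] b) (𝓝 l) := by
    by_cases hwb : w b = 0
    · have hzb : z b ≠ 0 := by
        intro hzb
        have := eq_zero_of_solution_of_flux_eq_zero hp₁ hpb
          (hq.sub (continuous_const.mul hm)) hw hz hTb.le hwb hzb
        simp [hwT] at this
      have hzp : z b / p b ≠ 0 := div_ne_zero hzb (hp b).ne'
      have hsu := (hasDerivAt_iff_tendsto_slope.1 (hu b)).mono_left
        (nhdsWithin_mono b (fun t (ht : t < b) => ht.ne))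
      have hsw := (hasDerivAt_iff_tendsto_slope.1 (hw b)).mono_left
        (nhdsWithin_mono b (fun t (ht : t < b) => ht.ne))
      refine ⟨_, (hsu.div hsw hzp).congr' ?_⟩
      filter_upwards [self_mem_nhdsWithin] with t ht
      have : t - b ≠ 0 := sub_ne_zero.2 (ne_of_lt ht)
      simp only [slope_def_field, hub, hwb, sub_zero, Pi.div_apply]
      exact div_div_div_cancel_right₀ this _ _
    · exact ⟨_, ((huc.tendsto b).div (hwc.tendsto b) hwb).mono_left nhdsWithin_le_nhds⟩
  have hlim : Tendsto H (𝓝[<] b) (𝓝 0) := by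
    obtain ⟨l, hl⟩ := hratio
    have hu' := (huc.tendsto b).mono_left (nhdsWithin_le_nhds (s := Iio b))
    have hy' := (hyc.tendsto b).mono_left (nhdsWithin_le_nhds (s := Iio b))
    have hz' := (hzc.tendsto b).mono_left (nhdsWithin_le_nhds (s := Iio b))
    have := ((hu'.mul hy').const_mul a').sub (((hu'.mul hl).mul hz').const_mul a)
    simpa [hub] using this
  have hHzero : ∀ t ∈ Ico T b, H t = 0 := by
    intro t ht
    refine le_antisymm (ge_of_tendsto hlim ?_) ?_
    · filter_upwards [Ioo_mem_nhdsLT ht.2] with s hs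
      exact hmono ht ⟨ht.1.trans hs.1.le, hs.2⟩ hs.1.le
    · have := hmono ⟨le_rfl, hTb⟩ ht ht.1
      simpa [hH, hyT, hzT] using this
  have hy0 : ∀ t ∈ Ioo T b, y t = 0 := by
    intro t ht
    have h0 : H' t = 0 := by
      refine (hder t ⟨ht.1.le, ht.2⟩).unique ((hasDerivAt_const t (0 : ℝ)).congr_of_eventuallyEq ?_)
      filter_upwards [Ioo_mem_nhds ht.1 ht.2] with s hs
      exact hHzero s ⟨hs.1.le, hs.2⟩
    have h1 := le_antisymm ((hH'nonneg t).trans h0.le) (hsq t)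
    simpa [(sub_pos.2 haa').ne', (hp t).ne'] using h1
  obtain ⟨t, ht, hslope⟩ := exists_hasDerivAt_eq_slope u (fun t => y t / p t) hTb
    huc.continuousOn (fun t _ => hu t)
  rw [hy0 t ht, hub, huT, zero_div, eq_comm, div_eq_zero_iff] at hslope
  rcases hslope with h | h <;> linarith

/-- The infimum of the zeros after `T` of a continuous function not vanishing at `T`
is again such a zero. -/
lemma sInf_zeros_mem {T : ℝ} {f : ℝ → ℝ} (hf : Continuous f) (hfT : f T ≠ 0)
    (hne : {t : ℝ | T < t ∧ f t = 0}.Nonempty) :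
    sInf {t : ℝ | T < t ∧ f t = 0} ∈ {t : ℝ | T < t ∧ f t = 0} := by
  have hbdd : BddBelow {t : ℝ | T < t ∧ f t = 0} := ⟨T, fun t ht => ht.1.le⟩
  have hzero : f (sInf {t : ℝ | T < t ∧ f t = 0}) = 0 :=
    closure_minimal (fun t ht => ht.2) (isClosed_eq hf continuous_const)
      (csInf_mem_closure hne hbdd)
  refine ⟨lt_of_le_of_ne (le_csInf hne fun t ht => ht.1.le) fun h => hfT ?_, hzero⟩
  rw [← h] at hzero
  exact hzero

/-- If each zero of `f` after `T` is strictly preceded by a zero of `g` after `T`, then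
the first zero of `g` strictly precedes that of `f`. -/
lemma sInf_zeros_lt {T : ℝ} {f g : ℝ → ℝ} (hf : Continuous f) (hfT : f T ≠ 0)
    (h : ∀ b, T < b → f b = 0 → ∃ t, (T < t ∧ g t = 0) ∧ t < b)
    (hne : {t : ℝ | T < t ∧ f t = 0}.Nonempty) :
    {t : ℝ | T < t ∧ g t = 0}.Nonempty ∧
      sInf {t : ℝ | T < t ∧ g t = 0} < sInf {t : ℝ | T < t ∧ f t = 0} := by
  obtain ⟨hT, h0⟩ := sInf_zeros_mem hf hfT hne
  obtain ⟨t, ht, hlt⟩ := h _ hT h0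
  exact ⟨⟨t, ht⟩, (csInf_le ⟨T, fun s hs => hs.1.le⟩ ht).trans_lt hlt⟩

/-- Property 2 (monotonicity of `ψ₁`): `ψ₁` is decreasing on `[0, ∞)`, strictly on
`B₁ ∩ [0, ∞)`, and increasing on `(-∞, 0]`, strictly on `B₁ ∩ (-∞, 0]`.
Here `ψ₁ a = inf {t > T₁ : v a t = 0}` (equal to `+∞` when the zero set is empty,
which is expressed below by membership of the zero set in `Nonempty`). -/
theorem psi1_monotone
    (T₁ p₁ : ℝ) (hp₁ : 0 < p₁)
    (p q m : ℝ → ℝ)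
    (hpc : Continuous p) (hqc : Continuous q) (hmc : Continuous m)
    (hpb : ∀ t, p₁ ≤ p t) (hqb : ∀ t, 0 ≤ q t)
    (v : ℝ → ℝ → ℝ)
    (hvdiff : ∀ a, Differentiable ℝ (v a))
    (hpvdiff : ∀ a, Differentiable ℝ (fun t => p t * deriv (v a) t))
    (heq : ∀ a t, -(deriv (fun s => p s * deriv (v a) s) t) + q t * v a t = a * m t * v a t)
    (hvT : ∀ a, v a T₁ = 1) (hv'T : ∀ a, deriv (v a) T₁ = 0) :
    (∀ a a2 : ℝ, 0 ≤ a → a ≤ a2 →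
      {t : ℝ | T₁ < t ∧ v a t = 0}.Nonempty →
        {t : ℝ | T₁ < t ∧ v a2 t = 0}.Nonempty ∧
        sInf {t : ℝ | T₁ < t ∧ v a2 t = 0} ≤ sInf {t : ℝ | T₁ < t ∧ v a t = 0}) ∧
    (∀ a a2 : ℝ, 0 ≤ a → a < a2 →
      {t : ℝ | T₁ < t ∧ v a t = 0}.Nonempty →
        {t : ℝ | T₁ < t ∧ v a2 t = 0}.Nonempty ∧
        sInf {t : ℝ | T₁ < t ∧ v a2 t = 0} < sInf {t : ℝ | T₁ < t ∧ v a t = 0}) ∧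
    (∀ a a2 : ℝ, a ≤ a2 → a2 ≤ 0 →
      {t : ℝ | T₁ < t ∧ v a2 t = 0}.Nonempty →
        {t : ℝ | T₁ < t ∧ v a t = 0}.Nonempty ∧
        sInf {t : ℝ | T₁ < t ∧ v a t = 0} ≤ sInf {t : ℝ | T₁ < t ∧ v a2 t = 0}) ∧
    (∀ a a2 : ℝ, a < a2 → a2 ≤ 0 →
      {t : ℝ | T₁ < t ∧ v a2 t = 0}.Nonempty →
        {t : ℝ | T₁ < t ∧ v a t = 0}.Nonempty ∧
        sInf {t : ℝ | T₁ < t ∧ v a t = 0} < sInf {t : ℝ | T₁ < t ∧ v a2 t = 0}) := by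
  have hp (t : ℝ) : p t ≠ 0 := (hp₁.trans_le (hpb t)).ne'
  have hv (a t : ℝ) : HasDerivAt (v a) (p t * deriv (v a) t / p t) t := by
    rw [mul_div_cancel_left₀ _ (hp t)]
    exact (hvdiff a t).hasDerivAt
  have hflux (a t : ℝ) :
      HasDerivAt (fun s => p s * deriv (v a) s) ((q t - a * m t) * v a t) t := by
    refine (hpvdiff a t).hasDerivAt.congr_deriv ?_
    linarith [heq a t]
  have hflux' (a t : ℝ) :
      HasDerivAt (fun s => p s * deriv (v a) s) ((q t - -a * -m t) * v a t) t := by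
    simpa using hflux a t
  have hfluxT (a : ℝ) : p T₁ * deriv (v a) T₁ = 0 := by rw [hv'T, mul_zero]
  have hvne (a : ℝ) : v a T₁ ≠ 0 := by simp [hvT]
  have hpos (a a2 : ℝ) (ha : 0 ≤ a) (h : a < a2) :=
    sInf_zeros_lt (g := v a2) (hvdiff a).continuous (hvne a) fun b hb h0 =>
      exists_zero_of_lt_parameter hp₁ hpb hqc hmc hqb (hv a) (hflux a) (hv a2) (hflux a2)
        (hvT a) (hfluxT a) (hvT a2) (hfluxT a2) ha h hb h0
  have hneg (a a2 : ℝ) (h : a < a2) (ha : a2 ≤ 0) :=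
    sInf_zeros_lt (g := v a) (hvdiff a2).continuous (hvne a2) fun b hb h0 =>
      exists_zero_of_lt_parameter hp₁ hpb hqc hmc.neg hqb (hv a2) (hflux' a2) (hv a) (hflux' a)
        (hvT a2) (hfluxT a2) (hvT a) (hfluxT a) (neg_nonneg.2 ha) (neg_lt_neg h) hb h0
  refine ⟨fun a a2 ha h hne => ?_, hpos, fun a a2 h ha hne => ?_, hneg⟩
  · rcases h.eq_or_lt with rfl | h
    · exact ⟨hne, le_rfl⟩
    · exact (hpos a a2 ha h hne).imp_right le_of_lt
  · rcases h.eq_or_lt with rfl | h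
    · exact ⟨hne, le_rfl⟩
    · exact (hneg a a2 h ha hne).imp_right le_of_lt
end

section
/- For every a ∈ B_1 with a > 0, ψ_1 is differentiable at a with ψ_1'(a) < 0; for every a ∈ B_1 with a < 0, ψ_1 is differentiable at a with ψ_1'(a) > 0. -/
open Set Filter Topology

/-- The least zero to the right of `T` of a continuous function that is positive at `T`. -/
theorem sInf_zeros_spec {f : ℝ → ℝ} {T : ℝ} (hf : Continuous f) (hT : 0 < f T)
    (hne : {t : ℝ | T < t ∧ f t = 0}.Nonempty) :
    (T < sInf {t : ℝ | T < t ∧ f t = 0} ∧ f (sInf {t : ℝ | T < t ∧ f t = 0}) = 0) ∧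
      ∀ t, T ≤ t → t < sInf {t : ℝ | T < t ∧ f t = 0} → 0 < f t := by
  have hbdd : BddBelow {t : ℝ | T < t ∧ f t = 0} := ⟨T, fun t ht => ht.1.le⟩
  have hclosed : IsClosed {t : ℝ | T < t ∧ f t = 0} := by
    have : {t : ℝ | T < t ∧ f t = 0} = Ici T ∩ f ⁻¹' {0} := by
      ext t
      simp only [mem_ofPred_eq, mem_inter_iff, mem_Ici, mem_preimage, mem_singleton_iff]
      refine ⟨fun h => ⟨h.1.le, h.2⟩, fun h => ⟨h.1.lt_of_ne ?_, h.2⟩⟩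
      rintro rfl
      exact hT.ne' h.2
    rw [this]
    exact isClosed_Ici.inter (isClosed_singleton.preimage hf)
  refine ⟨hclosed.csInf_mem hne hbdd, fun t hTt ht => ?_⟩
  by_contra! hneg
  obtain ⟨s, hs, hs0⟩ := intermediate_value_Icc' hTt hf.continuousOn ⟨hneg, hT.le⟩
  have hTs : T < s := hs.1.lt_of_ne (by rintro rfl; exact hT.ne' hs0)
  exact absurd (csInf_le hbdd ⟨hTs, hs0⟩) (not_le.2 (hs.2.trans_lt ht))

/-- A function with negative derivative at a zero takes negative values arbitrarily close to
the right of it. -/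
theorem HasDerivAt.exists_mem_Ioo_neg {f : ℝ → ℝ} {b B u : ℝ} (hf : HasDerivAt f B b) (hb : f b = 0)
    (hB : B < 0) (hu : b < u) : ∃ t ∈ Ioo b u, f t < 0 := by
  have h := (hf.tendsto_slope.mono_left (nhdsGT_le_nhdsNE b)).eventually_lt_const hB
  obtain ⟨t, ht, htu⟩ := (h.and (Ioo_mem_nhdsGT hu)).exists
  refine ⟨t, htu, ?_⟩
  rw [slope_def_field, hb, sub_zero] at ht
  by_contra! hneg
  exact absurd ht (not_lt.2 (div_nonneg hneg (sub_nonneg.2 htu.1.le)))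

/-- The least zero to the right of `T` depends continuously on the parameter where it is a
transversal zero. -/
theorem tendsto_sInf_zeros {f : ℝ → ℝ → ℝ} {T a b B : ℝ}
    (hf : Continuous fun x : ℝ × ℝ => f x.1 x.2)
    (hTb : T < b) (hb : f a b = 0) (hpos : ∀ t, T ≤ t → t < b → 0 < f a t)
    (hB : HasDerivAt (f a) B b) (hB0 : B < 0) :
    (∀ᶠ c in 𝓝 a, {t : ℝ | T < t ∧ f c t = 0}.Nonempty) ∧
      Tendsto (fun c => sInf {t : ℝ | T < t ∧ f c t = 0}) (𝓝 a) (𝓝 b) := by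
  have hcont : ∀ t, Continuous fun c => f c t := fun t =>
    hf.comp (continuous_id.prodMk continuous_const)
  have hzero : ∀ u, b < u → ∀ᶠ c in 𝓝 a, ∃ t, (T < t ∧ f c t = 0) ∧ t < u := by
    intro u hu
    obtain ⟨t, ht, hneg⟩ := hB.exists_mem_Ioo_neg hb hB0 hu
    filter_upwards [(hcont t).continuousAt.eventually_lt_const hneg,
      (hcont T).continuousAt.eventually_const_lt (hpos T le_rfl hTb)] with c h1 h2
    obtain ⟨s, hs, hs0⟩ := intermediate_value_Ioo' (hTb.trans ht.1).le
      (hf.comp (continuous_const.prodMk continuous_id)).continuousOn ⟨h1, h2⟩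
    exact ⟨s, ⟨hs.1, hs0⟩, hs.2.trans ht.2⟩
  have hne : ∀ᶠ c in 𝓝 a, {t : ℝ | T < t ∧ f c t = 0}.Nonempty :=
    (hzero (b + 1) (lt_add_one b)).mono fun c ⟨t, ht, _⟩ => ⟨t, ht⟩
  refine ⟨hne, tendsto_order.2 ⟨fun l hl => ?_, fun u hu => ?_⟩⟩
  · obtain ⟨l', hl', hl'b⟩ := exists_between hl
    have hK : ∀ᶠ c in 𝓝 a, ∀ t ∈ Icc T l', 0 < f c t :=
      isCompact_Icc.eventually_forall_of_forall_eventually fun t ht =>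
        hf.continuousAt.eventually_const_lt (hpos t ht.1 (ht.2.trans_lt hl'b))
    filter_upwards [hK, hne] with c hc hcne
    refine hl'.trans_le (le_csInf hcne fun t ht => ?_)
    by_contra! hlt
    exact (hc t ⟨ht.1.le, hlt.le⟩).ne' ht.2
  · filter_upwards [hzero u hu] with c ⟨t, ht, htu⟩
    exact (csInf_le ⟨T, fun s hs => hs.1.le⟩ ht).trans_lt htu

/-- The least zero to the right of `T` is differentiable in the parameter where it is a
transversal zero. -/
theorem hasDerivAt_sInf_zeros {f : ℝ → ℝ → ℝ} {T a b A B : ℝ}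
    (hf : ContDiff ℝ 1 fun x : ℝ × ℝ => f x.1 x.2)
    (hTb : T < b) (hb : f a b = 0) (hpos : ∀ t, T ≤ t → t < b → 0 < f a t)
    (hA : HasDerivAt (fun c => f c b) A a) (hB : HasDerivAt (f a) B b) (hB0 : B < 0) :
    HasDerivAt (fun c => sInf {t : ℝ | T < t ∧ f c t = 0}) (-A / B) a := by
  obtain ⟨hne, htend⟩ := tendsto_sInf_zeros hf.continuous hTb hb hpos hB hB0
  have hval : sInf {t : ℝ | T < t ∧ f a t = 0} = b :=
    le_antisymm (csInf_le ⟨T, fun s hs => hs.1.le⟩ ⟨hTb, hb⟩)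
      (le_csInf ⟨b, hTb, hb⟩ fun t ht => by
        by_contra! h
        exact (hpos t ht.1.le h).ne' ht.2)
  have hstrict := hf.contDiffAt.hasStrictFDerivAt (x := (a, b)) one_ne_zero
  set D := fderiv ℝ (fun x : ℝ × ℝ => f x.1 x.2) (a, b)
  have hDA : D (1, 0) = A := by
    refine HasDerivAt.unique (f := fun c => f c b) ?_ hA
    exact HasFDerivAt.comp_hasDerivAt (f := fun c => (c, b)) a hstrict.hasFDerivAt
      ((hasDerivAt_id a).prodMk (hasDerivAt_const a b))
  have hDB : D (0, 1) = B := by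
    refine HasDerivAt.unique (f := f a) ?_ hB
    exact HasFDerivAt.comp_hasDerivAt (f := fun t => (a, t)) b hstrict.hasFDerivAt
      ((hasDerivAt_const b a).prodMk (hasDerivAt_id b))
  have hinv : (D ∘L .inr ℝ ℝ ℝ).IsInvertible := by
    refine ⟨ContinuousLinearEquiv.unitsEquivAut ℝ (Units.mk0 B hB0.ne), ?_⟩
    ext
    simp [hDB]
  have hφ := (hstrict.hasStrictFDerivAt_implicitFunctionOfProdDomain hinv).hasFDerivAt.hasDerivAt
  have hφval :=
    (hstrict.eventually_apply_eq_iff_implicitFunctionOfProdDomain hinv).self_of_nhds.1 rfl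
  have hφeq := hstrict.eventually_apply_implicitFunctionOfProdDomain hinv
  have hφuniq := hstrict.eventually_apply_eq_iff_implicitFunctionOfProdDomain hinv
  set φ := hstrict.implicitFunctionOfProdDomain hinv
  set d := (-(D ∘L .inr ℝ ℝ ℝ).inverse ∘L (D ∘L .inl ℝ ℝ ℝ)) 1
  have hψφ : (fun c => sInf {t : ℝ | T < t ∧ f c t = 0}) =ᶠ[𝓝 a] φ := by
    filter_upwards [(tendsto_id.prodMk_nhds htend).eventually hφuniq, hne,
      (hf.continuous.comp (continuous_id.prodMk continuous_const)).continuousAt.eventually_const_lt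
        (hpos T le_rfl hTb)] with c hc hcne hcT
    have hz := (sInf_zeros_spec (hf.continuous.comp (continuous_const.prodMk continuous_id))
      hcT hcne).1.2
    exact (hc.1 (hz.trans hb.symm)).symm
  have hchain : HasDerivAt (fun c => f c (φ c)) (D (1, d)) a := by
    have h : HasFDerivAt (fun x : ℝ × ℝ => f x.1 x.2) D (id a, φ a) := by
      rw [hφval]; exact hstrict.hasFDerivAt
    exact h.comp_hasDerivAt a ((hasDerivAt_id a).prodMk hφ)
  have hzero : D (1, d) = 0 :=
    hchain.unique ((hasDerivAt_const a (f a b)).congr_of_eventuallyEq hφeq)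
  have hlin : D (1, d) = A + d * B := by
    rw [← hDA, ← hDB, ← smul_eq_mul, ← map_smul, ← map_add]
    simp
  have hd : d = -A / B := by
    rw [eq_div_iff hB0.ne]
    linarith
  exact hd ▸ hφ.congr_of_eventuallyEq hψφ

/-- The Lagrange identity for the Wronskian of two solutions belonging to different parameters. -/
theorem hasDerivAt_wronskian {p q m u w : ℝ → ℝ} {a c t : ℝ}
    (hu : Differentiable ℝ u) (hw : Differentiable ℝ w)
    (hpu : Differentiable ℝ fun t => p t * deriv u t)
    (hpw : Differentiable ℝ fun t => p t * deriv w t)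
    (hequ : -(deriv (fun s => p s * deriv u s) t) + q t * u t = a * m t * u t)
    (heqw : -(deriv (fun s => p s * deriv w s) t) + q t * w t = c * m t * w t) :
    HasDerivAt (fun s => p s * deriv u s * w s - p s * deriv w s * u s)
      ((c - a) * (m t * u t * w t)) t := by
  have h := ((hpu t).hasDerivAt.mul (hw t).hasDerivAt).sub
    ((hpw t).hasDerivAt.mul (hu t).hasDerivAt)
  refine h.congr_deriv ?_
  linear_combination (-w t) * hequ + u t * heqw

/-- The energy identity for a solution. -/
theorem hasDerivAt_energy {p q m u : ℝ → ℝ} {a t : ℝ}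
    (hu : Differentiable ℝ u) (hpu : Differentiable ℝ fun t => p t * deriv u t)
    (hequ : -(deriv (fun s => p s * deriv u s) t) + q t * u t = a * m t * u t) :
    HasDerivAt (fun s => p s * deriv u s * u s)
      (p t * deriv u t ^ 2 + q t * u t ^ 2 - a * (m t * u t * u t)) t := by
  refine ((hpu t).hasDerivAt.mul (hu t).hasDerivAt).congr_deriv ?_
  linear_combination (-u t) * hequ

theorem continuous_deriv_of_differentiable_mul {p u : ℝ → ℝ}
    (hp : Continuous p) (hp0 : ∀ t, 0 < p t)
    (hpu : Differentiable ℝ fun t => p t * deriv u t) : Continuous (deriv u) := by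
  have hne : ∀ t, p t ≠ 0 := fun t => (hp0 t).ne'
  have h : deriv u = fun t => p t * deriv u t / p t := by
    ext t
    rw [mul_div_cancel_left₀ _ (hne t)]
  rw [h]
  exact hpu.continuous.div hp hne

/-- A solution with a zero at the right end and a critical point at the left end, not identically
zero, has a weighted mass of the same sign as the parameter. -/
theorem mul_integral_weight_pos {p q m u : ℝ → ℝ} {a T b : ℝ}
    (hp : Continuous p) (hq : Continuous q) (hm : Continuous m)
    (hp0 : ∀ t, 0 < p t) (hq0 : ∀ t, 0 ≤ q t)
    (hu : Differentiable ℝ u) (hpu : Differentiable ℝ fun t => p t * deriv u t)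
    (hequ : ∀ t, -(deriv (fun s => p s * deriv u s) t) + q t * u t = a * m t * u t)
    (hTb : T < b) (huT : u T ≠ 0) (hu'T : deriv u T = 0) (hub : u b = 0) :
    0 < a * ∫ t in T..b, m t * u t * u t := by
  have hu' := continuous_deriv_of_differentiable_mul hp hp0 hpu
  have huc := hu.continuous
  have hc1 : Continuous fun t => p t * deriv u t ^ 2 + q t * u t ^ 2 := by fun_prop
  have hc2 : Continuous fun t => a * (m t * u t * u t) := by fun_prop
  have hint := intervalIntegral.integral_eq_sub_of_hasDerivAt (a := T) (b := b)
    (fun t _ => hasDerivAt_energy hu hpu (hequ t)) ((hc1.sub hc2).intervalIntegrable T b)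
  rw [intervalIntegral.integral_sub (hc1.intervalIntegrable T b) (hc2.intervalIntegrable T b),
    intervalIntegral.integral_const_mul, hu'T, hub] at hint
  have hpos : 0 < ∫ t in T..b, p t * deriv u t ^ 2 + q t * u t ^ 2 := by
    refine intervalIntegral.integral_pos hTb hc1.continuousOn (fun t _ => ?_) ?_
    · have := (hp0 t).le
      have := hq0 t
      positivity
    · obtain ⟨ξ, hξ, hslope⟩ := exists_deriv_eq_slope u hTb huc.continuousOn hu.differentiableOn
      have hne : deriv u ξ ≠ 0 := by
        rw [hslope, hub, zero_sub]
        exact div_ne_zero (neg_ne_zero.2 huT) (sub_pos.2 hTb).ne'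
      have h1 := hp0 ξ
      have h2 := hq0 ξ
      exact ⟨ξ, Ioo_subset_Icc_self hξ, by positivity⟩
  linarith


/-- Property 3: on `B₁`, `ψ₁` is differentiable with `ψ₁'(a) < 0` for `a > 0`
and `ψ₁'(a) > 0` for `a < 0`. -/
theorem psi1_deriv_sign
    (T₁ p₁ : ℝ) (hp₁ : 0 < p₁)
    (p q m : ℝ → ℝ)
    (hpc : Continuous p) (hqc : Continuous q) (hmc : Continuous m)
    (hpb : ∀ t, p₁ ≤ p t) (hqb : ∀ t, 0 ≤ q t)
    (v : ℝ → ℝ → ℝ)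
    (hvdiff : ∀ a, Differentiable ℝ (v a))
    (hpvdiff : ∀ a, Differentiable ℝ (fun t => p t * deriv (v a) t))
    (heq : ∀ a t, -(deriv (fun s => p s * deriv (v a) s) t) + q t * v a t = a * m t * v a t)
    (hvT : ∀ a, v a T₁ = 1) (hv'T : ∀ a, deriv (v a) T₁ = 0)
    (hC1 : ContDiff ℝ 1 (fun x : ℝ × ℝ => v x.1 x.2)) :
    ∀ a : ℝ, {t : ℝ | T₁ < t ∧ v a t = 0}.Nonempty →
      (0 < a → ∃ d : ℝ, d < 0 ∧
        HasDerivAt (fun b => sInf {t : ℝ | T₁ < t ∧ v b t = 0}) d a) ∧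
      (a < 0 → ∃ d : ℝ, 0 < d ∧
        HasDerivAt (fun b => sInf {t : ℝ | T₁ < t ∧ v b t = 0}) d a) := by
  intro a hne
  have hp0 : ∀ t, 0 < p t := fun t => hp₁.trans_le (hpb t)
  have hvc := fun c => (hvdiff c).continuous
  obtain ⟨⟨hTb, hb⟩, hpos⟩ := sInf_zeros_spec (hvc a) (T := T₁) (by simp [hvT]) hne
  set b := sInf {t : ℝ | T₁ < t ∧ v a t = 0}
  have hmass := mul_integral_weight_pos hpc hqc hmc hp0 hqb (hvdiff a) (hpvdiff a) (heq a) hTb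
    (by simp [hvT]) (hv'T a) hb
  set I := ∫ t in T₁..b, m t * v a t * v a t
  obtain ⟨A, hA⟩ : ∃ A, HasDerivAt (fun c => v c b) A a :=
    ⟨_, ((hC1.differentiable one_ne_zero).comp
      (differentiable_id.prodMk (differentiable_const b)) a).hasDerivAt⟩
  have hgreen : ∀ c, p b * deriv (v a) b * v c b = (c - a) * ∫ t in T₁..b, m t * v a t * v c t := by
    intro c
    have hcont : Continuous fun t => (c - a) * (m t * v a t * v c t) := by
      have := hvc a
      have := hvc c
      fun_prop
    have h := intervalIntegral.integral_eq_sub_of_hasDerivAt (a := T₁) (b := b)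
      (fun t _ => hasDerivAt_wronskian (hvdiff a) (hvdiff c) (hpvdiff a) (hpvdiff c)
        (heq a t) (heq c t)) (hcont.intervalIntegrable T₁ b)
    rw [intervalIntegral.integral_const_mul] at h
    simpa [hb, hv'T] using h.symm
  have hgreen_deriv : p b * deriv (v a) b * A = I := by
    have hJ : Continuous fun c => ∫ t in T₁..b, m t * v a t * v c t := by
      refine intervalIntegral.continuous_parametric_intervalIntegral_of_continuous' ?_ T₁ b
      exact ((hmc.comp continuous_snd).mul ((hvc a).comp continuous_snd)).mul hC1.continuous
    refine tendsto_nhds_unique ((hA.tendsto_slope).const_mul (p b * deriv (v a) b))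
      ((hJ.tendsto a).mono_left nhdsWithin_le_nhds |>.congr' ?_)
    filter_upwards [self_mem_nhdsWithin] with c hc
    rw [slope_def_field, hb, sub_zero, mul_div_assoc', hgreen c,
      mul_div_cancel_left₀ _ (sub_ne_zero.2 hc)]
  have hI0 : I ≠ 0 := right_ne_zero_of_mul hmass.ne'
  have hB := (hvdiff a b).hasDerivAt
  have hB0 : deriv (v a) b < 0 := by
    have hne0 : deriv (v a) b ≠ 0 := fun h => hI0 (by rw [← hgreen_deriv, h]; ring)
    refine lt_of_le_of_ne ?_ hne0
    refine le_of_tendsto (hB.tendsto_slope.mono_left (nhdsLT_le_nhdsNE b)) ?_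
    filter_upwards [Ioo_mem_nhdsLT hTb] with t ht
    rw [slope_def_field, hb, sub_zero]
    exact div_nonpos_of_nonneg_of_nonpos (hpos t ht.1.le ht.2).le (sub_nonpos.2 ht.2.le)
  have hψ := hasDerivAt_sInf_zeros hC1 hTb hb hpos hA hB hB0
  have hc : p b * deriv (v a) b < 0 := mul_neg_of_pos_of_neg (hp0 b) hB0
  refine ⟨fun ha => ⟨_, ?_, hψ⟩, fun ha => ⟨_, ?_, hψ⟩⟩
  · have hI : 0 < I := pos_of_mul_pos_right hmass ha.le
    have hAneg : A < 0 := by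
      by_contra! h
      exact absurd (hgreen_deriv ▸ hI) (not_lt.2 (mul_nonpos_of_nonpos_of_nonneg hc.le h))
    exact div_neg_of_pos_of_neg (neg_pos.2 hAneg) hB0
  · have hI : I < 0 := by
      by_contra! h
      exact absurd hmass (not_lt.2 (mul_nonpos_of_nonpos_of_nonneg ha.le h))
    have hApos : 0 < A := by
      by_contra! h
      exact absurd (hgreen_deriv ▸ hI) (not_lt.2 (mul_nonneg_of_nonpos_of_nonpos hc.le h))
    exact div_pos_of_neg_of_neg (neg_neg_of_pos hApos) hB0
end

section
/- Let a ≥ 0 and suppose v(t_0; a) = 0 for some t_0 > T_1. Then there exists s with T_1 < s < t_0 and m(s) > 0. In particular, for every a ≥ 0 one has ψ_1(a) ≥ inf{t > T_1 : m(t) > 0}, with strict inequality whenever a ∈ B_1. -/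
/-- The zeros of a continuous function to the right of a point where it does not vanish have a
least element, if there are any. -/
theorem isLeast_sInf_zeros_right {u : ℝ → ℝ} (hu : Continuous u) {T : ℝ} (hT : u T ≠ 0)
    (hne : {t : ℝ | T < t ∧ u t = 0}.Nonempty) :
    IsLeast {t : ℝ | T < t ∧ u t = 0} (sInf {t : ℝ | T < t ∧ u t = 0}) := by
  have hset : {t : ℝ | T < t ∧ u t = 0} = Set.Ici T ∩ u ⁻¹' {0} := by
    ext t
    simp only [Set.mem_ofPred_eq, Set.mem_inter_iff, Set.mem_Ici, Set.mem_preimage,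
      Set.mem_singleton_iff]
    refine ⟨fun h => ⟨h.1.le, h.2⟩, fun h => ⟨h.1.lt_of_ne ?_, h.2⟩⟩
    rintro rfl
    exact hT h.2
  have hbdd : BddBelow {t : ℝ | T < t ∧ u t = 0} := ⟨T, fun t ht => ht.1.le⟩
  refine ⟨?_, fun t ht => csInf_le hbdd ht⟩
  have hclosed : IsClosed {t : ℝ | T < t ∧ u t = 0} :=
    hset ▸ isClosed_Ici.inter (isClosed_singleton.preimage hu)
  exact hclosed.csInf_mem hne hbdd

/-- If `(p u')' = r u` with `p > 0`, `u T > 0` and `u' T = 0`, then `r` is negative somewhere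
between `T` and the first zero of `u` to the right of `T`. -/
theorem exists_neg_coeff_before_first_zero {p r u : ℝ → ℝ} {T t₁ : ℝ} (hp : ∀ t, 0 < p t)
    (hu : Differentiable ℝ u) (hpu : Differentiable ℝ (fun t => p t * deriv u t))
    (heq : ∀ t, deriv (fun s => p s * deriv u s) t = r t * u t)
    (huT : 0 < u T) (hu'T : deriv u T = 0)
    (ht₁ : IsLeast {t : ℝ | T < t ∧ u t = 0} t₁) :
    ∃ s, T < s ∧ s < t₁ ∧ r s < 0 := by
  by_contra! hr
  obtain ⟨⟨hTt₁, hut₁⟩, hleast⟩ := ht₁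
  have hpos : ∀ t, T ≤ t → t < t₁ → 0 < u t := by
    intro t hTt htt₁
    by_contra! hneg
    obtain ⟨x, hx, hux⟩ := intermediate_value_Icc' hTt hu.continuous.continuousOn ⟨hneg, huT.le⟩
    have hTx : T < x := hx.1.lt_of_ne (by rintro rfl; exact huT.ne' hux)
    exact absurd (hleast ⟨hTx, hux⟩) (not_le.2 (hx.2.trans_lt htt₁))
  have hflux : MonotoneOn (fun t => p t * deriv u t) (Set.Icc T t₁) := by
    refine monotoneOn_of_deriv_nonneg (convex_Icc T t₁) hpu.continuous.continuousOn
      hpu.differentiableOn fun t ht => ?_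
    rw [interior_Icc] at ht
    rw [heq]
    exact mul_nonneg (hr t ht.1 ht.2) (hpos t ht.1.le ht.2).le
  have hmono : MonotoneOn u (Set.Icc T t₁) := by
    refine monotoneOn_of_deriv_nonneg (convex_Icc T t₁) hu.continuous.continuousOn
      hu.differentiableOn fun t ht => ?_
    rw [interior_Icc] at ht
    have h := hflux (Set.left_mem_Icc.2 hTt₁.le) (Set.Ioo_subset_Icc_self ht) ht.1.le
    simp only [hu'T, mul_zero] at h
    exact nonneg_of_mul_nonneg_right h (hp t)
  have h := hmono (Set.left_mem_Icc.2 hTt₁.le) (Set.right_mem_Icc.2 hTt₁.le) hTt₁.le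
  linarith

/-- Lemma 2.5 (i): for `a ≥ 0`, any zero `t₀ > T₁` of `v a` is preceded by a point
where `m > 0`; consequently `ψ₁(a) ≥ inf {t > T₁ : m t > 0}`, with strict inequality
when `a ∈ B₁`. -/
theorem psi1_lower_bound_pos
    (T₁ p₁ : ℝ) (hp₁ : 0 < p₁)
    (p q m : ℝ → ℝ)
    (hpc : Continuous p) (hqc : Continuous q) (hmc : Continuous m)
    (hpb : ∀ t, p₁ ≤ p t) (hqb : ∀ t, 0 ≤ q t)
    (v : ℝ → ℝ → ℝ)
    (hvdiff : ∀ a, Differentiable ℝ (v a))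
    (hpvdiff : ∀ a, Differentiable ℝ (fun t => p t * deriv (v a) t))
    (heq : ∀ a t, -(deriv (fun s => p s * deriv (v a) s) t) + q t * v a t = a * m t * v a t)
    (hvT : ∀ a, v a T₁ = 1) (hv'T : ∀ a, deriv (v a) T₁ = 0) :
    (∀ a : ℝ, 0 ≤ a → ∀ t₀ : ℝ, T₁ < t₀ → v a t₀ = 0 →
      ∃ s : ℝ, T₁ < s ∧ s < t₀ ∧ 0 < m s) ∧
    (∀ a : ℝ, 0 ≤ a → {t : ℝ | T₁ < t ∧ v a t = 0}.Nonempty →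
      {t : ℝ | T₁ < t ∧ 0 < m t}.Nonempty ∧
      sInf {t : ℝ | T₁ < t ∧ 0 < m t} < sInf {t : ℝ | T₁ < t ∧ v a t = 0}) := by
  have key : ∀ a : ℝ, 0 ≤ a → {t : ℝ | T₁ < t ∧ v a t = 0}.Nonempty →
      ∃ s : ℝ, T₁ < s ∧ s < sInf {t : ℝ | T₁ < t ∧ v a t = 0} ∧ 0 < m s := by
    intro a ha hne
    obtain ⟨s, hTs, hs, hneg⟩ := exists_neg_coeff_before_first_zero (r := fun t => q t - a * m t)
      (fun t => hp₁.trans_le (hpb t)) (hvdiff a) (hpvdiff a)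
      (fun t => by linear_combination -heq a t) (by simp [hvT]) (hv'T a)
      (isLeast_sInf_zeros_right (hvdiff a).continuous (by simp [hvT]) hne)
    exact ⟨s, hTs, hs, pos_of_mul_pos_right (by linarith [hqb s] : 0 < a * m s) ha⟩
  refine ⟨fun a ha t₀ ht₀ hvt₀ => ?_, fun a ha hne => ?_⟩
  · obtain ⟨s, hTs, hs, hms⟩ := key a ha ⟨t₀, ht₀, hvt₀⟩
    exact ⟨s, hTs, hs.trans_le (csInf_le ⟨T₁, fun t ht => ht.1.le⟩ ⟨ht₀, hvt₀⟩), hms⟩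
  · obtain ⟨s, hTs, hs, hms⟩ := key a ha hne
    exact ⟨⟨s, hTs, hms⟩,
      lt_of_le_of_lt (csInf_le ⟨T₁, fun t ht => ht.1.le⟩ ⟨hTs, hms⟩) hs⟩
end

section
/- Let a ≤ 0 and suppose v(t_0; a) = 0 for some t_0 > T_1. Then there exists s with T_1 < s < t_0 and m(s) < 0. In particular, for every a ≤ 0 one has ψ_1(a) ≥ inf{t > T_1 : m(t) < 0}, with strict inequality whenever a ∈ B_1. -/
/-- If `-(p v')' + g v = 0` with `p > 0` and `g ≥ 0` on `(c, d)`, and `v'(c) = 0`, then `v ^ 2` is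
nondecreasing on `[c, d]`. -/
theorem monotoneOn_sq_of_sturmLiouville {c d : ℝ} {p g v : ℝ → ℝ}
    (hp : ∀ t, 0 < p t) (hg : ∀ t ∈ Set.Ioo c d, 0 ≤ g t)
    (hv : Differentiable ℝ v) (hpv : Differentiable ℝ (fun t => p t * deriv v t))
    (heq : ∀ t, deriv (fun s => p s * deriv v s) t = g t * v t) (hc : deriv v c = 0) :
    MonotoneOn (fun t => v t ^ 2) (Set.Icc c d) := by
  have hflux : MonotoneOn (fun t => v t * (p t * deriv v t)) (Set.Icc c d) := by
    refine monotoneOn_of_deriv_nonneg (convex_Icc c d) (hv.mul hpv).continuous.continuousOn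
      (hv.mul hpv).differentiableOn fun t ht => ?_
    rw [interior_Icc] at ht
    have hd := (hv t).hasDerivAt.mul (hpv t).hasDerivAt
    rw [heq t] at hd
    have hderiv : deriv (fun t => v t * (p t * deriv v t)) t =
        deriv v t * (p t * deriv v t) + v t * (g t * v t) := hd.deriv
    rw [hderiv]
    have h₁ := mul_nonneg (hp t).le (sq_nonneg (deriv v t))
    have h₂ := mul_nonneg (hg t ht) (sq_nonneg (v t))
    linarith
  refine monotoneOn_of_deriv_nonneg (convex_Icc c d) (hv.pow 2).continuous.continuousOn
    (hv.pow 2).differentiableOn fun t ht => ?_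
  rw [interior_Icc] at ht
  have hderiv : deriv (fun t => v t ^ 2) t = 2 * (v t * deriv v t) := by
    rw [((hv t).hasDerivAt.fun_pow 2).deriv]
    push_cast
    ring
  have hle : v c * (p c * deriv v c) ≤ v t * (p t * deriv v t) :=
    hflux (Set.left_mem_Icc.2 (ht.1.trans ht.2).le) (Set.Ioo_subset_Icc_self ht) ht.1.le
  have hprod : 0 ≤ p t * (v t * deriv v t) := by
    rw [hc] at hle
    linarith
  rw [hderiv]
  linarith [nonneg_of_mul_nonneg_right hprod (hp t)]

/-- The infimum of the zeros to the right of `c` of a continuous function that does not vanish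
at `c` is again such a zero. -/
theorem csInf_zeros_mem {c : ℝ} {f : ℝ → ℝ} (hf : Continuous f) (hc : f c ≠ 0)
    (hne : {t : ℝ | c < t ∧ f t = 0}.Nonempty) :
    sInf {t : ℝ | c < t ∧ f t = 0} ∈ {t : ℝ | c < t ∧ f t = 0} := by
  have hset : {t : ℝ | c < t ∧ f t = 0} = Set.Ici c ∩ f ⁻¹' {0} := by
    ext t
    refine ⟨fun h => ⟨h.1.le, h.2⟩, fun h => ⟨lt_of_le_of_ne h.1 ?_, h.2⟩⟩
    rintro rfl
    exact hc h.2
  have hclosed : IsClosed {t : ℝ | c < t ∧ f t = 0} := by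
    rw [hset]
    exact isClosed_Ici.inter (isClosed_singleton.preimage hf)
  exact hclosed.csInf_mem hne ⟨c, fun t ht => ht.1.le⟩

/-- Lemma 2.5 (ii): for `a ≤ 0`, any zero `t₀ > T₁` of `v a` is preceded by a point
where `m < 0`; consequently `ψ₁(a) ≥ inf {t > T₁ : m t < 0}`, with strict inequality
when `a ∈ B₁`. -/
theorem psi1_lower_bound_neg
    (T₁ p₁ : ℝ) (hp₁ : 0 < p₁)
    (p q m : ℝ → ℝ)
    (hpc : Continuous p) (hqc : Continuous q) (hmc : Continuous m)
    (hpb : ∀ t, p₁ ≤ p t) (hqb : ∀ t, 0 ≤ q t)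
    (v : ℝ → ℝ → ℝ)
    (hvdiff : ∀ a, Differentiable ℝ (v a))
    (hpvdiff : ∀ a, Differentiable ℝ (fun t => p t * deriv (v a) t))
    (heq : ∀ a t, -(deriv (fun s => p s * deriv (v a) s) t) + q t * v a t = a * m t * v a t)
    (hvT : ∀ a, v a T₁ = 1) (hv'T : ∀ a, deriv (v a) T₁ = 0) :
    (∀ a : ℝ, a ≤ 0 → ∀ t₀ : ℝ, T₁ < t₀ → v a t₀ = 0 →
      ∃ s : ℝ, T₁ < s ∧ s < t₀ ∧ m s < 0) ∧
    (∀ a : ℝ, a ≤ 0 → {t : ℝ | T₁ < t ∧ v a t = 0}.Nonempty →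
      {t : ℝ | T₁ < t ∧ m t < 0}.Nonempty ∧
      sInf {t : ℝ | T₁ < t ∧ m t < 0} < sInf {t : ℝ | T₁ < t ∧ v a t = 0}) := by
  have key : ∀ a : ℝ, a ≤ 0 → ∀ t₀ : ℝ, T₁ < t₀ → v a t₀ = 0 →
      ∃ s : ℝ, T₁ < s ∧ s < t₀ ∧ m s < 0 := by
    intro a ha t₀ ht₀ hzero
    by_contra! hm
    have hmono := monotoneOn_sq_of_sturmLiouville (d := t₀) (g := fun t => q t - a * m t)
      (fun t => hp₁.trans_le (hpb t))
      (fun t ht => by linarith [hqb t, mul_nonneg (neg_nonneg.2 ha) (hm t ht.1 ht.2)])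
      (hvdiff a) (hpvdiff a) (fun t => by linarith [heq a t]) (hv'T a)
    have hle : v a T₁ ^ 2 ≤ v a t₀ ^ 2 :=
      hmono (Set.left_mem_Icc.2 ht₀.le) (Set.right_mem_Icc.2 ht₀.le) ht₀.le
    rw [hvT, hzero] at hle
    norm_num at hle
  refine ⟨key, fun a ha hne => ?_⟩
  obtain ⟨hlt, hzero⟩ := csInf_zeros_mem (hvdiff a).continuous (by rw [hvT]; exact one_ne_zero) hne
  obtain ⟨s, hs, hst, hms⟩ := key a ha _ hlt hzero
  have hbdd : BddBelow {t : ℝ | T₁ < t ∧ m t < 0} := ⟨T₁, fun t ht => ht.1.le⟩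
  exact ⟨⟨s, hs, hms⟩, (csInf_le hbdd ⟨hs, hms⟩).trans_lt hst⟩
end

section
/- Let a ∈ ℝ and let u be the solution of Lu = a m u with u(T_1) = 0 and u'(T_1) = 1. If u has a zero t_0 > T_1, then v(·; a) has at least one zero in the open interval (T_1, t_0). In particular, ψ_1(a) is always ≤ the first zero > T_1 of u (taken to be +∞ if u has none), with strict inequality when u has a zero > T_1. -/
/-- The Wronskian of two solutions of `-(p y')' + q y = r y` is constant. -/
theorem sturmLiouville_wronskian_eq {p q r u w : ℝ → ℝ}
    (hu : Differentiable ℝ u) (hpu : Differentiable ℝ (fun t => p t * deriv u t))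
    (hueq : ∀ t, -(deriv (fun s => p s * deriv u s) t) + q t * u t = r t * u t)
    (hw : Differentiable ℝ w) (hpw : Differentiable ℝ (fun t => p t * deriv w t))
    (hweq : ∀ t, -(deriv (fun s => p s * deriv w s) t) + q t * w t = r t * w t) (x y : ℝ) :
    p x * (deriv u x * w x - u x * deriv w x) = p y * (deriv u y * w y - u y * deriv w y) := by
  have hder : ∀ t, HasDerivAt
      (fun t => (p t * deriv u t) * w t - u t * (p t * deriv w t)) 0 t := by
    intro t
    refine (((hpu t).hasDerivAt.mul (hw t).hasDerivAt).sub
      ((hu t).hasDerivAt.mul (hpw t).hasDerivAt)).congr_deriv ?_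
    linear_combination u t * hweq t - w t * hueq t
  have h := is_const_of_deriv_eq_zero (fun t => (hder t).differentiableAt)
    (fun t => (hder t).deriv) x y
  linear_combination h

/-- If the Wronskian of `u` and `w` never vanishes, then between two zeros of `u` there is a
zero of `w`. -/
theorem exists_zero_between_of_wronskian_ne_zero {u w : ℝ → ℝ} (hu : Differentiable ℝ u)
    (hw : Differentiable ℝ w) (hW : ∀ t, deriv u t * w t - u t * deriv w t ≠ 0)
    {x y : ℝ} (hxy : x < y) (hx : u x = 0) (hy : u y = 0) :
    ∃ s, x < s ∧ s < y ∧ w s = 0 := by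
  by_contra! hne
  have hend : ∀ t, u t = 0 → w t ≠ 0 := fun t hut hwt => hW t (by simp [hut, hwt])
  have hne' : ∀ t ∈ Set.Icc x y, w t ≠ 0 := by
    rintro t ⟨h₁, h₂⟩
    rcases h₁.eq_or_lt with rfl | h₁
    · exact hend _ hx
    rcases h₂.eq_or_lt with rfl | h₂
    · exact hend _ hy
    exact hne t h₁ h₂
  obtain ⟨c, hc, hc'⟩ := exists_hasDerivAt_eq_zero (f := fun t => u t / w t) hxy
    (hu.continuous.continuousOn.div hw.continuous.continuousOn hne') (by simp [hx, hy])
    (fun t ht => (hu t).hasDerivAt.div (hw t).hasDerivAt (hne' t (Set.Ioo_subset_Icc_self ht)))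
  have hwc := hne' c (Set.Ioo_subset_Icc_self hc)
  exact hW c ((div_eq_zero_iff.mp hc').resolve_right (pow_ne_zero 2 hwc))


/-- Lemma 2.6: if `u` is the solution of `Lu = a m u` with `u(T₁) = 0`, `u'(T₁) = 1`
and `u` vanishes at some `t₀ > T₁`, then `v a` vanishes in `(T₁, t₀)`; in particular
`ψ₁(a)` is strictly less than the first zero `> T₁` of `u` whenever the latter exists. -/
theorem psi1_le_phi
    (T₁ p₁ : ℝ) (hp₁ : 0 < p₁)
    (p q m : ℝ → ℝ)
    (hpc : Continuous p) (hqc : Continuous q) (hmc : Continuous m)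
    (hpb : ∀ t, p₁ ≤ p t) (hqb : ∀ t, 0 ≤ q t)
    (v : ℝ → ℝ → ℝ)
    (hvdiff : ∀ a, Differentiable ℝ (v a))
    (hpvdiff : ∀ a, Differentiable ℝ (fun t => p t * deriv (v a) t))
    (heq : ∀ a t, -(deriv (fun s => p s * deriv (v a) s) t) + q t * v a t = a * m t * v a t)
    (hvT : ∀ a, v a T₁ = 1) (hv'T : ∀ a, deriv (v a) T₁ = 0) :
    ∀ a : ℝ, ∀ u : ℝ → ℝ,
      Differentiable ℝ u →
      Differentiable ℝ (fun t => p t * deriv u t) →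
      (∀ t, -(deriv (fun s => p s * deriv u s) t) + q t * u t = a * m t * u t) →
      u T₁ = 0 → deriv u T₁ = 1 →
      (∀ t₀ : ℝ, T₁ < t₀ → u t₀ = 0 → ∃ s : ℝ, T₁ < s ∧ s < t₀ ∧ v a s = 0) ∧
      ({t : ℝ | T₁ < t ∧ u t = 0}.Nonempty →
        {t : ℝ | T₁ < t ∧ v a t = 0}.Nonempty ∧
        sInf {t : ℝ | T₁ < t ∧ v a t = 0} < sInf {t : ℝ | T₁ < t ∧ u t = 0}) := by
  intro a u hu hpu hueq huT hu'T
  have hW : ∀ t, deriv u t * v a t - u t * deriv (v a) t ≠ 0 := by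
    intro t ht
    have h := sturmLiouville_wronskian_eq (r := fun t => a * m t) hu hpu hueq
      (hvdiff a) (hpvdiff a) (heq a) t T₁
    rw [ht, huT, hu'T, hvT] at h
    linarith [hpb T₁]
  have hzero : ∀ t₀ : ℝ, T₁ < t₀ → u t₀ = 0 → ∃ s : ℝ, T₁ < s ∧ s < t₀ ∧ v a s = 0 :=
    fun _ ht₀ hut₀ =>
      exists_zero_between_of_wronskian_ne_zero hu (hvdiff a) hW ht₀ huT hut₀
  refine ⟨hzero, fun hne => ?_⟩
  have hvev : ∀ᶠ t in nhds T₁, v a t ≠ 0 :=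
    (hvdiff a).continuous.continuousAt.eventually_ne (by simp [hvT])
  obtain ⟨δ, hδ, hball⟩ := Metric.eventually_nhds_iff.mp hvev
  have hlow : ∀ t ∈ {t : ℝ | T₁ < t ∧ u t = 0}, T₁ + δ ≤ t := by
    rintro t ⟨ht, hut⟩
    obtain ⟨s, hs, hst, hvs⟩ := hzero t ht hut
    by_contra! hlt
    refine hball ?_ hvs
    rw [Real.dist_eq, abs_of_pos (by linarith)]
    linarith
  have hgt : T₁ < sInf {t : ℝ | T₁ < t ∧ u t = 0} := by
    linarith [le_csInf hne hlow]
  have hu0 : u (sInf {t : ℝ | T₁ < t ∧ u t = 0}) = 0 :=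
    closure_minimal (t := {t | u t = 0}) (fun _ ht => ht.2)
      (isClosed_eq hu.continuous continuous_const) (csInf_mem_closure hne ⟨T₁ + δ, hlow⟩)
  obtain ⟨s, hs, hlt, hvs⟩ := hzero _ hgt hu0
  exact ⟨⟨s, hs, hvs⟩, lt_of_le_of_lt
    (csInf_le ⟨T₁, fun _ ht => ht.1.le⟩ ⟨hs, hvs⟩) hlt⟩
end

section
/- Suppose the set {t > T_1 : m(t) > 0} is nonempty and let α := inf{t > T_1 : m(t) > 0}. Then ψ_1(a) → α as a → +∞; that is, for every ε > 0 there exists A ∈ ℝ such that for all a ≥ A one has a ∈ B_1 and α ≤ ψ_1(a) < α + ε. -/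
/-- If `(p u')' = g u` with `p > 0` and `g ≥ 0` on `(T, β)`, and `u T = 1`, `u' T = 0`, then
`u² ≥ 1` on `[T, β]`. -/
theorem one_le_sq_of_nonneg_potential {T β : ℝ} {p g u : ℝ → ℝ} (hT : T ≤ β)
    (hp : ∀ t, 0 < p t) (hu : Differentiable ℝ u)
    (hw : ∀ t, HasDerivAt (fun s => p s * deriv u s) (g t * u t) t)
    (hg : ∀ t ∈ Set.Ioo T β, 0 ≤ g t) (huT : u T = 1) (hu'T : deriv u T = 0) :
    1 ≤ u β ^ 2 := by
  have hd : ∀ t, HasDerivAt (fun s => u s * (p s * deriv u s))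
      (deriv u t * (p t * deriv u t) + u t * (g t * u t)) t :=
    fun t => (hu t).hasDerivAt.mul (hw t)
  have hmono : MonotoneOn (fun s => u s * (p s * deriv u s)) (Set.Icc T β) := by
    refine monotoneOn_of_deriv_nonneg (convex_Icc T β)
      (fun t _ => (hd t).continuousAt.continuousWithinAt)
      (fun t _ => (hd t).differentiableAt.differentiableWithinAt) fun t ht => ?_
    rw [interior_Icc] at ht
    rw [(hd t).deriv]
    nlinarith [mul_nonneg (hp t).le (sq_nonneg (deriv u t)),
      mul_nonneg (hg t ht) (sq_nonneg (u t))]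
  have hd2 : ∀ t, HasDerivAt (fun s => u s ^ 2) (2 * (u t * deriv u t)) t := fun t => by
    simpa [mul_assoc] using (hu t).hasDerivAt.fun_pow 2
  have hmono2 : MonotoneOn (fun s => u s ^ 2) (Set.Icc T β) := by
    refine monotoneOn_of_deriv_nonneg (convex_Icc T β)
      (fun t _ => (hd2 t).continuousAt.continuousWithinAt)
      (fun t _ => (hd2 t).differentiableAt.differentiableWithinAt) fun t ht => ?_
    rw [interior_Icc] at ht
    rw [(hd2 t).deriv]
    have h := hmono (Set.left_mem_Icc.2 hT) (Set.Ioo_subset_Icc_self ht) ht.1.le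
    simp only [hu'T, mul_zero] at h
    have h' : 0 ≤ p t * (u t * deriv u t) := by linarith
    linarith [nonneg_of_mul_nonneg_right h' (hp t)]
  simpa [huT] using hmono2 (Set.left_mem_Icc.2 hT) (Set.right_mem_Icc.2 hT) hT

/-- Sturm comparison through Picone's inequality: if `(p u')' = g u` with `0 ≤ p ≤ P` and
`g ≤ -(P (π / (d - c))² + 1)` on `(c, d)`, then `u` vanishes in `[c, d]`. -/
theorem exists_zero_of_potential_le {c d P : ℝ} {p g u : ℝ → ℝ} (hcd : c < d)
    (hp : ∀ t, 0 ≤ p t) (hpP : ∀ t, p t ≤ P) (hu : Differentiable ℝ u)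
    (hw : ∀ t, HasDerivAt (fun s => p s * deriv u s) (g t * u t) t)
    (hg : ∀ t ∈ Set.Ioo c d, g t ≤ -(P * (Real.pi / (d - c)) ^ 2 + 1)) :
    ∃ t ∈ Set.Icc c d, u t = 0 := by
  by_contra! hne
  set k : ℝ := Real.pi / (d - c) with hk
  have hkd : k * (d - c) = Real.pi := div_mul_cancel₀ _ (sub_pos.2 hcd).ne'
  have hk0 : 0 < k := div_pos Real.pi_pos (sub_pos.2 hcd)
  have hlin : ∀ t, HasDerivAt (fun s => k * (s - c)) k t := fun t => by
    simpa using ((hasDerivAt_id t).sub_const c).const_mul k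
  set S : ℝ → ℝ := fun s => Real.sin (k * (s - c)) with hS
  set C : ℝ → ℝ := fun s => Real.cos (k * (s - c)) with hC
  have hSd : ∀ t, HasDerivAt S (C t * k) t := fun t => (hlin t).sin
  have hCd : ∀ t, HasDerivAt C (-S t * k) t := fun t => (hlin t).cos
  set F : ℝ → ℝ := fun s => S s ^ 2 * ((p s * deriv u s) / u s) - P * k * (S s * C s) with hF
  have hd : ∀ t ∈ Set.Icc c d, HasDerivAt F
      (2 * S t * (C t * k) * ((p t * deriv u t) / u t) +
        S t ^ 2 * ((g t * u t * u t - p t * deriv u t * deriv u t) / u t ^ 2) -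
        P * k * (C t * k * C t + S t * (-S t * k))) t := fun t ht => by
    have h1 : HasDerivAt (fun s => S s ^ 2) (2 * S t * (C t * k)) t := by
      simpa using (hSd t).fun_pow 2
    exact (h1.mul ((hw t).div (hu t).hasDerivAt (hne t ht))).sub
      (((hSd t).mul (hCd t)).const_mul (P * k))
  have hanti : StrictAntiOn F (Set.Icc c d) := by
    refine strictAntiOn_of_deriv_neg (convex_Icc c d)
      (fun t ht => (hd t ht).continuousAt.continuousWithinAt) fun t ht => ?_
    rw [interior_Icc] at ht
    have ht' := Set.Ioo_subset_Icc_self ht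
    rw [(hd t ht').deriv]
    have hut := hne t ht'
    have hSpos : 0 < S t :=
      Real.sin_pos_of_pos_of_lt_pi (mul_pos hk0 (sub_pos.2 ht.1))
        (by rw [← hkd]; exact mul_lt_mul_of_pos_left (by linarith [ht.2]) hk0)
    have key : 2 * S t * (C t * k) * ((p t * deriv u t) / u t) +
        S t ^ 2 * ((g t * u t * u t - p t * deriv u t * deriv u t) / u t ^ 2) -
        P * k * (C t * k * C t + S t * (-S t * k)) =
        -(p t * (k * C t - S t * (deriv u t / u t)) ^ 2) - (P - p t) * (k * C t) ^ 2 +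
          S t ^ 2 * (g t + P * k ^ 2) := by
      field_simp
      ring
    rw [key]
    have h1 := mul_nonneg (hp t) (sq_nonneg (k * C t - S t * (deriv u t / u t)))
    have h2 := mul_nonneg (sub_nonneg.2 (hpP t)) (sq_nonneg (k * C t))
    have h3 : S t ^ 2 * (g t + P * k ^ 2) < 0 :=
      mul_neg_of_pos_of_neg (pow_pos hSpos 2) (by linarith [hg t ht])
    linarith
  have hlt := hanti (Set.left_mem_Icc.2 hcd.le) (Set.right_mem_Icc.2 hcd.le) hcd
  have hSc : S c = 0 := by simp [hS]
  have hSdd : S d = 0 := by simp [hS, hkd]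
  simp [hF, hSc, hSdd] at hlt


/-- Property 4 (i): if `{t > T₁ : m t > 0}` is nonempty with infimum `α`, then
`ψ₁(a) → α` as `a → +∞`: for every `ε > 0` there is `A` such that for all `a ≥ A`,
`a ∈ B₁` and `α ≤ ψ₁(a) < α + ε`. -/
theorem psi1_tendsto_at_top
    (T₁ p₁ p₂ q₂ : ℝ) (hp₁ : 0 < p₁)
    (p q m : ℝ → ℝ)
    (hpc : Continuous p) (hqc : Continuous q) (hmc : Continuous m)
    (hpb : ∀ t, p₁ ≤ p t) (hpb2 : ∀ t, p t ≤ p₂)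
    (hqb : ∀ t, 0 ≤ q t) (hqb2 : ∀ t, q t ≤ q₂)
    (v : ℝ → ℝ → ℝ)
    (hvdiff : ∀ a, Differentiable ℝ (v a))
    (hpvdiff : ∀ a, Differentiable ℝ (fun t => p t * deriv (v a) t))
    (heq : ∀ a t, -(deriv (fun s => p s * deriv (v a) s) t) + q t * v a t = a * m t * v a t)
    (hvT : ∀ a, v a T₁ = 1) (hv'T : ∀ a, deriv (v a) T₁ = 0)
    (hne : {t : ℝ | T₁ < t ∧ 0 < m t}.Nonempty) :
    ∀ ε : ℝ, 0 < ε → ∃ A : ℝ, ∀ a : ℝ, A ≤ a →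
      {t : ℝ | T₁ < t ∧ v a t = 0}.Nonempty ∧
      sInf {t : ℝ | T₁ < t ∧ 0 < m t} ≤ sInf {t : ℝ | T₁ < t ∧ v a t = 0} ∧
      sInf {t : ℝ | T₁ < t ∧ v a t = 0} < sInf {t : ℝ | T₁ < t ∧ 0 < m t} + ε := by

  intro ε hε
  set α := sInf {t : ℝ | T₁ < t ∧ 0 < m t} with hα
  have hbdd : BddBelow {t : ℝ | T₁ < t ∧ 0 < m t} := ⟨T₁, fun t ht => ht.1.le⟩
  have hw : ∀ a t, HasDerivAt (fun s => p s * deriv (v a) s) ((q t - a * m t) * v a t) t :=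
    fun a t => by
      have h := (hpvdiff a t).hasDerivAt
      rwa [show deriv (fun s => p s * deriv (v a) s) t = (q t - a * m t) * v a t by
        linarith [heq a t]] at h
  obtain ⟨b, ⟨hb, hmb⟩, hbα⟩ := exists_lt_of_csInf_lt hne (show α < α + ε by linarith)
  have hev : ∀ᶠ t in nhds b, T₁ < t ∧ m b / 2 < m t ∧ t < α + ε :=
    (eventually_gt_nhds hb).and
      ((hmc.continuousAt.eventually_const_lt (half_lt_self hmb)).and (eventually_lt_nhds hbα))
  obtain ⟨r, hr, hball⟩ := Metric.eventually_nhds_iff_ball.1 hev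
  have hIcc : ∀ t ∈ Set.Icc b (b + r / 2), T₁ < t ∧ m b / 2 < m t ∧ t < α + ε := fun t ht =>
    hball t (by rw [Metric.mem_ball, Real.dist_eq, abs_of_nonneg] <;> linarith [ht.1, ht.2])
  set K := p₂ * (Real.pi / (b + r / 2 - b)) ^ 2 + 1 with hK
  refine ⟨max 0 ((q₂ + K) / (m b / 2)), fun a ha => ?_⟩
  have ha0 : 0 ≤ a := (le_max_left _ _).trans ha
  have haK : q₂ + K ≤ a * (m b / 2) :=
    (div_le_iff₀ (half_pos hmb)).1 ((le_max_right _ _).trans ha)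
  obtain ⟨z, hz, hvz⟩ := exists_zero_of_potential_le (show b < b + r / 2 by linarith)
    (fun t => (hp₁.trans_le (hpb t)).le) hpb2 (hvdiff a) (hw a) fun t ht => by
      have h := mul_le_mul_of_nonneg_left (hIcc t (Set.Ioo_subset_Icc_self ht)).2.1.le ha0
      linarith [hqb2 t]
  have hzI := hIcc z hz
  have hmem : z ∈ {t : ℝ | T₁ < t ∧ v a t = 0} := ⟨hzI.1, hvz⟩
  refine ⟨⟨z, hmem⟩, le_csInf ⟨z, hmem⟩ fun t ht => ?_,
    (csInf_le ⟨T₁, fun t ht => ht.1.le⟩ hmem).trans_lt hzI.2.2⟩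
  by_contra! hlt
  have h1 := one_le_sq_of_nonneg_potential ht.1.le (fun s => hp₁.trans_le (hpb s)) (hvdiff a)
    (hw a) (fun s hs => by
      have hms : m s ≤ 0 := by
        by_contra! hpos
        linarith [csInf_le hbdd (show s ∈ {t : ℝ | T₁ < t ∧ 0 < m t} from ⟨hs.1, hpos⟩), hs.2]
      linarith [hqb s, mul_nonpos_of_nonneg_of_nonpos ha0 hms]) (hvT a) (hv'T a)
  rw [ht.2] at h1
  norm_num at h1
end

section
/- ψ_1(a) → +∞ as a → 0; that is, for every R > 0 there exists δ > 0 such that for every a with |a| < δ, the function v(·; a) has no zero in the interval (T_1, T_1 + R], i.e. ψ_1(a) > T_1 + R. -/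
/-- First-order form of a Sturm comparison: if `w = p v'` and `w' = c v` on `[a, b]`, where the
Riccati subsolution `-g` satisfies `-c ≤ g' - g² / p`, then `v` stays positive on `[a, b]`
as soon as `v a > 0` and `w a + g a * v a > 0`. -/
theorem pos_of_riccati_subsolution {a b k : ℝ} {p c v v' w g g' : ℝ → ℝ}
    (hp : ∀ t ∈ Set.Icc a b, 0 < p t)
    (hv : ∀ t ∈ Set.Icc a b, HasDerivAt v (v' t) t)
    (hw : ∀ t ∈ Set.Icc a b, HasDerivAt w (c t * v t) t)
    (hg : ∀ t ∈ Set.Icc a b, HasDerivAt g (g' t) t)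
    (hwv : ∀ t ∈ Set.Icc a b, w t = p t * v' t)
    (hg0 : ∀ t ∈ Set.Icc a b, 0 ≤ g t)
    (hgk : ∀ t ∈ Set.Icc a b, g t / p t ≤ k)
    (hric : ∀ t ∈ Set.Icc a b, 0 ≤ c t + g' t - g t ^ 2 / p t)
    (hva : 0 < v a) (hwa : 0 < w a + g a * v a) :
    ∀ t ∈ Set.Icc a b, 0 < v t := by
  set z : ℝ → ℝ := fun t => w t + g t * v t with hz
  have hzd : ∀ t ∈ Set.Icc a b, HasDerivAt z (c t * v t + (g' t * v t + g t * v' t)) t :=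
    fun t ht => (hw t ht).add ((hg t ht).mul (hv t ht))
  have hv' : ∀ t ∈ Set.Icc a b, v' t = z t / p t - g t / p t * v t := by
    intro t ht
    have := (hp t ht).ne'
    simp only [hz, hwv t ht]
    field_simp
    ring
  have hcont : ContinuousOn (fun t => min (v t) (z t)) (Set.Icc a b) :=
    ContinuousOn.inf (fun t ht => (hv t ht).continuousAt.continuousWithinAt)
      fun t ht => (hzd t ht).continuousAt.continuousWithinAt
  by_contra! hne
  obtain ⟨t₁, ht₁, hvt₁⟩ := hne
  have hS : IsCompact (Set.Icc a b ∩ (fun t => min (v t) (z t)) ⁻¹' Set.Iic 0) :=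
    isCompact_Icc.of_isClosed_subset
      (hcont.preimage_isClosed_of_isClosed isClosed_Icc isClosed_Iic) Set.inter_subset_left
  obtain ⟨t₀, ⟨ht₀, hmin⟩, hleast⟩ :=
    hS.exists_isLeast ⟨t₁, ht₁, (min_le_left _ _).trans hvt₁⟩
  have hsub : Set.Icc a t₀ ⊆ Set.Icc a b := Set.Icc_subset_Icc_right ht₀.2
  have hpos : ∀ t ∈ Set.Ioo a t₀, 0 < v t ∧ 0 < z t := by
    intro t ht
    rw [← lt_min_iff]
    by_contra! h
    exact (hleast ⟨hsub (Set.Ioo_subset_Icc_self ht), h⟩).not_gt ht.2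
  have hleft : a ∈ Set.Icc a t₀ := Set.left_mem_Icc.2 ht₀.1
  have hright : t₀ ∈ Set.Icc a t₀ := Set.right_mem_Icc.2 ht₀.1
  have hzmono : MonotoneOn z (Set.Icc a t₀) := by
    refine monotoneOn_of_hasDerivWithinAt_nonneg (convex_Icc _ _)
      (fun t ht => (hzd t (hsub ht)).continuousAt.continuousWithinAt)
      (fun t ht => (hzd t (hsub (interior_subset ht))).hasDerivWithinAt) ?_
    intro t ht
    have htb := hsub (interior_subset ht)
    rw [interior_Icc] at ht
    obtain ⟨hvt, hzt⟩ := hpos t ht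
    have h1 : 0 ≤ (c t + g' t - g t ^ 2 / p t) * v t := mul_nonneg (hric t htb) hvt.le
    have h2 : 0 ≤ g t * (z t / p t) := mul_nonneg (hg0 t htb) (div_pos hzt (hp t htb)).le
    rw [hv' t htb]
    calc 0 ≤ (c t + g' t - g t ^ 2 / p t) * v t + g t * (z t / p t) := add_nonneg h1 h2
      _ = _ := by ring
  have hed : ∀ t ∈ Set.Icc a b, HasDerivAt (fun s => v s * Real.exp (k * s))
      (v' t * Real.exp (k * t) + v t * (Real.exp (k * t) * (k * 1))) t :=
    fun t ht => (hv t ht).mul ((hasDerivAt_id t).const_mul k).exp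
  have hvmono : MonotoneOn (fun s => v s * Real.exp (k * s)) (Set.Icc a t₀) := by
    refine monotoneOn_of_hasDerivWithinAt_nonneg (convex_Icc _ _)
      (fun t ht => (hed t (hsub ht)).continuousAt.continuousWithinAt)
      (fun t ht => (hed t (hsub (interior_subset ht))).hasDerivWithinAt) ?_
    intro t ht
    have htb := hsub (interior_subset ht)
    rw [interior_Icc] at ht
    obtain ⟨hvt, hzt⟩ := hpos t ht
    have h1 : 0 ≤ (k - g t / p t) * v t := mul_nonneg (sub_nonneg.2 (hgk t htb)) hvt.le
    have h2 : 0 < z t / p t := div_pos hzt (hp t htb)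
    rw [hv' t htb]
    calc 0 ≤ (z t / p t + (k - g t / p t) * v t) * Real.exp (k * t) := by positivity
      _ = _ := by ring
  have hzt₀ : 0 < z t₀ := hwa.trans_le (hzmono hleft hright ht₀.1)
  have hvt₀ : 0 < v t₀ := by
    have h := hvmono hleft hright ht₀.1
    exact pos_of_mul_pos_left ((mul_pos hva (Real.exp_pos _)).trans_le h) (Real.exp_pos _).le
  exact (lt_min hvt₀ hzt₀).not_ge hmin

/-- Property 5: `ψ₁(a) → +∞` as `a → 0`: for every `R > 0` there is `δ > 0` such that
for `|a| < δ` the solution `v a` has no zero in `(T₁, T₁ + R]`. -/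
theorem psi1_tendsto_top_at_zero
    (T₁ p₁ : ℝ) (hp₁ : 0 < p₁)
    (p q m : ℝ → ℝ)
    (hpc : Continuous p) (hqc : Continuous q) (hmc : Continuous m)
    (hpb : ∀ t, p₁ ≤ p t) (hqb : ∀ t, 0 ≤ q t)
    (v : ℝ → ℝ → ℝ)
    (hvdiff : ∀ a, Differentiable ℝ (v a))
    (hpvdiff : ∀ a, Differentiable ℝ (fun t => p t * deriv (v a) t))
    (heq : ∀ a t, -(deriv (fun s => p s * deriv (v a) s) t) + q t * v a t = a * m t * v a t)
    (hvT : ∀ a, v a T₁ = 1) (hv'T : ∀ a, deriv (v a) T₁ = 0) :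
    ∀ R : ℝ, 0 < R → ∃ δ : ℝ, 0 < δ ∧ ∀ a : ℝ, |a| < δ →
      ∀ t ∈ Set.Ioc T₁ (T₁ + R), v a t ≠ 0 := by
  intro R hR
  obtain ⟨M, hM⟩ := (isCompact_Icc (a := T₁) (b := T₁ + R)).exists_bound_of_continuousOn
    hmc.continuousOn
  have hM0 : 0 ≤ M := (norm_nonneg _).trans (hM T₁ ⟨le_rfl, by linarith⟩)
  set η : ℝ := p₁ / (8 * R) with hη
  have hη0 : 0 < η := by positivity
  refine ⟨η / (2 * R) / (M + 1), by positivity, fun a ha t ht => ne_of_gt ?_⟩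
  have hε : |a| * M ≤ η / (2 * R) := by
    rw [lt_div_iff₀ (by positivity)] at ha
    nlinarith [abs_nonneg a]
  have hpos : ∀ t, 0 < p t := fun t => hp₁.trans_le (hpb t)
  have hgle : ∀ t ∈ Set.Icc T₁ (T₁ + R), 0 ≤ (t - T₁) / R ∧ (t - T₁) / R ≤ 1 := fun t ht =>
    ⟨div_nonneg (by linarith [ht.1]) hR.le, (div_le_one hR).2 (by linarith [ht.2])⟩
  refine pos_of_riccati_subsolution (p := p) (c := fun t => q t - a * m t) (v' := deriv (v a))
    (w := fun t => p t * deriv (v a) t) (g := fun t => η * (1 + (t - T₁) / R))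
    (g' := fun _ => η * (1 / R)) (k := 2 * η / p₁) (fun t _ => hpos t)
    (fun t _ => (hvdiff a t).hasDerivAt) ?_ ?_ (fun _ _ => rfl) ?_ ?_ ?_ ?_ ?_
    t (Set.Ioc_subset_Icc_self ht)
  · intro t _
    have hderiv : deriv (fun s => p s * deriv (v a) s) t = (q t - a * m t) * v a t := by
      linear_combination -heq a t
    exact hderiv ▸ (hpvdiff a t).hasDerivAt
  · intro t _
    exact ((((hasDerivAt_id t).sub_const T₁).div_const R).const_add 1).const_mul η
  · intro t ht
    exact mul_nonneg hη0.le (by linarith [hgle t ht])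
  · intro t ht
    exact div_le_div₀ (by positivity) (by nlinarith [hgle t ht]) hp₁ (hpb t)
  · intro t ht
    obtain ⟨h0, h1⟩ := hgle t ht
    have hsq : (η * (1 + (t - T₁) / R)) ^ 2 / p t ≤ (2 * η) ^ 2 / p₁ :=
      div_le_div₀ (by positivity)
        (pow_le_pow_left₀ (mul_nonneg hη0.le (by linarith)) (by nlinarith) 2) hp₁ (hpb t)
    have hval : (2 * η) ^ 2 / p₁ = η * (1 / R) - η / (2 * R) := by
      rw [hη]
      field_simp
      norm_num
    have ham : a * m t ≤ |a| * M := by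
      calc a * m t ≤ |a * m t| := le_abs_self _
        _ = |a| * |m t| := abs_mul _ _
        _ ≤ |a| * M := mul_le_mul_of_nonneg_left (hM t ht) (abs_nonneg a)
    linarith [hqb t]
  · rw [hvT]
    exact one_pos
  · simpa [hvT, hv'T] using hη0
end

section
/- (i) If 0 ≤ a ≤ ã then ψ_2(a) ≤ ψ_2(ã); if moreover 0 ≤ a < ã and a ∈ B_2, then ã ∈ B_2 and ψ_2(a) < ψ_2(ã). (ii) If a ≤ ã ≤ 0 then ψ_2(ã) ≤ ψ_2(a); if moreover a < ã ≤ 0 and ã ∈ B_2, then a ∈ B_2 and ψ_2(ã) < ψ_2(a). That is, ψ_2 is increasing on [0, +∞), strictly so on B_2 ∩ [0, +∞), and decreasing on (−∞, 0], strictly so on B_2 ∩ (−∞, 0]. -/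
open Set Filter Topology

/-- A solution of the linear system `v' = V / p`, `V' = c v` that vanishes together with `V` at
one point vanishes at every later point. -/
theorem eq_zero_of_first_order_system {p c v v' : ℝ → ℝ} {s T : ℝ} (hsT : s ≤ T)
    (hp : Continuous p) (hp0 : ∀ t, 0 < p t) (hc : Continuous c)
    (hv : ∀ t, HasDerivAt v (v' t) t)
    (hpv : ∀ t, HasDerivAt (fun x => p x * v' x) (c t * v t) t)
    (h0 : v s = 0) (h0' : v' s = 0) : v T = 0 := by
  have hcont : Continuous fun t => |1 / p t + c t| :=
    ((continuous_const.div hp fun t => (hp0 t).ne').add hc).abs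
  obtain ⟨K, hK⟩ := (isCompact_Icc (a := s) (b := T)).bddAbove_image hcont.continuousOn
  have hderiv : ∀ t, HasDerivAt
      (fun x => (v x ^ 2 + (p x * v' x) ^ 2) * Real.exp (-K * x))
      ((2 * v t * v' t + 2 * (p t * v' t) * (c t * v t)) * Real.exp (-K * t)
        + (v t ^ 2 + (p t * v' t) ^ 2) * (Real.exp (-K * t) * -K)) t := by
    intro t
    have h1 := ((hv t).pow 2).add ((hpv t).pow 2)
    have h2 := ((hasDerivAt_id t).const_mul (-K)).exp
    refine (h1.mul h2).congr_deriv ?_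
    simp only [Pi.add_apply, Pi.pow_apply, id]
    ring
  have hanti : AntitoneOn (fun x => (v x ^ 2 + (p x * v' x) ^ 2) * Real.exp (-K * x))
      (Icc s T) := by
    refine antitoneOn_of_deriv_nonpos (convex_Icc s T)
      (fun t _ => (hderiv t).continuousAt.continuousWithinAt)
      (fun t _ => (hderiv t).differentiableAt.differentiableWithinAt) fun t ht => ?_
    rw [(hderiv t).deriv]
    have hKt : |1 / p t + c t| ≤ K := hK ⟨t, interior_subset ht, rfl⟩
    have hpos := (hp0 t).ne'
    have hv' : v' t = (1 / p t) * (p t * v' t) := by field_simp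
    have key : 2 * v t * v' t + 2 * (p t * v' t) * (c t * v t)
        ≤ K * (v t ^ 2 + (p t * v' t) ^ 2) := by
      calc 2 * v t * v' t + 2 * (p t * v' t) * (c t * v t)
          = (1 / p t + c t) * (2 * v t * (p t * v' t)) := by
            field_simp
        _ ≤ |1 / p t + c t| * |2 * v t * (p t * v' t)| := by
            rw [← abs_mul]; exact le_abs_self _
        _ ≤ K * (v t ^ 2 + (p t * v' t) ^ 2) := by
            refine mul_le_mul hKt (abs_le.2 ⟨?_, ?_⟩) (abs_nonneg _) ((abs_nonneg _).trans hKt)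
            · nlinarith [sq_nonneg (v t + p t * v' t)]
            · nlinarith [sq_nonneg (v t - p t * v' t)]
    nlinarith [mul_le_mul_of_nonneg_right key (Real.exp_pos (-K * t)).le]
  have h := hanti (left_mem_Icc.2 hsT) (right_mem_Icc.2 hsT) hsT
  simp only [h0, h0'] at h
  have hE : v T ^ 2 + (p T * v' T) ^ 2 ≤ 0 := by
    refine nonpos_of_mul_nonpos_left (b := Real.exp (-K * T)) ?_ (Real.exp_pos _)
    simpa using h
  nlinarith [sq_nonneg (v T), sq_nonneg (p T * v' T)]

/-- If `u s = 0` and `v` vanishes at most simply at `s`, then `u² / v` tends to `0` at `s`. -/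
theorem tendsto_sq_div_of_simple_zero {u v : ℝ → ℝ} {s u' v' : ℝ}
    (hu : HasDerivAt u u' s) (hv : HasDerivAt v v' s) (hus : u s = 0)
    (h : v s ≠ 0 ∨ v' ≠ 0) :
    Tendsto (fun t => u t ^ 2 / v t) (𝓝[>] s) (𝓝 0) := by
  have hut : Tendsto u (𝓝[>] s) (𝓝 0) := by
    simpa [hus] using hu.continuousAt.tendsto.mono_left (nhdsWithin_le_nhds (s := Ioi s))
  by_cases hvs : v s = 0
  · have hv' : v' ≠ 0 := h.resolve_left (by simpa using hvs)
    have hle : 𝓝[>] s ≤ 𝓝[≠] s := nhdsWithin_mono _ fun t ht => (ne_of_gt ht)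
    have h1 := (hasDerivAt_iff_tendsto_slope.1 hu).mono_left hle
    have h2 := (hasDerivAt_iff_tendsto_slope.1 hv).mono_left hle
    have h3 := (h1.mul hut).div h2 hv'
    rw [mul_zero, zero_div] at h3
    refine h3.congr' ?_
    filter_upwards [self_mem_nhdsWithin] with t ht
    have hts : t - s ≠ 0 := sub_ne_zero.2 (ne_of_gt ht)
    simp only [slope_def_field, hus, hvs, sub_zero, Pi.div_apply]
    by_cases hvt : v t = 0
    · simp [hvt]
    · field_simp
  · have hvt := hv.continuousAt.tendsto.mono_left (nhdsWithin_le_nhds (s := Ioi s))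
    have h1 := (hut.pow 2).div hvt hvs
    rwa [zero_pow two_ne_zero, zero_div] at h1

/-- Sturm-type comparison through a Picone identity: for `0 ≤ a < b`, if the solution `u` for
the parameter `a` vanishes at `s < T`, the solution `v` for `b` vanishes strictly between
`s` and `T`. -/
theorem exists_zero_of_lt_parameter_s11 {p q m u u' v v' : ℝ → ℝ} {a b s T : ℝ}
    (hp : Continuous p) (hp0 : ∀ t, 0 < p t) (hq : Continuous q) (hq0 : ∀ t, 0 ≤ q t)
    (hm : Continuous m) (ha : 0 ≤ a) (hab : a < b) (hsT : s < T)
    (hu : ∀ t, HasDerivAt u (u' t) t)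
    (hpu : ∀ t, HasDerivAt (fun x => p x * u' x) ((q t - a * m t) * u t) t)
    (hv : ∀ t, HasDerivAt v (v' t) t)
    (hpv : ∀ t, HasDerivAt (fun x => p x * v' x) ((q t - b * m t) * v t) t)
    (huT : u T = 1) (hu'T : u' T = 0) (hvT : v T = 1) (hv'T : v' T = 0) (hus : u s = 0) :
    ∃ t ∈ Ioo s T, v t = 0 := by
  by_contra! hne
  have hvcont : Continuous v := continuous_iff_continuousAt.2 fun t => (hv t).continuousAt
  have hvpos : ∀ t ∈ Ioc s T, 0 < v t := by
    intro t ht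
    by_contra! hle
    have h0 : (0 : ℝ) ∈ Icc (v t) (v T) := ⟨hle, by rw [hvT]; exact zero_le_one⟩
    obtain ⟨r, hr, hr0⟩ := intermediate_value_Icc ht.2 hvcont.continuousOn h0
    have hrT : r ≠ T := by rintro rfl; rw [hvT] at hr0; exact one_ne_zero hr0
    exact hne r ⟨ht.1.trans_le hr.1, lt_of_le_of_ne hr.2 hrT⟩ hr0
  set H : ℝ → ℝ := fun x => b * ((p x * u' x) * u x) - a * ((p x * v' x) * (u x ^ 2 / v x))
    with hHdef
  have hH : ∀ t ∈ Ioc s T, HasDerivAt H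
      (a * (p t * (u' t - u t * v' t / v t) ^ 2)
        + (b - a) * (p t * u' t ^ 2 + q t * u t ^ 2)) t := by
    intro t ht
    have hvt := (hvpos t ht).ne'
    have h1 := ((hpu t).mul (hu t)).const_mul b
    have h2 := ((hpv t).mul (((hu t).pow 2).div (hv t) hvt)).const_mul a
    refine (h1.sub h2).congr_deriv ?_
    simp only [Pi.pow_apply, Pi.div_apply]
    field_simp
    ring
  have hmono : MonotoneOn H (Ioc s T) := by
    refine monotoneOn_of_deriv_nonneg (convex_Ioc s T)
      (fun t ht => (hH t ht).continuousAt.continuousWithinAt)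
      (fun t ht => (hH t (interior_subset ht)).differentiableAt.differentiableWithinAt)
      fun t ht => ?_
    rw [(hH t (interior_subset ht)).deriv]
    have h1 := hp0 t
    have h2 := hq0 t
    have h3 := sub_pos.2 hab
    positivity
  have hsimple : v s ≠ 0 ∨ v' s ≠ 0 := by
    by_contra! h
    have := eq_zero_of_first_order_system hsT.le hp hp0 (hq.sub (continuous_const.mul hm))
      hv hpv h.1 h.2
    rw [hvT] at this
    exact one_ne_zero this
  have hlim : Tendsto H (𝓝[>] s) (𝓝 0) := by
    have hU := (hpu s).continuousAt.tendsto.mono_left (nhdsWithin_le_nhds (s := Ioi s))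
    have hV := (hpv s).continuousAt.tendsto.mono_left (nhdsWithin_le_nhds (s := Ioi s))
    have hu0 := (hu s).continuousAt.tendsto.mono_left (nhdsWithin_le_nhds (s := Ioi s))
    have hw := tendsto_sq_div_of_simple_zero (hu s) (hv s) hus hsimple
    simpa [hus] using ((hU.mul hu0).const_mul b).sub ((hV.mul hw).const_mul a)
  have hHzero : ∀ t ∈ Ioc s T, H t = 0 := by
    intro t ht
    apply le_antisymm
    · have := hmono ht (right_mem_Ioc.2 hsT) ht.2
      simpa [hHdef, hu'T, hv'T] using this
    · refine le_of_tendsto hlim ?_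
      filter_upwards [Ioo_mem_nhdsGT ht.1] with r hr
      exact hmono ⟨hr.1, hr.2.le.trans ht.2⟩ ht hr.2.le
  have hu'zero : ∀ t ∈ Ioo s T, u' t = 0 := by
    intro t ht
    have h0 : H =ᶠ[𝓝 t] fun _ => 0 := by
      filter_upwards [Ioo_mem_nhds ht.1 ht.2] with r hr using hHzero r ⟨hr.1, hr.2.le⟩
    have h1 := (hH t ⟨ht.1, ht.2.le⟩).unique ((hasDerivAt_const t (0 : ℝ)).congr_of_eventuallyEq h0)
    have hpt := hp0 t
    have h2 : 0 ≤ a * (p t * (u' t - u t * v' t / v t) ^ 2) := by positivity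
    have h3 : 0 ≤ q t * u t ^ 2 := mul_nonneg (hq0 t) (sq_nonneg _)
    have h4 : 0 ≤ p t * u' t ^ 2 := by positivity
    have h5 : p t * u' t ^ 2 = 0 := by
      nlinarith [mul_nonneg (sub_pos.2 hab).le h3, mul_nonneg (sub_pos.2 hab).le h4,
        mul_pos (sub_pos.2 hab) hpt]
    simpa [hpt.ne'] using h5
  obtain ⟨t, ht, hslope⟩ := exists_hasDerivAt_eq_slope u u' hsT
    (fun t _ => (hu t).continuousAt.continuousWithinAt) fun t _ => hu t
  rw [hu'zero t ht, huT, hus, sub_zero] at hslope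
  exact (one_div_pos.2 (sub_pos.2 hsT)).ne hslope

theorem csSup_mem_zeros_lt {f : ℝ → ℝ} {T : ℝ} (hf : Continuous f) (hT : f T ≠ 0)
    (hne : {t : ℝ | t < T ∧ f t = 0}.Nonempty) :
    sSup {t : ℝ | t < T ∧ f t = 0} ∈ {t : ℝ | t < T ∧ f t = 0} := by
  have hset : {t : ℝ | t < T ∧ f t = 0} = Iic T ∩ f ⁻¹' {0} := by
    ext t
    refine ⟨fun h => ⟨h.1.le, h.2⟩, fun h => ⟨lt_of_le_of_ne h.1 ?_, h.2⟩⟩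
    rintro rfl
    exact hT h.2
  have hclosed : IsClosed {t : ℝ | t < T ∧ f t = 0} := by
    rw [hset]
    exact isClosed_Iic.inter (isClosed_singleton.preimage hf)
  exact hclosed.csSup_mem hne ⟨T, fun t ht => ht.1.le⟩

/-- Strict monotonicity of the last zero before `T` for parameters `0 ≤ a < b`. -/
theorem last_zero_lt_of_lt_parameter {p q m u u' v v' : ℝ → ℝ} {a b T : ℝ}
    (hp : Continuous p) (hp0 : ∀ t, 0 < p t) (hq : Continuous q) (hq0 : ∀ t, 0 ≤ q t)
    (hm : Continuous m) (ha : 0 ≤ a) (hab : a < b)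
    (hu : ∀ t, HasDerivAt u (u' t) t)
    (hpu : ∀ t, HasDerivAt (fun x => p x * u' x) ((q t - a * m t) * u t) t)
    (hv : ∀ t, HasDerivAt v (v' t) t)
    (hpv : ∀ t, HasDerivAt (fun x => p x * v' x) ((q t - b * m t) * v t) t)
    (huT : u T = 1) (hu'T : u' T = 0) (hvT : v T = 1) (hv'T : v' T = 0)
    (hne : {t : ℝ | t < T ∧ u t = 0}.Nonempty) :
    {t : ℝ | t < T ∧ v t = 0}.Nonempty ∧
      sSup {t : ℝ | t < T ∧ u t = 0} < sSup {t : ℝ | t < T ∧ v t = 0} := by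
  have hs := csSup_mem_zeros_lt (continuous_iff_continuousAt.2 fun t => (hu t).continuousAt)
    (by rw [huT]; exact one_ne_zero) hne
  obtain ⟨t, ht, hvt⟩ := exists_zero_of_lt_parameter_s11 hp hp0 hq hq0 hm ha hab hs.1 hu hpu hv hpv
    huT hu'T hvT hv'T hs.2
  exact ⟨⟨t, ht.2, hvt⟩,
    ht.1.trans_le (le_csSup ⟨T, fun r hr => hr.1.le⟩ ⟨ht.2, hvt⟩)⟩

/-- Monotonicity of the zero-function `ψ₂`: here `w a` is the solution of
`-(p w')' + q w = a m w` with `w(T₂) = 1`, `w'(T₂) = 0`,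
`ψ₂ a = sup {t < T₂ : w a t = 0}` (equal to `-∞` when the zero set is empty) and
`B₂ = {a : w a has a zero < T₂}`.  Then `ψ₂` is increasing on `[0, ∞)`, strictly on
`B₂ ∩ [0, ∞)`, and decreasing on `(-∞, 0]`, strictly on `B₂ ∩ (-∞, 0]`. -/
theorem psi2_monotone
    (T₂ p₁ : ℝ) (hp₁ : 0 < p₁)
    (p q m : ℝ → ℝ)
    (hpc : Continuous p) (hqc : Continuous q) (hmc : Continuous m)
    (hpb : ∀ t, p₁ ≤ p t) (hqb : ∀ t, 0 ≤ q t)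
    (w : ℝ → ℝ → ℝ)
    (hwdiff : ∀ a, Differentiable ℝ (w a))
    (hpwdiff : ∀ a, Differentiable ℝ (fun t => p t * deriv (w a) t))
    (heq : ∀ a t, -(deriv (fun s => p s * deriv (w a) s) t) + q t * w a t = a * m t * w a t)
    (hwT : ∀ a, w a T₂ = 1) (hw'T : ∀ a, deriv (w a) T₂ = 0) :
    (∀ a a2 : ℝ, 0 ≤ a → a ≤ a2 →
      {t : ℝ | t < T₂ ∧ w a t = 0}.Nonempty →
        {t : ℝ | t < T₂ ∧ w a2 t = 0}.Nonempty ∧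
        sSup {t : ℝ | t < T₂ ∧ w a t = 0} ≤ sSup {t : ℝ | t < T₂ ∧ w a2 t = 0}) ∧
    (∀ a a2 : ℝ, 0 ≤ a → a < a2 →
      {t : ℝ | t < T₂ ∧ w a t = 0}.Nonempty →
        {t : ℝ | t < T₂ ∧ w a2 t = 0}.Nonempty ∧
        sSup {t : ℝ | t < T₂ ∧ w a t = 0} < sSup {t : ℝ | t < T₂ ∧ w a2 t = 0}) ∧
    (∀ a a2 : ℝ, a ≤ a2 → a2 ≤ 0 →
      {t : ℝ | t < T₂ ∧ w a2 t = 0}.Nonempty →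
        {t : ℝ | t < T₂ ∧ w a t = 0}.Nonempty ∧
        sSup {t : ℝ | t < T₂ ∧ w a2 t = 0} ≤ sSup {t : ℝ | t < T₂ ∧ w a t = 0}) ∧
    (∀ a a2 : ℝ, a < a2 → a2 ≤ 0 →
      {t : ℝ | t < T₂ ∧ w a2 t = 0}.Nonempty →
        {t : ℝ | t < T₂ ∧ w a t = 0}.Nonempty ∧
        sSup {t : ℝ | t < T₂ ∧ w a2 t = 0} < sSup {t : ℝ | t < T₂ ∧ w a t = 0}) := by
  have hp0 : ∀ t, 0 < p t := fun t => hp₁.trans_le (hpb t)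
  have hw : ∀ a t, HasDerivAt (w a) (deriv (w a) t) t := fun a t => (hwdiff a t).hasDerivAt
  have hpw : ∀ a t, HasDerivAt (fun x => p x * deriv (w a) x)
      ((q t - a * m t) * w a t) t := fun a t =>
    (hpwdiff a t).hasDerivAt.congr_deriv (by linear_combination -(heq a t))
  have hpos : ∀ a a2 : ℝ, 0 ≤ a → a < a2 → {t : ℝ | t < T₂ ∧ w a t = 0}.Nonempty →
      {t : ℝ | t < T₂ ∧ w a2 t = 0}.Nonempty ∧
        sSup {t : ℝ | t < T₂ ∧ w a t = 0} < sSup {t : ℝ | t < T₂ ∧ w a2 t = 0} :=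
    fun a a2 ha hlt hne => last_zero_lt_of_lt_parameter hpc hp0 hqc hqb hmc ha hlt
      (hw a) (hpw a) (hw a2) (hpw a2) (hwT a) (hw'T a) (hwT a2) (hw'T a2) hne
  have hneg : ∀ a a2 : ℝ, a < a2 → a2 ≤ 0 → {t : ℝ | t < T₂ ∧ w a2 t = 0}.Nonempty →
      {t : ℝ | t < T₂ ∧ w a t = 0}.Nonempty ∧
        sSup {t : ℝ | t < T₂ ∧ w a2 t = 0} < sSup {t : ℝ | t < T₂ ∧ w a t = 0} :=
    fun a a2 hlt ha2 hne => last_zero_lt_of_lt_parameter (m := fun t => -m t)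
      hpc hp0 hqc hqb hmc.neg (neg_nonneg.2 ha2) (neg_lt_neg hlt)
      (hw a2) (by simpa using hpw a2) (hw a) (by simpa using hpw a)
      (hwT a2) (hw'T a2) (hwT a) (hw'T a) hne
  refine ⟨fun a a2 ha hle hne => ?_, hpos, fun a a2 hle ha2 hne => ?_, hneg⟩
  · rcases hle.eq_or_lt with rfl | hlt
    · exact ⟨hne, le_rfl⟩
    · exact (hpos a a2 ha hlt hne).imp_right le_of_lt
  · rcases hle.eq_or_lt with rfl | hlt
    · exact ⟨hne, le_rfl⟩
    · exact (hneg a a2 hlt ha2 hne).imp_right le_of_lt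
end

section
/- Suppose m takes a positive value in (T_1,T_2); set T_1^> := inf{t ∈ (T_1,T_2) : m(t) > 0} and T_2^> := sup{t ∈ (T_1,T_2) : m(t) > 0}. Let α > 0 be such that the solution w of Lw = α m w on [T_1,T_2] with w(T_2) = 1, w'(T_2) = 0 satisfies sup{t < T_2 : w(t) = 0} = T_1^>, and let β > 0 be such that the solution v of Lv = β m v on [T_1,T_2] with v(T_1) = 1, v'(T_1) = 0 satisfies inf{t > T_1 : v(t) = 0} = T_2^>. If C := C_1^> ∩ {(a,b) : a > 0, b > 0} is nonempty, then C is asymptotic to the lines {α} × ℝ and ℝ × {β}; precisely: (1) every (a,b) ∈ C satisfies a > α and b > β; (2) for every ε > 0 and every M there exists (a,b) ∈ C with a < α + ε and b > M; and (3) for every ε > 0 and every M there exists (a,b) ∈ C with b < β + ε and a > M. -/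
def FucikSol1 (T₁ T₂ : ℝ) (p q m : ℝ → ℝ) (a b : ℝ) (u : ℝ → ℝ) : Prop :=
  (∃ t ∈ Set.Icc T₁ T₂, u t ≠ 0) ∧
  ∃ u' pu' : ℝ → ℝ,
    (∀ t ∈ Set.Icc T₁ T₂, HasDerivAt u (u' t) t) ∧
    (∀ t ∈ Set.Icc T₁ T₂, HasDerivAt (fun s => p s * u' s) (pu' t) t) ∧
    (∀ t ∈ Set.Ioo T₁ T₂,
      -pu' t + q t * u t = m t * (a * max (u t) 0 - b * max (-u t) 0)) ∧
    u' T₁ = 0 ∧ u' T₂ = 0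

/-- `C_k^>`: pairs `(a,b)` admitting a nontrivial one-weight Fučik solution with
exactly `k` zeros in `(T₁, T₂)` and `u(T₂) > 0`. -/
def CGT1 (T₁ T₂ : ℝ) (p q m : ℝ → ℝ) (k : ℕ) : Set (ℝ × ℝ) :=
  {ab : ℝ × ℝ | ∃ u : ℝ → ℝ, FucikSol1 T₁ T₂ p q m ab.1 ab.2 u ∧
    {t ∈ Set.Ioo T₁ T₂ | u t = 0}.Finite ∧ {t ∈ Set.Ioo T₁ T₂ | u t = 0}.ncard = k ∧
    0 < u T₂}

/-- `C_k^<`: pairs `(a,b)` admitting a nontrivial one-weight Fučik solution with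
exactly `k` zeros in `(T₁, T₂)` and `u(T₂) < 0`. -/
def CLT1 (T₁ T₂ : ℝ) (p q m : ℝ → ℝ) (k : ℕ) : Set (ℝ × ℝ) :=
  {ab : ℝ × ℝ | ∃ u : ℝ → ℝ, FucikSol1 T₁ T₂ p q m ab.1 ab.2 u ∧
    {t ∈ Set.Ioo T₁ T₂ | u t = 0}.Finite ∧ {t ∈ Set.Ioo T₁ T₂ | u t = 0}.ncard = k ∧
    u T₂ < 0}

open Set MeasureTheory Filter Topology

/-- Globally defined continuous coefficients with `p > 0` and `q ≥ 0`. -/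
structure SLCoeff (p q m : ℝ → ℝ) : Prop where
  cont_p : Continuous p
  cont_q : Continuous q
  cont_m : Continuous m
  p_pos : ∀ t, 0 < p t
  q_nonneg : ∀ t, 0 ≤ q t

/-- `w` with flux `y = p w'` solves `-(p w')' + q w = a m w` in the interior of `[c, d]`, and both
are continuous up to the boundary. -/
structure IsSLSol (p q m : ℝ → ℝ) (a c d : ℝ) (w y : ℝ → ℝ) : Prop where
  cont : ContinuousOn w (Icc c d)
  cont_flux : ContinuousOn y (Icc c d)
  deriv : ∀ t ∈ Ioo c d, HasDerivAt w (y t / p t) t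
  deriv_flux : ∀ t ∈ Ioo c d, HasDerivAt y ((q t - a * m t) * w t) t

lemma le_mul_exp_of_deriv_le {f f' : ℝ → ℝ} {c d K : ℝ} (hf : ContinuousOn f (Icc c d))
    (hf' : ∀ t ∈ Ioo c d, HasDerivAt f (f' t) t) (hK : ∀ t ∈ Ioo c d, f' t ≤ K * f t)
    {t : ℝ} (ht : t ∈ Icc c d) : f t ≤ f c * Real.exp (K * (t - c)) := by
  have hanti : AntitoneOn (fun s => f s * Real.exp (-(K * (s - c)))) (Icc c d) := by
    apply antitoneOn_of_hasDerivWithinAt_nonpos (convex_Icc c d)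
      (f' := fun s => (f' s - K * f s) * Real.exp (-(K * (s - c))))
    · exact hf.mul (by fun_prop)
    · intro x hx
      rw [interior_Icc] at hx
      have h2 : HasDerivAt (fun s : ℝ => Real.exp (-(K * (s - c))))
          (Real.exp (-(K * (x - c))) * (-(K * 1))) x :=
        ((((hasDerivAt_id x).sub_const c).const_mul K).neg).exp
      have := (hf' x hx).mul h2
      exact (this.congr_deriv (by ring)).hasDerivWithinAt
    · intro x hx
      rw [interior_Icc] at hx
      exact mul_nonpos_of_nonpos_of_nonneg (by linarith [hK x hx]) (Real.exp_pos _).le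
  have h1 := hanti (left_mem_Icc.2 (ht.1.trans ht.2)) ht ht.1
  simp only [sub_self, mul_zero, neg_zero, Real.exp_zero, mul_one] at h1
  have h3 : Real.exp (-(K * (t - c))) * Real.exp (K * (t - c)) = 1 := by
    rw [← Real.exp_add]; simp
  have h4 := mul_le_mul_of_nonneg_right h1 (Real.exp_pos (K * (t - c))).le
  rwa [mul_assoc, h3, mul_one] at h4

namespace IsSLSol

variable {p q m : ℝ → ℝ} {a b c d : ℝ} {w y v z : ℝ → ℝ}

lemma mono (h : IsSLSol p q m a c d w y) {c' d' : ℝ} (hc : c ≤ c') (hd : d' ≤ d) :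
    IsSLSol p q m a c' d' w y :=
  ⟨h.cont.mono (Icc_subset_Icc hc hd), h.cont_flux.mono (Icc_subset_Icc hc hd),
    fun t ht => h.deriv t (Ioo_subset_Ioo hc hd ht),
    fun t ht => h.deriv_flux t (Ioo_subset_Ioo hc hd ht)⟩

lemma const_mul (h : IsSLSol p q m a c d w y) (k : ℝ) :
    IsSLSol p q m a c d (fun t => k * w t) (fun t => k * y t) :=
  ⟨h.cont.const_mul k, h.cont_flux.const_mul k,
    fun t ht => ((h.deriv t ht).const_mul k).congr_deriv (by ring),
    fun t ht => ((h.deriv_flux t ht).const_mul k).congr_deriv (by ring)⟩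

lemma zero : IsSLSol p q m a c d (fun _ => 0) (fun _ => 0) :=
  ⟨continuousOn_const, continuousOn_const,
    fun t _ => (hasDerivAt_const t 0).congr_deriv (by simp),
    fun t _ => (hasDerivAt_const t 0).congr_deriv (by simp)⟩

/-- Reflection `t ↦ -t`. -/
lemma reflect (h : IsSLSol p q m a c d w y) :
    IsSLSol (fun t => p (-t)) (fun t => q (-t)) (fun t => m (-t)) a (-d) (-c)
      (fun t => w (-t)) (fun t => -y (-t)) := by
  have hm : MapsTo (fun t : ℝ => -t) (Icc (-d) (-c)) (Icc c d) := fun t ht =>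
    ⟨by linarith [ht.2], by linarith [ht.1]⟩
  have hm' : ∀ t ∈ Ioo (-d) (-c), -t ∈ Ioo c d := fun t ht =>
    ⟨by linarith [ht.2], by linarith [ht.1]⟩
  refine ⟨h.cont.comp (by fun_prop) hm, (h.cont_flux.comp (by fun_prop) hm).neg, ?_, ?_⟩
  · intro t ht
    have := (h.deriv (-t) (hm' t ht)).scomp t (hasDerivAt_neg t)
    exact this.congr_deriv (by simp [neg_div])
  · intro t ht
    have := ((h.deriv_flux (-t) (hm' t ht)).scomp t (hasDerivAt_neg t)).neg
    exact this.congr_deriv (by simp)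

/-- Quantitative continuous dependence of a solution on the spectral parameter. -/
lemma exists_dist_sq_le (hp : SLCoeff p q m) (h : IsSLSol p q m a c d w y) :
    ∃ C, 0 ≤ C ∧ ∀ b v z, |b - a| ≤ 1 → IsSLSol p q m b c d v z → v c = w c → z c = y c →
      ∀ t ∈ Icc c d, (v t - w t) ^ 2 + (z t - y t) ^ 2 ≤ C * (b - a) ^ 2 := by
  have hcB : Continuous fun t => 1 / p t + |q t| + (|a| + 1) * |m t| :=
    ((continuous_const.div hp.cont_p fun t => (hp.p_pos t).ne').add hp.cont_q.abs).add
      (continuous_const.mul hp.cont_m.abs)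
  obtain ⟨B, hB⟩ := (isCompact_Icc (a := c) (b := d)).exists_bound_of_continuousOn hcB.continuousOn
  obtain ⟨D, hD⟩ := (isCompact_Icc (a := c) (b := d)).exists_bound_of_continuousOn
    (hp.cont_m.continuousOn.mul h.cont)
  refine ⟨Real.exp (|B + D| * (d - c)), (Real.exp_pos _).le, ?_⟩
  intro b v z hb hv hvc hzc t ht
  have hderiv : ∀ s ∈ Ioo c d, HasDerivAt
      (fun s => (v s - w s) ^ 2 + (z s - y s) ^ 2 + (b - a) ^ 2)
      (2 * (v s - w s) * ((z s - y s) / p s) +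
        2 * (z s - y s) * ((q s - b * m s) * (v s - w s) - (b - a) * (m s * w s))) s := by
    intro s hs
    have h1 := ((hv.deriv s hs).sub (h.deriv s hs)).pow 2
    have h2 := ((hv.deriv_flux s hs).sub (h.deriv_flux s hs)).pow 2
    exact ((h1.add h2).add_const _).congr_deriv (by simp; ring)
  have hle : ∀ s ∈ Ioo c d, 2 * (v s - w s) * ((z s - y s) / p s) +
        2 * (z s - y s) * ((q s - b * m s) * (v s - w s) - (b - a) * (m s * w s)) ≤
        |B + D| * ((v s - w s) ^ 2 + (z s - y s) ^ 2 + (b - a) ^ 2) := by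
    intro s hs
    have hB' := hB s (Ioo_subset_Icc_self hs)
    have hD' := hD s (Ioo_subset_Icc_self hs)
    have hps := hp.p_pos s
    rw [Real.norm_of_nonneg (by positivity)] at hB'
    rw [Real.norm_eq_abs, Pi.mul_apply] at hD'
    have hba : |b| ≤ |a| + 1 := by
      have := abs_sub_abs_le_abs_sub b a
      linarith
    have hR : |1 / p s + (q s - b * m s)| ≤ B := by
      calc |1 / p s + (q s - b * m s)| ≤ |1 / p s| + (|q s| + |b * m s|) :=
            (abs_add_le _ _).trans (by gcongr; exact abs_sub _ _)
        _ ≤ 1 / p s + |q s| + (|a| + 1) * |m s| := by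
            rw [abs_mul, abs_of_pos (by positivity : 0 < 1 / p s)]
            have := mul_le_mul_of_nonneg_right hba (abs_nonneg (m s))
            linarith
        _ ≤ B := hB'
    set X := v s - w s
    set Y := z s - y s
    set R := 1 / p s + (q s - b * m s) with hRdef
    have e : 2 * X * (Y / p s) + 2 * Y * ((q s - b * m s) * X - (b - a) * (m s * w s)) =
        R * (2 * X * Y) - (m s * w s) * (2 * Y * (b - a)) := by
      rw [hRdef]; ring
    rw [e]
    have hR0 := abs_le.1 hR
    have hD0 := abs_le.1 hD'
    have k1 : R * (2 * X * Y) ≤ B * (X ^ 2 + Y ^ 2) := by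
      nlinarith [mul_nonneg (sub_nonneg.2 hR0.2) (sq_nonneg (X + Y)),
        mul_nonneg (by linarith [hR0.1] : 0 ≤ B + R) (sq_nonneg (X - Y))]
    have k2 : - (m s * w s) * (2 * Y * (b - a)) ≤ D * (Y ^ 2 + (b - a) ^ 2) := by
      nlinarith [mul_nonneg (sub_nonneg.2 hD0.2) (sq_nonneg (Y - (b - a))),
        mul_nonneg (by linarith [hD0.1] : 0 ≤ D + m s * w s) (sq_nonneg (Y + (b - a)))]
    have hB0 : 0 ≤ B := (abs_nonneg _).trans hR
    have hD00 : 0 ≤ D := (abs_nonneg _).trans hD'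
    rw [abs_of_nonneg (by linarith)]
    nlinarith [mul_nonneg hB0 (sq_nonneg (b - a)), mul_nonneg hD00 (sq_nonneg X)]
  have hcont : ContinuousOn (fun s => (v s - w s) ^ 2 + (z s - y s) ^ 2 + (b - a) ^ 2)
      (Icc c d) :=
    (((hv.cont.sub h.cont).pow 2).add ((hv.cont_flux.sub h.cont_flux).pow 2)).add
      continuousOn_const
  have key := le_mul_exp_of_deriv_le hcont hderiv hle ht
  simp only [hvc, hzc, sub_self] at key
  have hexp : Real.exp (|B + D| * (t - c)) ≤ Real.exp (|B + D| * (d - c)) := by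
    gcongr
    exact ht.2
  nlinarith [sq_nonneg (b - a), mul_le_mul_of_nonneg_left hexp (sq_nonneg (b - a))]

lemma eqOn_of_left (hp : SLCoeff p q m) (hw : IsSLSol p q m a c d w y)
    (hv : IsSLSol p q m a c d v z) (h1 : v c = w c) (h2 : z c = y c) {t : ℝ}
    (ht : t ∈ Icc c d) : v t = w t ∧ z t = y t := by
  obtain ⟨C, -, hC⟩ := exists_dist_sq_le hp hw
  have := hC a v z (by simp) hv h1 h2 t ht
  simp only [sub_self] at this
  constructor <;> nlinarith [sq_nonneg (v t - w t), sq_nonneg (z t - y t)]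

end IsSLSol

lemma SLCoeff.reflect {p q m : ℝ → ℝ} (h : SLCoeff p q m) :
    SLCoeff (fun t => p (-t)) (fun t => q (-t)) (fun t => m (-t)) :=
  ⟨h.cont_p.comp continuous_neg, h.cont_q.comp continuous_neg, h.cont_m.comp continuous_neg,
    fun _ => h.p_pos _, fun _ => h.q_nonneg _⟩

namespace IsSLSol

variable {p q m : ℝ → ℝ} {a b c d : ℝ} {w y v z : ℝ → ℝ}

lemma eq_zero_of_right (hp : SLCoeff p q m) (hw : IsSLSol p q m a c d w y)
    (h1 : w d = 0) (h2 : y d = 0) {t : ℝ} (ht : t ∈ Icc c d) : w t = 0 ∧ y t = 0 := by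
  have := eqOn_of_left hp.reflect (zero (a := a)) hw.reflect (by simpa using h1)
    (by simpa using h2) (t := -t) ⟨by linarith [ht.2], by linarith [ht.1]⟩
  simpa using this

/-- Existence for the initial value problem `w(c) = 1`, `(p w')(c) = 0`. -/
lemma exists_ivp (hp : SLCoeff p q m) (a : ℝ) {c d : ℝ} (hcd : c ≤ d) :
    ∃ w y, IsSLSol p q m a c d w y ∧ w c = 1 ∧ y c = 0 := by
  have hcB : Continuous fun t => 1 / p t + |q t - a * m t| :=
    (continuous_const.div hp.cont_p fun t => (hp.p_pos t).ne').add
      (hp.cont_q.sub (continuous_const.mul hp.cont_m)).abs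
  obtain ⟨B, hB⟩ := (isCompact_Icc (a := c) (b := d)).exists_bound_of_continuousOn hcB.continuousOn
  have hB' : ∀ t ∈ Icc c d, 1 / p t ≤ B ∧ |q t - a * m t| ≤ B := by
    intro t ht
    have := (le_abs_self _).trans (hB t ht)
    have h1 : 0 < 1 / p t := by have := hp.p_pos t; positivity
    constructor <;> linarith [abs_nonneg (q t - a * m t)]
  have hB0 : 0 ≤ B := (abs_nonneg _).trans (hB' c (left_mem_Icc.2 hcd)).2
  set R : ℝ := Real.exp (2 * B * (d - c)) with hR
  have hR0 : 0 < R := Real.exp_pos _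
  have hR1 : 1 ≤ R := Real.one_le_exp (mul_nonneg (by linarith) (by linarith))
  set T : ℝ → ℝ := fun x => max (-R) (min R x) with hT
  have hTl : ∀ x x', |T x - T x'| ≤ |x - x'| := fun x x' =>
    (abs_max_sub_max_le_max _ _ _ _).trans
      (by simpa using abs_min_sub_min_le_max R x R x')
  have hTR : ∀ x, |T x| ≤ R := fun x =>
    abs_le.2 ⟨le_max_left _ _, max_le (by linarith) (min_le_left _ _)⟩
  have hT0 : T 0 = 0 := by simp [hT, hR0.le]
  have hTx : ∀ x, |T x| ≤ |x| := fun x => by simpa [hT0] using hTl x 0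
  have hTid : ∀ x, |x| ≤ R → T x = x := fun x hx => by
    simp [hT, (abs_le.1 hx).1, (abs_le.1 hx).2]
  let f : ℝ → ℝ × ℝ → ℝ × ℝ := fun t x => (1 / p t * T x.2, (q t - a * m t) * T x.1)
  have hPL : IsPicardLindelof f (⟨c, left_mem_Icc.2 hcd⟩ : Icc c d) ((1, 0) : ℝ × ℝ)
      (⟨B * R * (d - c), by have := sub_nonneg.2 hcd; positivity⟩ : NNReal) 0
      ⟨B * R, by positivity⟩ ⟨B, hB0⟩ := by
    refine ⟨fun t ht => ?_, fun x _ => ?_, fun t ht x _ => ?_, ?_⟩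
    · apply LipschitzWith.lipschitzOnWith
      refine LipschitzWith.of_dist_le_mul fun x x' => ?_
      obtain ⟨h1, h2⟩ := hB' t ht
      have hpt := hp.p_pos t
      rw [Prod.dist_eq, Prod.dist_eq, Real.dist_eq, Real.dist_eq, Real.dist_eq, Real.dist_eq]
      simp only [f, ← mul_sub, abs_mul]
      rw [abs_of_pos (by positivity : 0 < 1 / p t)]
      refine max_le ?_ ?_
      · exact mul_le_mul h1 ((hTl _ _).trans (le_max_right _ _)) (abs_nonneg _) hB0
      · exact mul_le_mul h2 ((hTl _ _).trans (le_max_left _ _)) (abs_nonneg _) hB0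
    · apply Continuous.continuousOn
      exact ((continuous_const.div hp.cont_p fun t => (hp.p_pos t).ne').mul continuous_const).prodMk
        ((hp.cont_q.sub (continuous_const.mul hp.cont_m)).mul continuous_const)
    · obtain ⟨h1, h2⟩ := hB' t ht
      have hpt := hp.p_pos t
      rw [Prod.norm_def, Real.norm_eq_abs, Real.norm_eq_abs]
      simp only [f, abs_mul]
      rw [abs_of_pos (by positivity : 0 < 1 / p t)]
      exact max_le (mul_le_mul h1 (hTR _) (abs_nonneg _) hB0)
        (mul_le_mul h2 (hTR _) (abs_nonneg _) hB0)
    · simp only [sub_self, sub_nonneg.2 hcd, sup_of_le_left, NNReal.coe_zero, sub_zero]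
      exact le_refl (B * R * (d - c))
  obtain ⟨γ, hγ0, hγ⟩ := hPL.exists_eq_forall_mem_Icc_hasDerivWithinAt₀
  have h1 : ∀ t ∈ Icc c d, HasDerivWithinAt (fun s => (γ s).1) (1 / p t * T (γ t).2) (Icc c d) t :=
    fun t ht => (hγ t ht).fst
  have h2 : ∀ t ∈ Icc c d,
      HasDerivWithinAt (fun s => (γ s).2) ((q t - a * m t) * T (γ t).1) (Icc c d) t :=
    fun t ht => (hγ t ht).snd
  have c1 : ContinuousOn (fun s => (γ s).1) (Icc c d) := fun t ht => (h1 t ht).continuousWithinAt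
  have c2 : ContinuousOn (fun s => (γ s).2) (Icc c d) := fun t ht => (h2 t ht).continuousWithinAt
  have d1 : ∀ t ∈ Ioo c d, HasDerivAt (fun s => (γ s).1) (1 / p t * T (γ t).2) t := fun t ht =>
    (h1 t (Ioo_subset_Icc_self ht)).hasDerivAt (Icc_mem_nhds ht.1 ht.2)
  have d2 : ∀ t ∈ Ioo c d, HasDerivAt (fun s => (γ s).2) ((q t - a * m t) * T (γ t).1) t :=
    fun t ht => (h2 t (Ioo_subset_Icc_self ht)).hasDerivAt (Icc_mem_nhds ht.1 ht.2)
  have hbound : ∀ t ∈ Icc c d, |(γ t).1| ≤ R ∧ |(γ t).2| ≤ R := by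
    intro t ht
    have key := le_mul_exp_of_deriv_le (K := 2 * B) (f := fun s => (γ s).1 ^ 2 + (γ s).2 ^ 2)
      ((c1.pow 2).add (c2.pow 2))
      (fun s hs => (((d1 s hs).pow 2).add ((d2 s hs).pow 2))) (fun s hs => by
        obtain ⟨e1, e2⟩ := hB' s (Ioo_subset_Icc_self hs)
        have hps : 0 < 1 / p s := by have := hp.p_pos s; positivity
        have e1' : |1 / p s| ≤ B := by rwa [abs_of_pos hps]
        have k : ∀ u x y : ℝ, |u| ≤ B → 2 * x * (u * T y) ≤ B * (x ^ 2 + y ^ 2) := by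
          intro u x y hu
          have l1 : |u * T y| ≤ B * |y| := by
            rw [abs_mul]; exact mul_le_mul hu (hTx y) (abs_nonneg _) hB0
          have l2 : 2 * x * (u * T y) ≤ 2 * |x| * (B * |y|) := by
            calc 2 * x * (u * T y) ≤ |2 * x * (u * T y)| := le_abs_self _
              _ = 2 * |x| * |u * T y| := by rw [abs_mul, abs_mul, abs_two]
              _ ≤ _ := by gcongr
          nlinarith [mul_nonneg hB0 (sq_nonneg (|x| - |y|)), sq_abs x, sq_abs y]
        have k1 := k _ (γ s).1 (γ s).2 e1'
        have k2 := k _ (γ s).2 (γ s).1 e2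
        simp only [Nat.cast_ofNat, Nat.add_one_sub_one, pow_one]
        linarith) ht
    simp only [hγ0] at key
    have hexp : Real.exp (2 * B * (t - c)) ≤ R := by
      rw [hR]; gcongr; exact ht.2
    have hRR : R ≤ R ^ 2 := by nlinarith
    have hs : (γ t).1 ^ 2 + (γ t).2 ^ 2 ≤ R ^ 2 := by
      norm_num at key
      linarith
    constructor <;> apply abs_le_of_sq_le_sq _ hR0.le <;>
      nlinarith [sq_nonneg (γ t).1, sq_nonneg (γ t).2]
  refine ⟨fun s => (γ s).1, fun s => (γ s).2, ⟨c1, c2, fun t ht => ?_, fun t ht => ?_⟩, ?_, ?_⟩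
  · refine (d1 t ht).congr_deriv ?_
    rw [hTid _ (hbound t (Ioo_subset_Icc_self ht)).2]; ring
  · refine (d2 t ht).congr_deriv ?_
    rw [hTid _ (hbound t (Ioo_subset_Icc_self ht)).1]
  · simp [hγ0]
  · simp [hγ0]

end IsSLSol

lemma exists_first_zero {f : ℝ → ℝ} {c d : ℝ} (hf : ContinuousOn f (Icc c d)) (hc : 0 < f c)
    (h : ¬ ∀ t ∈ Icc c d, 0 < f t) : ∃ s ∈ Ioc c d, f s = 0 ∧ ∀ t ∈ Ico c s, 0 < f t := by
  push Not at h
  obtain ⟨t₀, ht₀, hft₀⟩ := h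
  have hcl : IsClosed (Icc c d ∩ f ⁻¹' Iic 0) := hf.preimage_isClosed_of_isClosed isClosed_Icc
    isClosed_Iic
  have hbdd : BddBelow (Icc c d ∩ f ⁻¹' Iic 0) := ⟨c, fun x hx => hx.1.1⟩
  have hmem := hcl.csInf_mem ⟨t₀, ht₀, hft₀⟩ hbdd
  set s := sInf (Icc c d ∩ f ⁻¹' Iic 0)
  have hpos : ∀ t ∈ Ico c s, 0 < f t := by
    intro t ht
    by_contra hn
    exact absurd (csInf_le hbdd ⟨⟨ht.1, ht.2.le.trans hmem.1.2⟩, not_lt.1 hn⟩) (not_le.2 ht.2)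
  have hcs : c < s := lt_of_le_of_ne hmem.1.1 fun e => by
    have : f s ≤ 0 := hmem.2
    rw [← e] at this
    linarith
  refine ⟨s, ⟨hcs, hmem.1.2⟩, le_antisymm hmem.2 ?_, hpos⟩
  have hcw : ContinuousWithinAt f (Ico c s) s :=
    (hf s hmem.1).mono (fun x hx => ⟨hx.1, hx.2.le.trans hmem.1.2⟩)
  have hmc : s ∈ closure (Ico c s) := by
    rw [closure_Ico hcs.ne]; exact right_mem_Icc.2 hcs.le
  have := hcw.mem_closure hmc (t := Ici 0) (fun x hx => (hpos x hx).le)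
  rwa [isClosed_Ici.closure_eq] at this

namespace IsSLSol

variable {p q m : ℝ → ℝ} {a b c d : ℝ} {w y v z : ℝ → ℝ}

lemma continuousOn_energy (hp : SLCoeff p q m) {φ ψ : ℝ → ℝ} {s : Set ℝ}
    (hφ : ContinuousOn φ s) (hψ : ContinuousOn ψ s) :
    ContinuousOn (fun t => ψ t ^ 2 / p t + q t * φ t ^ 2) s :=
  ((hψ.pow 2).div hp.cont_p.continuousOn fun t _ => (hp.p_pos t).ne').add
    (hp.cont_q.continuousOn.mul (hφ.pow 2))

/-- Energy identity. -/
lemma energy (hp : SLCoeff p q m) (h : IsSLSol p q m a c d w y) (hcd : c ≤ d) :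
    w d * y d - w c * y c =
      (∫ t in c..d, (y t ^ 2 / p t + q t * w t ^ 2)) - a * ∫ t in c..d, m t * w t ^ 2 := by
  have i1 : IntervalIntegrable (fun t => y t ^ 2 / p t + q t * w t ^ 2) volume c d :=
    ContinuousOn.intervalIntegrable_of_Icc hcd (continuousOn_energy hp h.cont h.cont_flux)
  have i2 : IntervalIntegrable (fun t => m t * w t ^ 2) volume c d :=
    ContinuousOn.intervalIntegrable_of_Icc hcd (hp.cont_m.continuousOn.mul (h.cont.pow 2))
  rw [← intervalIntegral.integral_const_mul, ← intervalIntegral.integral_sub i1 (i2.const_mul a)]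
  symm
  apply intervalIntegral.integral_eq_sub_of_hasDerivAt_of_le hcd (f := fun t => w t * y t)
    (h.cont.mul h.cont_flux) _ (i1.sub (i2.const_mul a))
  intro t ht
  exact ((h.deriv t ht).mul (h.deriv_flux t ht)).congr_deriv (by ring)

/-- Picone's inequality. -/
lemma picone (hp : SLCoeff p q m) (hv : IsSLSol p q m b c d v z) (hcd : c ≤ d)
    (hpos : ∀ t ∈ Icc c d, 0 < v t) {φ ψ : ℝ → ℝ} (hφ : ContinuousOn φ (Icc c d))
    (hψ : ContinuousOn ψ (Icc c d)) (hd : ∀ t ∈ Ioo c d, HasDerivAt φ (ψ t / p t) t) :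
    φ d ^ 2 * z d / v d - φ c ^ 2 * z c / v c ≤
      (∫ t in c..d, (ψ t ^ 2 / p t + q t * φ t ^ 2)) - b * ∫ t in c..d, m t * φ t ^ 2 := by
  have ce := continuousOn_energy hp hφ hψ
  have cm : ContinuousOn (fun t => m t * φ t ^ 2) (Icc c d) :=
    hp.cont_m.continuousOn.mul (hφ.pow 2)
  rw [← intervalIntegral.integral_const_mul, ← intervalIntegral.integral_sub
    (ce.intervalIntegrable_of_Icc hcd) ((cm.intervalIntegrable_of_Icc hcd).const_mul b)]
  refine intervalIntegral.sub_le_integral_of_hasDeriv_right_of_le hcd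
    (g := fun t => φ t ^ 2 * z t / v t)
    (((hφ.pow 2).mul hv.cont_flux).div hv.cont fun t ht => (hpos t ht).ne')
    (g' := fun t => ((2 * φ t * (ψ t / p t)) * z t + φ t ^ 2 * ((q t - b * m t) * v t)) / v t
      - φ t ^ 2 * z t * (z t / p t) / v t ^ 2) ?_
    (ce.sub (cm.const_smul b)).integrableOn_Icc ?_
  · intro t ht
    have hv0 := (hpos t (Ioo_subset_Icc_self ht)).ne'
    have := (((hd t ht).pow 2).mul (hv.deriv_flux t ht)).div (hv.deriv t ht) hv0
    refine (this.congr_deriv ?_).hasDerivWithinAt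
    simp only [Nat.cast_ofNat, Nat.add_one_sub_one, pow_one, Pi.mul_apply, Pi.pow_apply]
    field_simp
  · intro t ht
    have hv0 := hpos t (Ioo_subset_Icc_self ht)
    have hp0 := hp.p_pos t
    have : 0 ≤ (ψ t - φ t * z t / v t) ^ 2 / p t := by positivity
    have e : (ψ t - φ t * z t / v t) ^ 2 / p t =
      ψ t ^ 2 / p t + q t * φ t ^ 2 - b * (m t * φ t ^ 2) -
      (((2 * φ t * (ψ t / p t)) * z t + φ t ^ 2 * ((q t - b * m t) * v t)) / v t
      - φ t ^ 2 * z t * (z t / p t) / v t ^ 2) := by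
      field_simp
      ring
    show _ ≤ ψ t ^ 2 / p t + q t * φ t ^ 2 - b * (m t * φ t ^ 2)
    linarith

lemma monotoneOn_of_weight_nonpos (hp : SLCoeff p q m) (h : IsSLSol p q m a c d w y)
    (ha : 0 ≤ a) (hm : ∀ t ∈ Ioo c d, m t ≤ 0) (hw : ∀ t ∈ Ioo c d, 0 ≤ w t) (hy : 0 ≤ y c) :
    MonotoneOn w (Icc c d) := by
  have my : MonotoneOn y (Icc c d) := by
    apply monotoneOn_of_hasDerivWithinAt_nonneg (convex_Icc c d) h.cont_flux
      (f' := fun t => (q t - a * m t) * w t) <;> rw [interior_Icc]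
    · exact fun t ht => (h.deriv_flux t ht).hasDerivWithinAt
    · intro t ht
      have := mul_nonpos_of_nonneg_of_nonpos ha (hm t ht)
      exact mul_nonneg (by linarith [hp.q_nonneg t]) (hw t ht)
  apply monotoneOn_of_hasDerivWithinAt_nonneg (convex_Icc c d) h.cont
    (f' := fun t => y t / p t) <;> rw [interior_Icc]
  · exact fun t ht => (h.deriv t ht).hasDerivWithinAt
  · intro t ht
    have := my (left_mem_Icc.2 (ht.1.trans ht.2).le) (Ioo_subset_Icc_self ht) ht.1.le
    exact div_nonneg (by linarith) (hp.p_pos t).le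

lemma pos_of_weight_nonpos (hp : SLCoeff p q m) (h : IsSLSol p q m a c d w y)
    (ha : 0 ≤ a) (hm : ∀ t ∈ Ioo c d, m t ≤ 0) (hw : w c = 1) (hy : y c = 0) :
    ∀ t ∈ Icc c d, 0 < w t := by
  by_contra hn
  obtain ⟨s, hs, hws, hpos⟩ := exists_first_zero h.cont (by rw [hw]; exact one_pos) hn
  have := monotoneOn_of_weight_nonpos hp (h.mono le_rfl hs.2) ha
    (fun t ht => hm t ⟨ht.1, ht.2.trans_le hs.2⟩) (fun t ht => (hpos t ⟨ht.1.le, ht.2⟩).le) hy.ge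
    (left_mem_Icc.2 hs.1.le) (right_mem_Icc.2 hs.1.le) hs.1.le
  rw [hw, hws] at this
  linarith

lemma flux_neg_of_pos (hp : SLCoeff p q m) (h : IsSLSol p q m a c d w y) (hcd : c < d)
    (hpos : ∀ t ∈ Ioo c d, 0 < w t) (hd : w d = 0) : y d < 0 := by
  by_contra hn
  rcases (not_lt.1 hn).eq_or_lt with h0 | h0
  · have hmid : (c + d) / 2 ∈ Ioo c d := ⟨by linarith, by linarith⟩
    have := (eq_zero_of_right hp h hd h0.symm (Ioo_subset_Icc_self hmid)).1
    linarith [hpos _ hmid]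
  · have hev : ∀ᶠ t in 𝓝[Icc c d] d, 0 < y t :=
      (h.cont_flux d (right_mem_Icc.2 hcd.le)).eventually (lt_mem_nhds h0)
    rw [nhdsWithin_Icc_eq_nhdsLE hcd] at hev
    obtain ⟨l, hl, hls⟩ := (mem_nhdsLE_iff_exists_Ioc_subset' hcd).1 hev
    obtain ⟨e, he1, he2⟩ := exists_between (max_lt hl hcd)
    have hce : c < e := (le_max_right _ _).trans_lt he1
    have hle : l < e := (le_max_left _ _).trans_lt he1
    have hmono : MonotoneOn w (Icc e d) := by
      apply monotoneOn_of_hasDerivWithinAt_nonneg (convex_Icc e d)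
        (h.cont.mono (Icc_subset_Icc hce.le le_rfl))
        (f' := fun t => y t / p t) <;> rw [interior_Icc]
      · exact fun t ht => (h.deriv t ⟨hce.trans ht.1, ht.2⟩).hasDerivWithinAt
      · exact fun t ht => div_nonneg (le_of_lt (hls ⟨hle.trans ht.1, ht.2.le⟩)) (hp.p_pos t).le
    have := hmono (left_mem_Icc.2 he2.le) (right_mem_Icc.2 he2.le) he2.le
    linarith [hpos e ⟨hce, he2⟩]

end IsSLSol

/-- `b` is the eigenvalue with positive eigenfunction for the Neumann condition at `c` and the
Dirichlet condition at `s`. -/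
def IsNDEigenvalue (p q m : ℝ → ℝ) (c s b : ℝ) : Prop :=
  c < s ∧ ∃ v z, IsSLSol p q m b c s v z ∧ v c = 1 ∧ z c = 0 ∧ (∀ t ∈ Ico c s, 0 < v t) ∧ v s = 0

section

variable {p q m : ℝ → ℝ} {a b c d s : ℝ} {w y v z : ℝ → ℝ}

lemma IsSLSol.isNDEigenvalue (hp : SLCoeff p q m) (h : IsSLSol p q m b c s w y) (hcs : c < s)
    (hy : y c = 0) (hpos : ∀ t ∈ Ioo c s, 0 < w t) (hs : w s = 0) :
    IsNDEigenvalue p q m c s b := by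
  have hmid : (c + s) / 2 ∈ Ioo c s := ⟨by linarith, by linarith⟩
  have hc0 : 0 ≤ w c := by
    have hcw : ContinuousWithinAt w (Ioo c s) c :=
      (h.cont c (left_mem_Icc.2 hcs.le)).mono Ioo_subset_Icc_self
    have hmc : c ∈ closure (Ioo c s) := by
      rw [closure_Ioo hcs.ne]; exact left_mem_Icc.2 hcs.le
    have := hcw.mem_closure hmc (t := Ici 0) (fun x hx => (hpos x hx).le)
    rwa [isClosed_Ici.closure_eq] at this
  have hc : 0 < w c := by
    refine lt_of_le_of_ne hc0 fun e => ?_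
    have := (IsSLSol.eqOn_of_left hp (IsSLSol.zero (a := b)) h e.symm hy
      (Ioo_subset_Icc_self hmid)).1
    exact (hpos _ hmid).ne' this
  refine ⟨hcs, _, _, h.const_mul (w c)⁻¹, inv_mul_cancel₀ hc.ne', by simp [hy], ?_, by simp [hs]⟩
  intro t ht
  have : 0 < w t := by
    rcases ht.1.eq_or_lt with e | e
    · rwa [← e]
    · exact hpos t ⟨e, ht.2⟩
  positivity

/-- If `m > 0` somewhere in `(c, s)` then solutions cannot stay positive for large parameters. -/
lemma exists_bound_of_pos (hp : SLCoeff p q m) (hm : ∃ t ∈ Ioo c s, 0 < m t) :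
    ∃ B, ∀ b v z, IsSLSol p q m b c s v z → (∀ t ∈ Icc c s, 0 < v t) → b ≤ B := by
  obtain ⟨t₀, ht₀, hmt⟩ := hm
  have hev : ∀ᶠ t in 𝓝 t₀, 0 < m t ∧ t ∈ Ioo c s :=
    (hp.cont_m.continuousAt.eventually (lt_mem_nhds hmt)).and (Ioo_mem_nhds ht₀.1 ht₀.2)
  obtain ⟨ε, hε, hball⟩ := Metric.eventually_nhds_iff.1 hev
  obtain ⟨e, he⟩ : ∃ e, e = t₀ - ε / 2 := ⟨_, rfl⟩
  obtain ⟨f, hf⟩ : ∃ f, f = t₀ + ε / 2 := ⟨_, rfl⟩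
  have hef : e < f := by linarith
  have hI : ∀ t ∈ Icc e f, 0 < m t ∧ t ∈ Ioo c s := fun t ht => hball (by
    rw [Real.dist_eq, abs_lt]
    obtain ⟨h1, h2⟩ := ht
    constructor <;> linarith)
  let φ : ℝ → ℝ := fun t => (t - e) * (f - t)
  let ψ : ℝ → ℝ := fun t => p t * (e + f - 2 * t)
  have hφ : Continuous φ := by fun_prop
  have hψ : Continuous ψ := hp.cont_p.mul (by fun_prop)
  have hpos : 0 < ∫ t in e..f, m t * φ t ^ 2 := by
    apply intervalIntegral.intervalIntegral_pos_of_pos_on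
      ((hp.cont_m.mul (hφ.pow 2)).intervalIntegrable _ _) _ hef
    intro t ht
    have h1 := (hI t (Ioo_subset_Icc_self ht)).1
    have h2 := sub_pos.2 ht.1
    have h3 := sub_pos.2 ht.2
    exact mul_pos h1 (pow_pos (mul_pos h2 h3) 2)
  refine ⟨(∫ t in e..f, (ψ t ^ 2 / p t + q t * φ t ^ 2)) / ∫ t in e..f, m t * φ t ^ 2, ?_⟩
  intro b v z hv hvp
  have hce : c ≤ e := (hI e (left_mem_Icc.2 hef.le)).2.1.le
  have hfs : f ≤ s := (hI f (right_mem_Icc.2 hef.le)).2.2.le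
  have := IsSLSol.picone hp (hv.mono hce hfs) hef.le
    (fun t ht => hvp t ⟨hce.trans ht.1, ht.2.trans hfs⟩) hφ.continuousOn hψ.continuousOn
    (fun t _ => by
      have hpt := (hp.p_pos t).ne'
      have := ((hasDerivAt_id t).sub_const e).mul ((hasDerivAt_id t).const_sub f)
      refine this.congr_deriv ?_
      simp only [ψ, id]
      field_simp
      ring)
  have e1 : φ f = 0 := by simp [φ]
  have e2 : φ e = 0 := by simp [φ]
  rw [e1, e2] at this
  rw [le_div_iff₀ hpos]
  norm_num at this
  linarith

/-- Strict comparison: above an eigenvalue `a > 0` on `[c, s]`, solutions lose positivity on a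
uniformly shorter interval. -/
lemma IsNDEigenvalue.exists_not_pos (hp : SLCoeff p q m) (h : IsNDEigenvalue p q m c s a)
    (ha : 0 < a) {a₂ : ℝ} (ha₂ : a < a₂) :
    ∃ s₁ ∈ Ioo c s, ∀ b v z, a₂ ≤ b → IsSLSol p q m b c s₁ v z → z c = 0 →
      ¬ ∀ t ∈ Icc c s₁, 0 < v t := by
  obtain ⟨hcs, w, y, hw, -, hyc, hpos, hws⟩ := h
  have hys : y s < 0 := hw.flux_neg_of_pos hp hcs (fun t ht => hpos t ⟨ht.1.le, ht.2⟩) hws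
  have henergy := hw.energy hp hcs.le
  rw [hws, hyc] at henergy
  have hE : 0 < ∫ t in c..s, (y t ^ 2 / p t + q t * w t ^ 2) := by
    apply intervalIntegral.integral_pos hcs (IsSLSol.continuousOn_energy hp hw.cont hw.cont_flux)
    · intro t _
      have := hp.p_pos t
      have := hp.q_nonneg t
      positivity
    · refine ⟨s, right_mem_Icc.2 hcs.le, ?_⟩
      have := hp.p_pos s
      have := hp.q_nonneg s
      have := pow_pos (neg_pos.2 hys) 2
      rw [neg_sq] at this
      positivity
  set E : ℝ → ℝ := fun τ => ∫ t in c..τ, (y t ^ 2 / p t + q t * (w t - w τ) ^ 2) with hEdef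
  set N : ℝ → ℝ := fun τ => ∫ t in c..τ, m t * (w t - w τ) ^ 2 with hNdef
  have hneg : E s - a₂ * N s < 0 := by
    simp only [hEdef, hNdef, hws, sub_zero]
    have hN : 0 < ∫ t in c..s, m t * w t ^ 2 := by
      by_contra hn
      nlinarith [mul_nonneg ha.le (neg_nonneg.2 (not_lt.1 hn))]
    nlinarith
  have prim : ∀ g : ℝ → ℝ, ContinuousOn g (Icc c s) →
      ContinuousOn (fun τ => ∫ t in c..τ, g t) (Icc c s) := by
    intro g hg
    rw [← uIcc_of_le hcs.le] at hg ⊢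
    exact intervalIntegral.continuousOn_primitive_interval hg.integrableOn_uIcc
  have quad : ∀ g₀ g : ℝ → ℝ, ContinuousOn g₀ (Icc c s) → ContinuousOn g (Icc c s) →
      ContinuousOn (fun τ => ∫ t in c..τ, (g₀ t + g t * (w t - w τ) ^ 2)) (Icc c s) := by
    intro g₀ g hg₀ hg
    have c1 : ContinuousOn (fun t => g₀ t + g t * w t ^ 2) (Icc c s) :=
      hg₀.add (hg.mul (hw.cont.pow 2))
    have c2 : ContinuousOn (fun t => g t * w t) (Icc c s) := hg.mul hw.cont
    refine (((prim _ c1).sub ((hw.cont.const_mul 2).mul (prim _ c2))).add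
      ((hw.cont.pow 2).mul (prim _ hg))).congr fun τ hτ => ?_
    have ii : ∀ {f : ℝ → ℝ}, ContinuousOn f (Icc c s) → IntervalIntegrable f volume c τ :=
      fun hf => (hf.mono (Icc_subset_Icc le_rfl hτ.2)).intervalIntegrable_of_Icc hτ.1
    simp only [Pi.add_apply, Pi.sub_apply, Pi.mul_apply, Pi.pow_apply]
    rw [← intervalIntegral.integral_const_mul, ← intervalIntegral.integral_const_mul,
      ← intervalIntegral.integral_sub (ii c1) ((ii c2).const_mul _),
      ← intervalIntegral.integral_add ((ii c1).sub ((ii c2).const_mul _)) ((ii hg).const_mul _)]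
    congr 1
    ext t
    ring
  have cE : ContinuousOn E (Icc c s) := quad (fun t => y t ^ 2 / p t) q
    ((hw.cont_flux.pow 2).div hp.cont_p.continuousOn fun t _ => (hp.p_pos t).ne')
    hp.cont_q.continuousOn
  have cN : ContinuousOn N (Icc c s) := by
    simpa only [zero_add] using quad (fun _ => 0) m continuousOn_const hp.cont_m.continuousOn
  have hev : ∀ᶠ τ in 𝓝[Icc c s] s, E τ - a₂ * N τ < 0 :=
    ((cE.sub (cN.const_mul a₂)) s (right_mem_Icc.2 hcs.le)).eventually (gt_mem_nhds hneg)
  rw [nhdsWithin_Icc_eq_nhdsLE hcs] at hev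
  obtain ⟨l, hl, hls⟩ := (mem_nhdsLE_iff_exists_Ioc_subset' hcs).1 hev
  obtain ⟨τ, hτ1, hτ2⟩ := exists_between (max_lt hl hcs)
  have hcτ : c < τ := (le_max_right _ _).trans_lt hτ1
  have hτneg : E τ - a₂ * N τ < 0 := hls ⟨(le_max_left _ _).trans_lt hτ1, hτ2.le⟩
  refine ⟨τ, ⟨hcτ, hτ2⟩, fun b v z hb hv hz hvpos => ?_⟩
  have hsub : Icc c τ ⊆ Icc c s := Icc_subset_Icc le_rfl hτ2.le
  have hpic := hv.picone hp hcτ.le hvpos (φ := fun t => w t - w τ) (ψ := y)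
    ((hw.cont.mono hsub).sub continuousOn_const) (hw.cont_flux.mono hsub)
    (fun t ht => (hw.deriv t ⟨ht.1, ht.2.trans hτ2⟩).sub_const _)
  simp only [sub_self, hz] at hpic
  norm_num at hpic
  have hE0 : 0 ≤ E τ := intervalIntegral.integral_nonneg hcτ.le fun t _ => by
    have := hp.p_pos t
    have := hp.q_nonneg t
    positivity
  have hN0 : 0 < N τ := by
    by_contra hn
    nlinarith [mul_nonneg (ha.trans ha₂).le (neg_nonneg.2 (not_lt.1 hn))]
  have : b * N τ ≤ E τ := hpic
  nlinarith

end

namespace IsNDEigenvalue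

variable {p q m : ℝ → ℝ} {a b c d s S β : ℝ}

lemma lt_of_weight_nonpos (hp : SLCoeff p q m) (h : IsNDEigenvalue p q m c s b) (hb : 0 ≤ b)
    (hm : ∀ t ∈ Ioo c S, m t ≤ 0) : S < s := by
  obtain ⟨hcs, v, z, hv, hvc, hzc, -, hvs⟩ := h
  by_contra hn
  have := hv.pos_of_weight_nonpos hp hb (fun t ht => hm t ⟨ht.1, ht.2.trans_le (not_lt.1 hn)⟩)
    hvc hzc s (right_mem_Icc.2 hcs.le)
  linarith

lemma pos_of_lt (hp : SLCoeff p q m) (h : IsNDEigenvalue p q m c S β) (hs : s < S)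
    {v z : ℝ → ℝ} (hv : IsSLSol p q m β c s v z) (hvc : v c = 1) (hzc : z c = 0) :
    ∀ t ∈ Icc c s, 0 < v t := by
  intro t ht
  obtain ⟨-, v₀, z₀, hv₀, hvc₀, hzc₀, hpos, -⟩ := h
  rw [((hv₀.mono le_rfl hs.le).eqOn_of_left hp hv (hvc.trans hvc₀.symm)
    (hzc.trans hzc₀.symm) ht).1]
  exact hpos t ⟨ht.1, ht.2.trans_lt hs⟩

/-- Eigenvalues strictly decrease with the interval. -/
lemma lt_of_lt (hp : SLCoeff p q m) (h : IsNDEigenvalue p q m c s b) (hb : 0 < b)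
    (h' : IsNDEigenvalue p q m c S β) (hs : s < S) : β < b := by
  by_contra hn
  obtain ⟨hcs, v, z, hv, hvc, hzc, hpos, hvs⟩ := id h
  rcases (not_lt.1 hn).eq_or_lt with e | e
  · subst e
    have := h'.pos_of_lt hp hs hv hvc hzc s (right_mem_Icc.2 hcs.le)
    linarith
  · obtain ⟨s₁, hs₁, hno⟩ := h.exists_not_pos hp hb e
    obtain ⟨hcS, v₀, z₀, hv₀, hvc₀, hzc₀, hpos₀, -⟩ := h'
    exact hno β v₀ z₀ le_rfl (hv₀.mono le_rfl (hs₁.2.trans hs).le) hzc₀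
      fun t ht => hpos₀ t ⟨ht.1, ht.2.trans_lt (hs₁.2.trans hs)⟩

/-- Eigenvalues depend continuously on the interval from the left. -/
lemma exists_lt_add (hp : SLCoeff p q m) (h : IsNDEigenvalue p q m c S β) (hβ : 0 < β) {ε : ℝ}
    (hε : 0 < ε) : ∃ s₁ < S, ∀ s b, s₁ < s → IsNDEigenvalue p q m c s b → b < β + ε := by
  obtain ⟨s₁, hs₁, hno⟩ := h.exists_not_pos hp hβ (a₂ := β + ε) (by linarith)
  refine ⟨s₁, hs₁.2, fun s b hs hb => ?_⟩
  by_contra hn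
  obtain ⟨hcs, v, z, hv, hvc, hzc, hpos, hvs⟩ := hb
  exact hno b v z (not_lt.1 hn) (hv.mono le_rfl hs.le) hzc
    fun t ht => hpos t ⟨ht.1, ht.2.trans_lt hs⟩

/-- Eigenvalues blow up as the interval shrinks to a region where the weight is nonpositive. -/
lemma exists_lt_of_lt (hp : SLCoeff p q m) (hcS : c ≤ S) (hm : ∀ t ∈ Ioo c S, m t ≤ 0) (B : ℝ) :
    ∃ s₀ > S, ∀ s b, s < s₀ → 0 < b → IsNDEigenvalue p q m c s b → B < b := by
  obtain ⟨B', hB', hBB'⟩ : ∃ B', 0 < B' ∧ B < B' :=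
    ⟨max B 0 + 1, by positivity, by linarith [le_max_left B 0]⟩
  obtain ⟨w, y, hw, hwc, hyc⟩ := IsSLSol.exists_ivp hp B' (c := c) (d := S + 1) (by linarith)
  have hwS := (hw.mono le_rfl (by linarith : S ≤ S + 1)).pos_of_weight_nonpos hp hB'.le hm hwc hyc
  have hS : S ∈ Icc c (S + 1) := ⟨hcS, by linarith⟩
  have hS1 : S < S + 1 := by linarith
  have hev : ∀ᶠ t in 𝓝[Icc S (S + 1)] S, 0 < w t :=
    ((hw.cont S hS).mono (Icc_subset_Icc hcS le_rfl)).eventually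
      (lt_mem_nhds (hwS S (right_mem_Icc.2 hcS)))
  rw [nhdsWithin_Icc_eq_nhdsGE hS1] at hev
  obtain ⟨u, hu, hus⟩ := (mem_nhdsGE_iff_exists_Ico_subset' hS1).1 hev
  refine ⟨min u (S + 1), lt_min hu hS1, fun s b hs hb h => ?_⟩
  by_contra hn
  obtain ⟨s₁, hs₁, hno⟩ := h.exists_not_pos hp hb (lt_of_le_of_lt (not_lt.1 hn) hBB')
  have hs₁' : s₁ < min u (S + 1) := hs₁.2.trans hs
  refine hno B' w y le_rfl (hw.mono le_rfl (hs₁'.le.trans (min_le_right _ _))) hyc fun t ht => ?_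
  rcases le_or_gt t S with h1 | h1
  · exact hwS t ⟨ht.1, h1⟩
  · exact hus ⟨h1.le, ht.2.trans_lt (hs₁'.trans_le (min_le_left _ _))⟩

end IsNDEigenvalue

/-- Existence of the eigenvalue on `[c, s]`, given positivity for a smaller parameter. -/
lemma exists_isNDEigenvalue {p q m : ℝ → ℝ} {c s S β : ℝ} (hp : SLCoeff p q m) (hcs : c < s)
    (h : IsNDEigenvalue p q m c S β) (hs : s < S) (hm : ∃ t ∈ Ioo c s, 0 < m t) :
    ∃ b ≥ β, IsNDEigenvalue p q m c s b := by
  choose V Z hV hVc hZc using fun a => IsSLSol.exists_ivp hp a hcs.le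
  obtain ⟨B, hB⟩ := exists_bound_of_pos hp hm
  set A : Set ℝ := {a | ∀ t ∈ Icc c s, 0 < V a t}
  have hβA : β ∈ A := h.pos_of_lt hp hs (hV β) (hVc β) (hZc β)
  have hbdd : BddAbove A := ⟨B, fun a ha => hB a _ _ (hV a) ha⟩
  obtain ⟨b, hb⟩ : ∃ b, b = sSup A := ⟨_, rfl⟩
  obtain ⟨C, hC0, hC⟩ := (hV b).exists_dist_sq_le hp
  have hdist : ∀ a, |a - b| ≤ 1 → ∀ t ∈ Icc c s, (V a t - V b t) ^ 2 ≤ C * (a - b) ^ 2 :=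
    fun a ha t ht => by
      nlinarith [hC a _ _ ha (hV a) ((hVc a).trans (hVc b).symm) ((hZc a).trans (hZc b).symm) t ht,
        sq_nonneg (Z a t - Z b t)]
  have hnear : ∀ η > 0, ∃ δ > 0, ∀ a, |a - b| ≤ δ → ∀ t ∈ Icc c s, |V a t - V b t| < η := by
    intro η hη
    have hC1 : 0 < √(C + 1) := Real.sqrt_pos.2 (by linarith)
    refine ⟨min 1 (η / (√(C + 1) * 2)), by positivity, fun a ha t ht => ?_⟩
    have h1 := hdist a (ha.trans (min_le_left _ _)) t ht
    have h2 : |a - b| ≤ η / (√(C + 1) * 2) := ha.trans (min_le_right _ _)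
    rw [le_div_iff₀ (by positivity)] at h2
    apply abs_lt_of_sq_lt_sq _ hη.le
    have h3 : (a - b) ^ 2 * (C + 1) * 4 ≤ η ^ 2 := by
      have := pow_le_pow_left₀ (by positivity) h2 2
      rw [mul_pow, mul_pow, sq_abs, Real.sq_sqrt (by linarith)] at this
      linarith
    nlinarith [sq_nonneg (a - b), sq_pos_of_pos hη]
  have hnonneg : ∀ t ∈ Icc c s, 0 ≤ V b t := by
    intro t ht
    by_contra hn
    obtain ⟨δ, hδ, hδ'⟩ := hnear (-V b t) (by linarith)
    obtain ⟨a, ha, hab⟩ := exists_lt_of_lt_csSup ⟨β, hβA⟩ (show b - δ < sSup A by linarith)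
    have hab' : a ≤ b := hb ▸ le_csSup hbdd ha
    have := (abs_lt.1 (hδ' a (abs_le.2 ⟨by linarith, by linarith⟩) t ht)).2
    linarith [ha t ht]
  have hint : ∀ t ∈ Ioo c s, 0 < V b t := by
    intro t ht
    refine lt_of_le_of_ne (hnonneg t (Ioo_subset_Icc_self ht)) fun e => ?_
    have hmin : IsLocalMin (V b) t := by
      filter_upwards [Ioo_mem_nhds ht.1 ht.2] with x hx
      rw [← e]
      exact hnonneg x (Ioo_subset_Icc_self hx)
    have hd := hmin.hasDerivAt_eq_zero ((hV b).deriv t ht)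
    have hz : Z b t = 0 := by
      rcases div_eq_zero_iff.1 hd with h | h
      · exact h
      · exact absurd h (hp.p_pos t).ne'
    have := (((hV b).mono le_rfl ht.2.le).eq_zero_of_right hp e.symm hz
      (left_mem_Icc.2 ht.1.le)).1
    rw [hVc b] at this
    exact one_ne_zero this
  refine ⟨b, hb ▸ le_csSup hbdd hβA, (hV b).isNDEigenvalue hp hcs (hZc b) hint ?_⟩
  by_contra hne
  have hs0 : 0 < V b s := lt_of_le_of_ne (hnonneg s (right_mem_Icc.2 hcs.le)) (Ne.symm hne)
  obtain ⟨t₁, ht₁, hmin⟩ := isCompact_Icc.exists_isMinOn (nonempty_Icc.2 hcs.le) (hV b).cont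
  have hpos : 0 < V b t₁ := by
    rcases ht₁.1.eq_or_lt with e | e
    · rw [← e, hVc b]; exact one_pos
    rcases ht₁.2.eq_or_lt with e' | e'
    · rwa [e']
    · exact hint _ ⟨e, e'⟩
  obtain ⟨δ, hδ, hδ'⟩ := hnear _ hpos
  have : b + δ ∈ A := fun t ht => by
    have h1 := (abs_lt.1 (hδ' (b + δ) (by simp [abs_of_pos hδ]) t ht)).1
    have h2 : V b t₁ ≤ V b t := hmin ht
    linarith
  linarith [le_csSup hbdd this]

/-- A solution vanishing at `c` keeps nonzero flux where the weight is nonpositive. -/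
lemma IsSLSol.flux_ne_zero_of_weight_nonpos {p q m : ℝ → ℝ} {a c d : ℝ} {w y : ℝ → ℝ}
    (hp : SLCoeff p q m) (h : IsSLSol p q m a c d w y) (hcd : c ≤ d) (ha : 0 ≤ a)
    (hm : ∀ t ∈ Ioo c d, m t ≤ 0) (hw : w c = 0) (hy : y c ≠ 0) : y d ≠ 0 := by
  intro hyd
  rcases hcd.eq_or_lt with e | e
  · exact hy (e ▸ hyd)
  have hen := h.energy hp hcd
  rw [hw, hyd] at hen
  have hE : 0 < ∫ t in c..d, (y t ^ 2 / p t + q t * w t ^ 2) := by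
    apply intervalIntegral.integral_pos e (IsSLSol.continuousOn_energy hp h.cont h.cont_flux)
    · intro t _
      have := hp.p_pos t
      have := hp.q_nonneg t
      positivity
    · refine ⟨c, left_mem_Icc.2 e.le, ?_⟩
      have := hp.p_pos c
      have := hp.q_nonneg c
      positivity
  have hN : ∫ t in c..d, m t * w t ^ 2 ≤ 0 := by
    rw [intervalIntegral.integral_of_le hcd, integral_Ioc_eq_integral_Ioo]
    exact setIntegral_nonpos measurableSet_Ioo fun t ht =>
      mul_nonpos_of_nonpos_of_nonneg (hm t ht) (sq_nonneg _)
  nlinarith [mul_nonneg ha (neg_nonneg.2 hN)]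

/-- A function differentiable inside `[a, b]` off one point, with continuous derivative `g`,
extends to a function with derivative `g` at every point of `[a, b]`. -/
lemma exists_hasDerivAt_extension {f g : ℝ → ℝ} {a b s : ℝ} (hab : a ≤ b)
    (hf : ContinuousOn f (Icc a b)) (hg : ContinuousOn g (Icc a b))
    (hd : ∀ t ∈ Ioo a b \ {s}, HasDerivAt f (g t) t) :
    ∃ F, EqOn F f (Icc a b) ∧ ∀ t ∈ Icc a b, HasDerivAt F (g t) t := by
  obtain ⟨G, hG, hGg⟩ : ∃ G : ℝ → ℝ, Continuous G ∧ EqOn G g (Icc a b) :=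
    ⟨IccExtend hab ((Icc a b).domRestrict g), hg.domRestrict.Icc_extend',
      fun t ht => by rw [IccExtend_of_mem _ _ ht]; rfl⟩
  refine ⟨fun t => f a + ∫ x in a..t, G x, fun t ht => ?_, fun t ht => ?_⟩
  · have := integral_eq_of_hasDerivAt_off_countable_of_le f G ht.1 (countable_singleton s)
      (hf.mono (Icc_subset_Icc le_rfl ht.2))
      (fun x hx => (hd x ⟨⟨hx.1.1, hx.1.2.trans_le ht.2⟩, hx.2⟩).congr_deriv
        (hGg ⟨hx.1.1.le, hx.1.2.le.trans ht.2⟩).symm) (hG.intervalIntegrable _ _)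
    simp only [this]
    ring
  · rw [← hGg ht]
    exact (hG.integral_hasStrictDerivAt a t).hasDerivAt.const_add _

lemma forall_pos_of_isPreconnected {f : ℝ → ℝ} {S : Set ℝ} (hS : IsPreconnected S)
    (hf : ContinuousOn f S) (h0 : ∀ t ∈ S, f t ≠ 0) {x : ℝ} (hx : x ∈ S) (hfx : 0 < f x) :
    ∀ t ∈ S, 0 < f t := by
  intro t ht
  by_contra hn
  obtain ⟨r, hr, hr0⟩ := hS.intermediate_value ht hx hf ⟨not_lt.1 hn, hfx.le⟩
  exact h0 r hr hr0

lemma ContinuousOn.exists_continuous_eqOn_Icc {f : ℝ → ℝ} {a b : ℝ} (hab : a ≤ b)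
    (hf : ContinuousOn f (Icc a b)) :
    ∃ F : ℝ → ℝ, Continuous F ∧ EqOn F f (Icc a b) ∧ ∀ t, ∃ x ∈ Icc a b, F t = f x :=
  ⟨IccExtend hab ((Icc a b).domRestrict f), hf.domRestrict.Icc_extend',
    fun t ht => by rw [IccExtend_of_mem _ _ ht]; rfl, fun t => ⟨_, (projIcc a b hab t).2, rfl⟩⟩

lemma ContinuousOn.Icc_of_Icc {f g h : ℝ → ℝ} {a b s : ℝ} (has : a ≤ s) (hsb : s ≤ b)
    (hg : ContinuousOn g (Icc a s)) (hh : ContinuousOn h (Icc s b))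
    (hfg : EqOn f g (Icc a s)) (hfh : EqOn f h (Icc s b)) : ContinuousOn f (Icc a b) := by
  rw [← Icc_union_Icc_eq_Icc has hsb]
  exact (hg.congr hfg).union_of_isClosed (hh.congr hfh) isClosed_Icc isClosed_Icc

lemma IsSLSol.of_hasDerivAt {p q m P Q M u u' pu' : ℝ → ℝ} {a c d : ℝ} (hP : SLCoeff P Q M)
    (hPp : EqOn P p (Ioo c d)) (hQq : EqOn Q q (Ioo c d)) (hMm : EqOn M m (Ioo c d))
    (hu : ∀ t ∈ Icc c d, HasDerivAt u (u' t) t)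
    (hpu : ∀ t ∈ Icc c d, HasDerivAt (fun s => p s * u' s) (pu' t) t)
    (heq : ∀ t ∈ Ioo c d, -pu' t + q t * u t = a * m t * u t) :
    IsSLSol P Q M a c d u (fun t => p t * u' t) := by
  refine ⟨fun t ht => (hu t ht).continuousAt.continuousWithinAt,
    fun t ht => (hpu t ht).continuousAt.continuousWithinAt, fun t ht => ?_, fun t ht => ?_⟩
  · refine (hu t (Ioo_subset_Icc_self ht)).congr_deriv ?_
    have := (hP.p_pos t).ne'
    rw [← hPp ht]
    field_simp
  · refine (hpu t (Ioo_subset_Icc_self ht)).congr_deriv ?_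
    rw [hQq ht, hMm ht]
    linarith [heq t ht]

lemma IsNDEigenvalue.of_first_zero {p q m w y : ℝ → ℝ} {a c d s : ℝ}
    (h : IsSLSol p q m a c d w y) (hw : w c = 1) (hy : y c = 0)
    (hne : {t | c < t ∧ t ≤ d ∧ w t = 0}.Nonempty)
    (hs : sInf {t | c < t ∧ t ≤ d ∧ w t = 0} = s) : IsNDEigenvalue p q m c s a := by
  obtain ⟨t₀, h1, h2, h3⟩ := hne
  obtain ⟨r, hr, hwr, hpos⟩ := exists_first_zero h.cont (by rw [hw]; exact one_pos)
    fun hn => (hn t₀ ⟨h1.le, h2⟩).ne' h3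
  have : sInf {t | c < t ∧ t ≤ d ∧ w t = 0} = r :=
    IsLeast.csInf_eq ⟨⟨hr.1, hr.2, hwr⟩, fun t ht => not_lt.1 fun hlt =>
      (hpos t ⟨ht.1.le, hlt⟩).ne' ht.2.2⟩
  rw [← hs, this]
  exact ⟨hr.1, w, y, h.mono le_rfl hr.2, hw, hy, hpos, hwr⟩

lemma IsNDEigenvalue.flux_ne_zero {p q m w y : ℝ → ℝ} {a c d s : ℝ} (hp : SLCoeff p q m)
    (he : IsNDEigenvalue p q m c s a) (hsd : s ≤ d) (ha : 0 ≤ a) (hm : ∀ t ∈ Ioo s d, m t ≤ 0)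
    (h : IsSLSol p q m a c d w y) (hw : w c = 1) (hy : y c = 0) : y d ≠ 0 := by
  obtain ⟨hcs, v, z, hv, hvc, hzc, hpos, hvs⟩ := he
  have hs := (h.mono le_rfl hsd).eqOn_of_left hp hv (hvc.trans hw.symm) (hzc.trans hy.symm)
    (right_mem_Icc.2 hcs.le)
  refine (h.mono hcs.le le_rfl).flux_ne_zero_of_weight_nonpos hp hsd ha hm (hs.1 ▸ hvs) ?_
  rw [← hs.2]
  exact (hv.flux_neg_of_pos hp hcs (fun t ht => hpos t ⟨ht.1.le, ht.2⟩) hvs).ne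

lemma exists_isNDEigenvalue_pair {p q m p' q' m' : ℝ → ℝ} {c c' S₁ S₂ α β : ℝ}
    (hp : SLCoeff p q m) (hp' : SLCoeff p' q' m') (hc : c ≤ S₁) (hc' : c' ≤ -S₂) (hS : S₁ < S₂)
    (hm : ∀ s > S₁, ∃ t ∈ Ioo c s, 0 < m t) (hm' : ∀ s > -S₂, ∃ t ∈ Ioo c' s, 0 < m' t)
    (hn' : ∀ t ∈ Ioo c' (-S₂), m' t ≤ 0) (hβ : 0 < β) (hα : 0 < α)
    (h : IsNDEigenvalue p q m c S₂ β) (h' : IsNDEigenvalue p' q' m' c' (-S₁) α)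
    {ε : ℝ} (hε : 0 < ε) (B : ℝ) :
    ∃ s b a, 0 < b ∧ b < β + ε ∧ 0 < a ∧ B < a ∧ IsNDEigenvalue p q m c s b ∧
      IsNDEigenvalue p' q' m' c' (-s) a := by
  obtain ⟨s₁, hs₁, h1⟩ := h.exists_lt_add hp hβ hε
  obtain ⟨s₀, hs₀, h0⟩ := IsNDEigenvalue.exists_lt_of_lt hp' hc' hn' B
  obtain ⟨s, hs, hsS⟩ := exists_between (max_lt (max_lt hs₁ hS) (show -s₀ < S₂ by linarith))
  have hss₁ : s₁ < s := ((le_max_left _ _).trans (le_max_left _ _)).trans_lt hs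
  have hsS₁ : S₁ < s := ((le_max_right _ _).trans (le_max_left _ _)).trans_lt hs
  have hss₀ : -s₀ < s := (le_max_right _ _).trans_lt hs
  obtain ⟨b, hb, hbe⟩ := exists_isNDEigenvalue hp (hc.trans_lt hsS₁) h hsS (hm s hsS₁)
  obtain ⟨a, ha, hae⟩ := exists_isNDEigenvalue hp' (show c' < -s by linarith) h' (by linarith)
    (hm' (-s) (by linarith))
  exact ⟨s, b, a, by linarith, h1 s b hss₁ hbe, by linarith,
    h0 (-s) a (by linarith) (by linarith) hae, hbe, hae⟩

section

variable {T₁ T₂ a b s : ℝ} {p q m P Q M : ℝ → ℝ}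

lemma exists_isNDEigenvalue_of_mem_CGT1 (hP : SLCoeff P Q M) (hPp : EqOn P p (Icc T₁ T₂))
    (hQq : EqOn Q q (Icc T₁ T₂)) (hMm : EqOn M m (Icc T₁ T₂)) (h : (a, b) ∈ CGT1 T₁ T₂ p q m 1) :
    ∃ s, IsNDEigenvalue P Q M T₁ s b ∧
      IsNDEigenvalue (fun t => P (-t)) (fun t => Q (-t)) (fun t => M (-t)) (-T₂) (-s) a := by
  obtain ⟨u, ⟨-, u', pu', hu, hpu, heq, hu1, hu2⟩, -, hcard, huT⟩ := h
  obtain ⟨s, hs⟩ := ncard_eq_one.1 hcard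
  obtain ⟨hsI, hus⟩ : s ∈ {t ∈ Ioo T₁ T₂ | u t = 0} := hs ▸ mem_singleton s
  have huniq : ∀ t ∈ Ioo T₁ T₂, t ≠ s → u t ≠ 0 := fun t ht hts h0 =>
    hts (by have : t ∈ {t ∈ Ioo T₁ T₂ | u t = 0} := ⟨ht, h0⟩
            rwa [hs] at this)
  have hcont : ContinuousOn u (Icc T₁ T₂) := fun t ht =>
    (hu t ht).continuousAt.continuousWithinAt
  have hsol : ∀ {e c d : ℝ}, T₁ ≤ c → d ≤ T₂ →
      (∀ t ∈ Ioo c d, a * max (u t) 0 - b * max (-u t) 0 = e * u t) →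
      IsSLSol P Q M e c d u (fun t => p t * u' t) := by
    intro e c d hc hd h
    have hsub : Icc c d ⊆ Icc T₁ T₂ := Icc_subset_Icc hc hd
    have hsub' : Ioo c d ⊆ Icc T₁ T₂ := Ioo_subset_Icc_self.trans hsub
    refine IsSLSol.of_hasDerivAt hP (hPp.mono hsub') (hQq.mono hsub') (hMm.mono hsub')
      (fun t ht => hu t (hsub ht)) (fun t ht => hpu t (hsub ht)) fun t ht => ?_
    rw [heq t ⟨hc.trans_lt ht.1, ht.2.trans_le hd⟩, h t ht]
    ring
  have hsolpos : ∀ {c d : ℝ}, T₁ ≤ c → d ≤ T₂ → (∀ t ∈ Ioo c d, 0 < u t) →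
      IsSLSol P Q M a c d u (fun t => p t * u' t) := fun hc hd h => hsol hc hd fun t ht => by
    rw [max_eq_left (h t ht).le, max_eq_right (by linarith [h t ht])]
    ring
  have hright : ∀ t ∈ Ioc s T₂, 0 < u t := by
    refine forall_pos_of_isPreconnected isPreconnected_Ioc
      (hcont.mono fun t ht => ⟨(hsI.1.trans ht.1).le, ht.2⟩) (fun t ht => ?_)
      (right_mem_Ioc.2 hsI.2) huT
    rcases ht.2.eq_or_lt with e | e
    · rw [e]; exact huT.ne'
    · exact huniq t ⟨hsI.1.trans ht.1, e⟩ ht.1.ne'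
  have hR := (hsolpos hsI.1.le le_rfl fun t ht => hright t ⟨ht.1, ht.2.le⟩).reflect
  have hRpos : ∀ t ∈ Ioo (-T₂) (-s), 0 < u (-t) := fun t ht =>
    hright _ ⟨by linarith [ht.2], by linarith [ht.1]⟩
  have hRs : u (- -s) = 0 := by rwa [neg_neg]
  have hRlt : -T₂ < -s := by linarith [hsI.2]
  have hflux : 0 < p s * u' s := by
    simpa using hR.flux_neg_of_pos hP.reflect hRlt hRpos hRs
  have hleft0 : ∀ t ∈ Ioo T₁ s, u t ≠ 0 := fun t ht =>
    huniq t ⟨ht.1, ht.2.trans hsI.2⟩ ht.2.ne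
  have hleft : ∀ t ∈ Ioo T₁ s, u t < 0 := by
    intro t ht
    by_contra hn
    have hpos := forall_pos_of_isPreconnected isPreconnected_Ioo
      (hcont.mono fun t ht => ⟨ht.1.le, (ht.2.trans hsI.2).le⟩) hleft0 ht
      (lt_of_le_of_ne (not_lt.1 hn) (hleft0 t ht).symm)
    have := (hsolpos le_rfl hsI.2.le hpos).flux_neg_of_pos hP hsI.1 hpos hus
    linarith
  refine ⟨s, ?_, hR.isNDEigenvalue hP.reflect hRlt (by simp [hu2]) hRpos hRs⟩
  have hL : IsSLSol P Q M b T₁ s u (fun t => p t * u' t) := hsol le_rfl hsI.2.le fun t ht => by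
    rw [max_eq_right (hleft t ht).le, max_eq_left (by linarith [hleft t ht])]
    ring
  exact (hL.const_mul (-1)).isNDEigenvalue hP hsI.1 (by simp [hu1])
    (fun t ht => by linarith [hleft t ht]) (by simp [hus])

lemma mem_CGT1_of_isNDEigenvalue (hP : SLCoeff P Q M) (hPp : EqOn P p (Icc T₁ T₂))
    (hQq : EqOn Q q (Icc T₁ T₂)) (hMm : EqOn M m (Icc T₁ T₂))
    (hp0 : ∀ t ∈ Icc T₁ T₂, ∀ᶠ x in 𝓝 t, p x ≠ 0) (hb : IsNDEigenvalue P Q M T₁ s b)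
    (ha : IsNDEigenvalue (fun t => P (-t)) (fun t => Q (-t)) (fun t => M (-t)) (-T₂) (-s) a) :
    (a, b) ∈ CGT1 T₁ T₂ p q m 1 := by
  obtain ⟨hT₁s, v, z, hv, hv1, hz1, hvpos, hvs⟩ := hb
  obtain ⟨hsT₂, w, y, hw, hw1, hy1, hwpos, hws⟩ := ha
  have hzs := hv.flux_neg_of_pos hP hT₁s (fun t ht => hvpos t ⟨ht.1.le, ht.2⟩) hvs
  have hys := hw.flux_neg_of_pos hP.reflect hsT₂ (fun t ht => hwpos t ⟨ht.1.le, ht.2⟩) hws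
  have hw := hw.reflect
  simp only [neg_neg] at hw
  have hsT₂ : s < T₂ := by linarith
  have hT : T₁ < T₂ := hT₁s.trans hsT₂
  obtain ⟨k, hk⟩ : ∃ k, k = y (-s) / z s := ⟨_, rfl⟩
  have hk0 : 0 < k := hk ▸ div_pos_of_neg_of_neg hys hzs
  have hkz : k * z s = y (-s) := by rw [hk]; field_simp [hzs.ne]
  set u : ℝ → ℝ := fun t => if t ≤ s then -k * v t else w (-t) with hu
  set f : ℝ → ℝ := fun t => if t ≤ s then -k * z t else -y (-t) with hf
  have huL : ∀ t ≤ s, u t = -k * v t := fun t ht => if_pos ht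
  have hfL : ∀ t ≤ s, f t = -k * z t := fun t ht => if_pos ht
  have huR : ∀ t, s ≤ t → u t = w (-t) := by
    intro t ht
    rcases ht.eq_or_lt with e | e
    · rw [← e, huL s le_rfl, hvs, hws, mul_zero]
    · exact if_neg (not_le.2 e)
  have hfR : ∀ t, s ≤ t → f t = -y (-t) := by
    intro t ht
    rcases ht.eq_or_lt with e | e
    · rw [← e, hfL s le_rfl, ← hkz]; ring
    · exact if_neg (not_le.2 e)
  have hL := hv.const_mul (-k)
  have huc : ContinuousOn u (Icc T₁ T₂) := ContinuousOn.Icc_of_Icc hT₁s.le hsT₂.le hL.cont hw.cont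
    (fun t ht => huL t ht.2) (fun t ht => huR t ht.1)
  have hfc : ContinuousOn f (Icc T₁ T₂) := ContinuousOn.Icc_of_Icc hT₁s.le hsT₂.le hL.cont_flux
    hw.cont_flux (fun t ht => hfL t ht.2) (fun t ht => hfR t ht.1)
  have huneg : ∀ t ∈ Ico T₁ s, u t < 0 := fun t ht => by
    rw [huL t ht.2.le]
    nlinarith [mul_pos hk0 (hvpos t ht)]
  have hupos : ∀ t ∈ Ioc s T₂, 0 < u t := fun t ht => by
    rw [huR t ht.1.le]
    exact hwpos _ ⟨by linarith [ht.2], by linarith [ht.1]⟩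
  have hud : ∀ t ∈ Ioo T₁ T₂ \ {s}, HasDerivAt u (f t / P t) t := by
    rintro t ⟨ht, hts⟩
    rcases lt_or_gt_of_ne hts with h | h
    · rw [hfL t h.le]
      exact (hL.deriv t ⟨ht.1, h⟩).congr_of_eventuallyEq <| by
        filter_upwards [Iio_mem_nhds h] with x hx using huL x (le_of_lt hx)
    · rw [hfR t h.le]
      exact (hw.deriv t ⟨h, ht.2⟩).congr_of_eventuallyEq <| by
        filter_upwards [Ioi_mem_nhds h] with x hx using huR x (le_of_lt hx)
  have hfd : ∀ t ∈ Ioo T₁ T₂ \ {s}, HasDerivAt f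
      (Q t * u t - M t * (a * max (u t) 0 - b * max (-u t) 0)) t := by
    rintro t ⟨ht, hts⟩
    rcases lt_or_gt_of_ne hts with h | h
    · have hneg := huneg t ⟨ht.1.le, h⟩
      rw [max_eq_right hneg.le, max_eq_left (by linarith), huL t h.le]
      refine ((hL.deriv_flux t ⟨ht.1, h⟩).congr_of_eventuallyEq ?_).congr_deriv (by ring)
      filter_upwards [Iio_mem_nhds h] with x hx using hfL x (le_of_lt hx)
    · have hpos := hupos t ⟨h, ht.2.le⟩
      rw [max_eq_left hpos.le, max_eq_right (by linarith), huR t h.le]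
      refine ((hw.deriv_flux t ⟨h, ht.2⟩).congr_of_eventuallyEq ?_).congr_deriv (by ring)
      filter_upwards [Ioi_mem_nhds h] with x hx using hfR x (le_of_lt hx)
  obtain ⟨U, hU, hUd⟩ := exists_hasDerivAt_extension hT.le huc (g := fun t => f t / P t)
    (hfc.div hP.cont_p.continuousOn fun t _ => (hP.p_pos t).ne') hud
  obtain ⟨F, hF, hFd⟩ := exists_hasDerivAt_extension hT.le hfc
    (g := fun t => Q t * u t - M t * (a * max (u t) 0 - b * max (-u t) 0))
    ((hP.cont_q.continuousOn.mul huc).sub (hP.cont_m.continuousOn.mul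
      ((continuousOn_const.mul (huc.sup continuousOn_const)).sub
        (continuousOn_const.mul (huc.neg.sup continuousOn_const))))) hfd
  have hT₁ := left_mem_Icc.2 hT.le
  have hT₂ := right_mem_Icc.2 hT.le
  have hUT₂ : U T₂ = 1 := by rw [hU hT₂, huR _ hsT₂.le, hw1]
  have hzero : {t ∈ Ioo T₁ T₂ | U t = 0} = {s} := by
    ext t
    constructor
    · rintro ⟨ht, h0⟩
      rw [hU (Ioo_subset_Icc_self ht)] at h0
      rcases lt_trichotomy t s with h | h | h
      · exact absurd h0 (huneg t ⟨ht.1.le, h⟩).ne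
      · exact h
      · exact absurd h0 (hupos t ⟨h, ht.2.le⟩).ne'
    · rintro rfl
      exact ⟨⟨hT₁s, hsT₂⟩, by rw [hU ⟨hT₁s.le, hsT₂.le⟩, huL _ le_rfl, hvs, mul_zero]⟩
  refine ⟨U, ⟨⟨T₂, hT₂, by rw [hUT₂]; exact one_ne_zero⟩, fun t => F t / p t, _,
    fun t ht => (hUd t ht).congr_deriv (by simp only [hF ht, hPp ht]),
    fun t ht => (hFd t ht).congr_of_eventuallyEq ?_, fun t ht => ?_, ?_, ?_⟩, ?_, ?_, ?_⟩
  · filter_upwards [hp0 t ht] with x hx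
    exact mul_div_cancel₀ _ hx
  · have ht' := Ioo_subset_Icc_self ht
    simp only [hU ht', hQq ht', hMm ht']
    ring
  · simp [hF hT₁, hfL _ hT₁s.le, hz1]
  · simp [hF hT₂, hfR _ hsT₂.le, hy1]
  · rw [hzero]; exact finite_singleton s
  · rw [hzero]; exact ncard_singleton s
  · rw [hUT₂]; exact one_pos

end

/-- Theorem 7 (i): the first curve `C₁^> ∩ (ℝ₊ × ℝ₊)`, when nonempty, is asymptotic
to the vertical line `{α} × ℝ` and the horizontal line `ℝ × {β}`, where `α, β > 0`
are determined by `ψ₂(α) = T₁^>` and `ψ₁(β) = T₂^>`. -/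
theorem fucik_first_curve_asymptotes
    (T₁ T₂ : ℝ) (hT : T₁ < T₂)
    (p q m : ℝ → ℝ)
    (hpc : ContinuousOn p (Set.Icc T₁ T₂)) (hqc : ContinuousOn q (Set.Icc T₁ T₂))
    (hmc : ContinuousOn m (Set.Icc T₁ T₂))
    (hppos : ∀ t ∈ Set.Icc T₁ T₂, 0 < p t) (hqpos : ∀ t ∈ Set.Icc T₁ T₂, 0 ≤ q t)
    (hm0 : ∃ t ∈ Set.Icc T₁ T₂, m t ≠ 0)
    (hmpos : ∃ t ∈ Set.Ioo T₁ T₂, 0 < m t)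
    (T₁gt T₂gt : ℝ)
    (hT₁gt : T₁gt = sInf {t : ℝ | t ∈ Set.Ioo T₁ T₂ ∧ 0 < m t})
    (hT₂gt : T₂gt = sSup {t : ℝ | t ∈ Set.Ioo T₁ T₂ ∧ 0 < m t})
    (α : ℝ) (hα : 0 < α) (w w' pw' : ℝ → ℝ)
    (hw : ∀ t ∈ Set.Icc T₁ T₂, HasDerivAt w (w' t) t)
    (hpw : ∀ t ∈ Set.Icc T₁ T₂, HasDerivAt (fun s => p s * w' s) (pw' t) t)
    (hweq : ∀ t ∈ Set.Icc T₁ T₂, -pw' t + q t * w t = α * m t * w t)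
    (hwT₂ : w T₂ = 1) (hw'T₂ : w' T₂ = 0)
    (hwzero : {t : ℝ | T₁ ≤ t ∧ t < T₂ ∧ w t = 0}.Nonempty ∧
      sSup {t : ℝ | T₁ ≤ t ∧ t < T₂ ∧ w t = 0} = T₁gt)
    (β : ℝ) (hβ : 0 < β) (v v' pv' : ℝ → ℝ)
    (hv : ∀ t ∈ Set.Icc T₁ T₂, HasDerivAt v (v' t) t)
    (hpv : ∀ t ∈ Set.Icc T₁ T₂, HasDerivAt (fun s => p s * v' s) (pv' t) t)
    (hveq : ∀ t ∈ Set.Icc T₁ T₂, -pv' t + q t * v t = β * m t * v t)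
    (hvT₁ : v T₁ = 1) (hv'T₁ : v' T₁ = 0)
    (hvzero : {t : ℝ | T₁ < t ∧ t ≤ T₂ ∧ v t = 0}.Nonempty ∧
      sInf {t : ℝ | T₁ < t ∧ t ≤ T₂ ∧ v t = 0} = T₂gt)
    (hCne : (CGT1 T₁ T₂ p q m 1 ∩ {ab : ℝ × ℝ | 0 < ab.1 ∧ 0 < ab.2}).Nonempty) :
    (∀ ab ∈ CGT1 T₁ T₂ p q m 1 ∩ {ab : ℝ × ℝ | 0 < ab.1 ∧ 0 < ab.2},
      α < ab.1 ∧ β < ab.2) ∧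
    (∀ ε : ℝ, 0 < ε → ∀ M : ℝ,
      ∃ ab ∈ CGT1 T₁ T₂ p q m 1 ∩ {ab : ℝ × ℝ | 0 < ab.1 ∧ 0 < ab.2},
        ab.1 < α + ε ∧ M < ab.2) ∧
    (∀ ε : ℝ, 0 < ε → ∀ M : ℝ,
      ∃ ab ∈ CGT1 T₁ T₂ p q m 1 ∩ {ab : ℝ × ℝ | 0 < ab.1 ∧ 0 < ab.2},
        ab.2 < β + ε ∧ M < ab.1) := by
  obtain ⟨P, hPc, hPp, hPx⟩ := hpc.exists_continuous_eqOn_Icc hT.le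
  obtain ⟨Q, hQc, hQq, hQx⟩ := hqc.exists_continuous_eqOn_Icc hT.le
  obtain ⟨M, hMc, hMm, -⟩ := hmc.exists_continuous_eqOn_Icc hT.le
  have hP : SLCoeff P Q M := ⟨hPc, hQc, hMc,
    fun t => by obtain ⟨x, hx, e⟩ := hPx t; exact e ▸ hppos x hx,
    fun t => by obtain ⟨x, hx, e⟩ := hQx t; exact e ▸ hqpos x hx⟩
  have hne : {t : ℝ | t ∈ Ioo T₁ T₂ ∧ 0 < m t}.Nonempty := hmpos
  have hbelow : BddBelow {t : ℝ | t ∈ Ioo T₁ T₂ ∧ 0 < m t} := ⟨T₁, fun t ht => ht.1.1.le⟩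
  have habove : BddAbove {t : ℝ | t ∈ Ioo T₁ T₂ ∧ 0 < m t} := ⟨T₂, fun t ht => ht.1.2.le⟩
  have hT₁gt_le : ∀ t ∈ Ioo T₁ T₂, 0 < m t → T₁gt ≤ t := fun t ht h =>
    hT₁gt ▸ csInf_le hbelow ⟨ht, h⟩
  have hle_T₂gt : ∀ t ∈ Ioo T₁ T₂, 0 < m t → t ≤ T₂gt := fun t ht h =>
    hT₂gt ▸ le_csSup habove ⟨ht, h⟩
  have hT₁le : T₁ ≤ T₁gt := hT₁gt ▸ le_csInf hne fun t ht => ht.1.1.le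
  have hleT₂ : T₂gt ≤ T₂ := hT₂gt ▸ csSup_le hne fun t ht => ht.1.2.le
  have hnearL : ∀ s > T₁gt, ∃ t ∈ Ioo T₁ s, 0 < M t := by
    intro s hs
    rw [hT₁gt] at hs
    obtain ⟨t, ht, hts⟩ := exists_lt_of_csInf_lt hne hs
    exact ⟨t, ⟨ht.1.1, hts⟩, by rw [hMm (Ioo_subset_Icc_self ht.1)]; exact ht.2⟩
  have hnearR : ∀ s > -T₂gt, ∃ t ∈ Ioo (-T₂) s, 0 < M (-t) := by
    intro s hs
    obtain ⟨t, ht, hts⟩ := exists_lt_of_lt_csSup hne (b := -s) (by rw [← hT₂gt]; linarith)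
    exact ⟨-t, ⟨by linarith [ht.1.2], by linarith⟩, by
      rw [neg_neg, hMm (Ioo_subset_Icc_self ht.1)]; exact ht.2⟩
  obtain ⟨t₀, ht₀, hmt₀⟩ := hmpos
  have hT₁₂ : T₁gt < T₂gt := by
    have hev : ∀ᶠ t in 𝓝 t₀, 0 < M t ∧ t ∈ Ioo T₁ T₂ :=
      (hMc.continuousAt.eventually (lt_mem_nhds
        (by rw [hMm (Ioo_subset_Icc_self ht₀)]; exact hmt₀))).and (Ioo_mem_nhds ht₀.1 ht₀.2)
    obtain ⟨t, ht, hMt, htI⟩ := hev.exists_gt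
    rw [hMm (Ioo_subset_Icc_self htI)] at hMt
    exact ((hT₁gt_le t₀ ht₀ hmt₀).trans_lt ht).trans_le (hle_T₂gt t htI hMt)
  have hnonposL : ∀ t ∈ Ioo T₁ T₁gt, M t ≤ 0 := fun t ht => by
    have htI : t ∈ Ioo T₁ T₂ := ⟨ht.1, (ht.2.trans hT₁₂).trans_le hleT₂⟩
    rw [hMm (Ioo_subset_Icc_self htI)]
    exact not_lt.1 fun h => absurd (hT₁gt_le t htI h) (not_le.2 ht.2)
  have hnonposR : ∀ t ∈ Ioo T₂gt T₂, M t ≤ 0 := fun t ht => by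
    have htI : t ∈ Ioo T₁ T₂ := ⟨(hT₁le.trans_lt hT₁₂).trans ht.1, ht.2⟩
    rw [hMm (Ioo_subset_Icc_self htI)]
    exact not_lt.1 fun h => absurd (hle_T₂gt t htI h) (not_le.2 ht.1)
  have hnonposL' : ∀ t ∈ Ioo (-T₁gt) (-T₁), M (-t) ≤ 0 := fun t ht =>
    hnonposL _ ⟨by linarith [ht.2], by linarith [ht.1]⟩
  have hnonposR' : ∀ t ∈ Ioo (-T₂) (-T₂gt), M (-t) ≤ 0 := fun t ht =>
    hnonposR _ ⟨by linarith [ht.2], by linarith [ht.1]⟩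
  have hvsol : IsSLSol P Q M β T₁ T₂ v (fun t => p t * v' t) :=
    IsSLSol.of_hasDerivAt hP (hPp.mono Ioo_subset_Icc_self) (hQq.mono Ioo_subset_Icc_self)
      (hMm.mono Ioo_subset_Icc_self) hv hpv fun t ht => hveq t (Ioo_subset_Icc_self ht)
  have hwsol := (IsSLSol.of_hasDerivAt hP (hPp.mono Ioo_subset_Icc_self)
    (hQq.mono Ioo_subset_Icc_self) (hMm.mono Ioo_subset_Icc_self) hw hpw
    fun t ht => hweq t (Ioo_subset_Icc_self ht)).reflect
  have heigL : IsNDEigenvalue P Q M T₁ T₂gt β :=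
    IsNDEigenvalue.of_first_zero hvsol hvT₁ (by simp [hv'T₁]) hvzero.1 hvzero.2
  have hset : {t | -T₂ < t ∧ t ≤ -T₁ ∧ w (-t) = 0} = -{t : ℝ | T₁ ≤ t ∧ t < T₂ ∧ w t = 0} := by
    ext t
    simp only [mem_ofPred_eq, Set.mem_neg]
    exact ⟨fun h => ⟨by linarith [h.2.1], by linarith [h.1], h.2.2⟩,
      fun h => ⟨by linarith [h.2.1], by linarith [h.1], h.2.2⟩⟩
  have heigR : IsNDEigenvalue (fun t => P (-t)) (fun t => Q (-t)) (fun t => M (-t)) (-T₂)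
      (-T₁gt) α :=
    IsNDEigenvalue.of_first_zero hwsol (by simp [hwT₂]) (by simp [hw'T₂])
      (by rw [hset]; exact hwzero.1.neg) (by rw [hset, Real.sInf_neg, hwzero.2])
  have hfluxL := heigL.flux_ne_zero hP hleT₂ hβ.le hnonposR hvsol hvT₁ (by simp [hv'T₁])
  have hfluxR := heigR.flux_ne_zero hP.reflect (by linarith) hα.le hnonposL' hwsol
    (by simp [hwT₂]) (by simp [hw'T₂])
  rw [neg_neg, neg_ne_zero] at hfluxR
  have hp0 : ∀ t ∈ Icc T₁ T₂, ∀ᶠ x in 𝓝 t, p x ≠ 0 := by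
    intro t ht
    rcases ht.1.eq_or_lt with e | e
    · subst e
      filter_upwards [(hpw T₁ ht).continuousAt.eventually_ne hfluxR] with x hx
      exact left_ne_zero_of_mul hx
    rcases ht.2.eq_or_lt with e' | e'
    · subst e'
      filter_upwards [(hpv t ht).continuousAt.eventually_ne hfluxL] with x hx
      exact left_ne_zero_of_mul hx
    · filter_upwards [Ioo_mem_nhds e e'] with x hx
      exact (hppos x (Ioo_subset_Icc_self hx)).ne'
  refine ⟨?_, ?_, ?_⟩
  · rintro ⟨a, b⟩ ⟨h, ha, hb⟩
    obtain ⟨s, hL, hR⟩ := exists_isNDEigenvalue_of_mem_CGT1 hP hPp hQq hMm h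
    have h1 := hL.lt_of_weight_nonpos hP hb.le hnonposL
    have h2 := hR.lt_of_weight_nonpos hP.reflect ha.le hnonposR'
    exact ⟨hR.lt_of_lt hP.reflect ha heigR (by linarith), hL.lt_of_lt hP hb heigL (by linarith)⟩
  · intro ε hε B
    obtain ⟨s, a, b, ha, haε, hb, hbB, hR, hL⟩ := exists_isNDEigenvalue_pair hP.reflect hP
      (neg_le_neg hleT₂) (hT₁le.trans_eq (neg_neg _).symm) (neg_lt_neg hT₁₂) hnearR
      (by simpa using hnearL) (by simpa using hnonposL) hα hβ heigR (by simpa using heigL) hε B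
    exact ⟨(a, b), ⟨mem_CGT1_of_isNDEigenvalue hP hPp hQq hMm hp0 hL (by simpa using hR), ha, hb⟩,
      haε, hbB⟩
  · intro ε hε B
    obtain ⟨s, b, a, hb, hbε, ha, haB, hL, hR⟩ := exists_isNDEigenvalue_pair hP hP.reflect
      hT₁le (by linarith) hT₁₂ hnearL hnearR hnonposR' hβ hα heigL heigR hε B
    exact ⟨(a, b), ⟨mem_CGT1_of_isNDEigenvalue hP hPp hQq hMm hp0 hL hR, ha, hb⟩, hbε, haB⟩
end
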